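/- Let K be a number field of degree d with r₁ real embeddings and r₂ pairs of complex embeddings, and let H(s) = ζ_K(s)·(s-1), an entire function. Unconditionally, for any real t > 1/2 with H(t) ≠ 0 and any x ≥ 2, one has -H'(t)/H(t) ≤ Σ_{2 ≤ n ≤ x} d·Λ(n)/n^t · (log(x/n)/log x) + (1/log x)·(d/ds)(H'/H)(t) + (1/log x)·Re Σ_ρ m_ρ · x^{ρ-t}/(ρ-t)² + ((r₁+r₂)/log x)·Σ_{n=0}^∞ x^{-2n-t}/(2n+t)² + (r₂/log x)·Σ_{n=0}^∞ x^{-2n-1-t}/(2n+1+t)², where ρ runs over the zeros of ζ_K with 0 < Re ρ < 1, each counted with its multiplicity m_ρ. -/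

import Mathlib

section
open MeasureTheory Complex

/-- product summability over `ι → ℤ` -/
lemma summable_pi_prod {ι : Type*} [Fintype ι] {β : Type*} (f : β → ℝ) (hf : ∀ b, 0 ≤ f b)
    (hs : Summable f) : Summable (fun k : ι → β => ∏ i, f (k i)) := by
  classical
  refine summable_of_sum_le (c := ∏ _i : ι, ∑' b, f b)
    (fun k => Finset.prod_nonneg fun i _ => hf _) fun s => ?_
  let t : ι → Finset β := fun i => s.image (fun k => k i)
  have hsub : s ⊆ Fintype.piFinset t := by
    intro k hk
    rw [Fintype.mem_piFinset]
    intro i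
    exact Finset.mem_image_of_mem (fun k : ι → β => k i) hk
  calc ∑ k ∈ s, ∏ i, f (k i) ≤ ∑ k ∈ Fintype.piFinset t, ∏ i, f (k i) :=
        Finset.sum_le_sum_of_subset_of_nonneg hsub
          (fun k _ _ => Finset.prod_nonneg fun i _ => hf _)
    _ = ∏ i, ∑ b ∈ t i, f b := (Finset.prod_univ_sum t (fun _ b => f b)).symm
    _ ≤ ∏ _i : ι, ∑' b, f b := by
        refine Finset.prod_le_prod (fun i _ => Finset.sum_nonneg fun b _ => hf b) fun i _ => ?_
        exact hs.sum_le_tsum _ (fun b _ => hf b)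

lemma summable_int_gauss (c : ℝ) (hc : 0 < c) :
    Summable (fun k : ℤ => Real.exp (-c * (k : ℝ) ^ 2)) := by
  have h1 : Summable (fun n : ℕ => Real.exp (-c * (n : ℝ))) := by
    have := Real.summable_exp_nat_mul_iff.mpr (show -c < 0 by linarith)
    refine this.congr fun n => by ring_nf
  have h2 : Summable (fun n : ℕ => Real.exp (-c * (n : ℝ) ^ 2)) := by
    refine Summable.of_nonneg_of_le (fun _ => (Real.exp_pos _).le) (fun n => ?_) h1
    apply Real.exp_le_exp.mpr
    rcases Nat.eq_zero_or_pos n with h | h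
    · simp [h]
    · have : (1:ℝ) ≤ n := by exact_mod_cast h
      nlinarith [mul_le_mul_of_nonneg_left (show (n:ℝ) ≤ n^2 by nlinarith) hc.le]
  refine Summable.of_nat_of_neg ?_ ?_
  · simpa using h2
  · simpa using h2

lemma summable_gauss_pi {ι : Type*} [Fintype ι] (c : ℝ) (hc : 0 < c) :
    Summable (fun k : ι → ℤ => Real.exp (-c * ∑ i, (k i : ℝ) ^ 2)) := by
  refine (summable_pi_prod _ (fun _ => (Real.exp_pos _).le) (summable_int_gauss c hc)).congr
    fun k => ?_
  rw [← Real.exp_sum, Finset.mul_sum]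

lemma integrable_gauss_pi {ι : Type*} [Fintype ι] (c : ℝ) (hc : 0 < c) :
    Integrable (fun x : ι → ℝ => Real.exp (-c * ∑ i, (x i) ^ 2)) := by
  have := Integrable.fintype_prod (ι := ι) (E := ℝ) (μ := fun _ => volume)
    (f := fun _ (x : ℝ) => Real.exp (-c * x ^ 2))
    (fun _ => integrable_exp_neg_mul_sq hc)
  refine this.congr (Filter.Eventually.of_forall fun x => ?_)
  simp only
  rw [← Real.exp_sum, Finset.mul_sum]

section
variable {ι : Type*} [Fintype ι]

lemma gauss_shift_bound (c C : ℝ) (hc : 0 < c) (hC : 0 ≤ C) (F : (ι → ℝ) → ℂ)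
    (hb : ∀ x, ‖F x‖ ≤ C * Real.exp (-c * ∑ i, x i ^ 2)) (x : ι → ℝ) (k : ι → ℤ) :
    ‖F (fun i => x i + k i)‖ ≤
      C * Real.exp (c * ∑ i, x i ^ 2) * Real.exp (-(c / 2) * ∑ i, (k i : ℝ) ^ 2) := by
  refine (hb _).trans ?_
  rw [mul_assoc, ← Real.exp_add]
  refine mul_le_mul_of_nonneg_left (Real.exp_le_exp.mpr ?_) hC
  have : ∑ i, ((k i : ℝ) ^ 2 / 2 - x i ^ 2) ≤ ∑ i, (x i + k i) ^ 2 := by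
    refine Finset.sum_le_sum fun i _ => ?_
    nlinarith [sq_nonneg (2 * x i + k i)]
  rw [Finset.sum_sub_distrib, ← Finset.sum_div] at this
  nlinarith

lemma periodize_continuous (c C : ℝ) (hc : 0 < c) (hC : 0 ≤ C) (F : (ι → ℝ) → ℂ)
    (hF : Continuous F)
    (hb : ∀ x, ‖F x‖ ≤ C * Real.exp (-c * ∑ i, x i ^ 2)) :
    Continuous (fun x : ι → ℝ => ∑' k : ι → ℤ, F (fun i => x i + k i)) := by
  rw [continuous_iff_continuousAt]
  intro x0
  set B := c * ∑ i, x0 i ^ 2 + 1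
  have hopen : IsOpen {x : ι → ℝ | c * ∑ i, x i ^ 2 < B} :=
    isOpen_lt (by fun_prop) continuous_const
  refine ContinuousOn.continuousAt (s := {x : ι → ℝ | c * ∑ i, x i ^ 2 < B}) ?_
    (hopen.mem_nhds (by simp [B]))
  refine continuousOn_tsum (u := fun k : ι → ℤ => C * Real.exp B *
    Real.exp (-(c / 2) * ∑ i, (k i : ℝ) ^ 2)) (fun k => ?_) ?_ ?_
  · exact (hF.comp (by fun_prop)).continuousOn
  · exact (summable_gauss_pi (c / 2) (by linarith)).mul_left _
  · intro k x hx
    refine (gauss_shift_bound c C hc hC F hb x k).trans ?_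
    gcongr
    exact le_of_lt hx

/-- the unit box -/
def ubox (a : ι → ℤ) : Set (ι → ℝ) := {x : ι → ℝ | ∀ i, x i ∈ Set.Ioc (a i : ℝ) (a i + 1)}

lemma ubox_eq_pi (a : ι → ℤ) :
    ubox a = Set.univ.pi (fun i => Set.Ioc (a i : ℝ) (a i + 1)) := by
  ext x; simp [ubox]

lemma ubox_meas (a : ι → ℤ) : MeasurableSet (ubox a) := by
  rw [ubox_eq_pi]
  exact MeasurableSet.univ_pi fun i => measurableSet_Ioc

lemma ubox_iUnion : (⋃ a : ι → ℤ, ubox a) = Set.univ := by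
  ext x
  simp only [Set.mem_iUnion, Set.mem_univ, iff_true]
  refine ⟨fun i => ⌈x i⌉ - 1, fun i => ⟨?_, ?_⟩⟩
  · push_cast
    linarith [Int.ceil_lt_add_one (x i)]
  · push_cast
    linarith [Int.le_ceil (x i)]

lemma ubox_disj : Pairwise (Function.onFun Disjoint (ubox (ι := ι))) := by
  intro a b hab
  rw [Function.onFun, Set.disjoint_left]
  intro x hxa hxb
  apply hab
  funext i
  have h1 := hxa i
  have h2 := hxb i
  have e1 : (a i : ℝ) < b i + 1 := lt_of_lt_of_le h1.1 h2.2
  have e2 : (b i : ℝ) < a i + 1 := lt_of_lt_of_le h2.1 h1.2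
  have e1' : a i < b i + 1 := by exact_mod_cast e1
  have e2' : b i < a i + 1 := by exact_mod_cast e2
  omega

lemma setIntegral_ubox (g : (ι → ℝ) → ℂ) (k : ι → ℤ) :
    ∫ x in ubox k, g x = ∫ x in ubox 0, g (fun i => x i + k i) := by
  have hmp : MeasurePreserving (fun x : ι → ℝ => x + (fun i => (k i : ℝ))) volume volume :=
    measurePreserving_add_right volume _
  have := hmp.setIntegral_preimage_emb
    (MeasurableEquiv.addRight (fun i => (k i : ℝ))).measurableEmbedding g (ubox k)
  rw [← this]
  have hset : (fun x : ι → ℝ => x + (fun i => (k i : ℝ))) ⁻¹' ubox k = ubox 0 := by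
    ext x
    simp only [ubox, Set.mem_preimage, Set.mem_ofPred_eq, Set.mem_Ioc, Pi.add_apply, Pi.zero_apply,
      Int.cast_zero, zero_add]
    refine forall_congr' fun i => ?_
    constructor <;> rintro ⟨h1, h2⟩ <;> constructor <;> linarith
  rw [hset]
  rfl

lemma integral_eq_periodize (c C : ℝ) (hc : 0 < c) (hC : 0 ≤ C) (F : (ι → ℝ) → ℂ)
    (hF : Continuous F)
    (hb : ∀ x, ‖F x‖ ≤ C * Real.exp (-c * ∑ i, x i ^ 2)) :
    ∫ x, F x = ∫ x in ubox 0, ∑' k : ι → ℤ, F (fun i => x i + k i) := by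
  have hintg : Integrable F := by
    refine Integrable.mono' ((integrable_gauss_pi c hc).const_mul C) hF.aestronglyMeasurable
      (Filter.Eventually.of_forall hb)
  have h1 : ∫ x, F x = ∑' k : ι → ℤ, ∫ x in ubox k, F x := by
    rw [← setIntegral_univ, ← ubox_iUnion]
    exact integral_iUnion (fun k => ubox_meas k) ubox_disj (by
      rw [ubox_iUnion]; exact hintg.integrableOn)
  rw [h1]
  simp_rw [setIntegral_ubox F]
  have hvol : volume (ubox (0 : ι → ℤ)) ≠ ⊤ := by
    rw [ubox_eq_pi, Real.volume_pi_Ioc]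
    simp
  have hbd : ∀ k : ι → ℤ, ∀ x ∈ ubox (0 : ι → ℤ), ‖F (fun i => x i + k i)‖ ≤
      C * Real.exp (c * (Fintype.card ι)) * Real.exp (-(c / 2) * ∑ i, (k i : ℝ) ^ 2) := by
    intro k x hx
    refine (gauss_shift_bound c C hc hC F hb x k).trans ?_
    gcongr
    calc ∑ i, x i ^ 2 ≤ ∑ _i : ι, (1:ℝ) := by
          refine Finset.sum_le_sum fun i _ => ?_
          have := hx i
          simp only [Pi.zero_apply, Int.cast_zero, zero_add, Set.mem_Ioc] at this
          nlinarith
      _ = Fintype.card ι := by simp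
  have hintgk : ∀ k : ι → ℤ, IntegrableOn (fun x : ι → ℝ => F (fun i => x i + k i)) (ubox 0) :=
    fun k => (hintg.comp_add_right (fun i => (k i : ℝ))).integrableOn
  refine (hasSum_integral_of_summable_integral_norm hintgk ?_).tsum_eq
  refine Summable.of_nonneg_of_le (fun k => integral_nonneg fun x => norm_nonneg _)
    (fun k => ?_) ((((summable_gauss_pi (ι := ι) (c / 2) (by linarith)).mul_left
      (C * Real.exp (c * (Fintype.card ι)))).mul_right (volume.real (ubox (0 : ι → ℤ)))))
  calc _ ≤ ‖∫ x in ubox (0 : ι → ℤ), ‖F (fun i => x i + k i)‖‖ := Real.le_norm_self _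
    _ ≤ _ := norm_setIntegral_le_of_norm_le_const hvol.lt_top (fun x hx => by
        simpa using hbd k x hx)

theorem poisson_pi (c C : ℝ) (hc : 0 < c) (hC : 0 ≤ C) (F : (ι → ℝ) → ℂ)
    (hF : Continuous F)
    (hb : ∀ x, ‖F x‖ ≤ C * Real.exp (-c * ∑ i, x i ^ 2))
    (hs : Summable fun k : ι → ℤ =>
      ∫ x : ι → ℝ, cexp (-(2 * Real.pi * I * ∑ i, (k i : ℂ) * x i)) * F x) :
    ∑' k : ι → ℤ, F (fun i => (k i : ℝ)) = ∑' k : ι → ℤ,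
      ∫ x : ι → ℝ, cexp (-(2 * Real.pi * I * ∑ i, (k i : ℂ) * x i)) * F x := by
  let π : (ι → ℝ) → UnitAddTorus ι := Pi.map (fun _ => ((↑) : ℝ → UnitAddCircle))
  have hπ : IsOpenQuotientMap π := IsOpenQuotientMap.piMap
    (fun _ => QuotientAddGroup.isOpenQuotientMap_mk)
  let P : C((ι → ℝ), ℂ) := ⟨_, periodize_continuous c C hc hC F hF hb⟩
  have hP : ∀ x, P x = ∑' k : ι → ℤ, F (fun i => x i + k i) := fun x => rfl
  have hfac : Function.FactorsThrough P π := by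
    intro x y hxy
    have : ∀ i, ∃ n : ℤ, x i + n = y i := by
      intro i
      have h := congrFun hxy i
      have h' : ((x i : ℝ) : UnitAddCircle) = (y i : ℝ) := h
      rw [eq_comm, QuotientAddGroup.eq_iff_sub_mem, AddSubgroup.mem_zmultiples_iff] at h'
      obtain ⟨n, hn⟩ := h'
      exact ⟨n, by simp at hn; linarith⟩
    choose n hn using this
    rw [hP, hP]
    rw [← (Equiv.addRight (fun i => n i : ι → ℤ)).tsum_eq]
    refine tsum_congr fun k => ?_
    congr 1
    funext i
    simp only [Equiv.coe_addRight, Pi.add_apply, Int.cast_add]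
    rw [← hn i]; ring
  let πc : C((ι → ℝ), UnitAddTorus ι) := ⟨π, hπ.continuous⟩
  have hπq : Topology.IsQuotientMap (πc : (ι → ℝ) → UnitAddTorus ι) := hπ.isQuotientMap
  have hfac : Function.FactorsThrough P πc := hfac
  let f : C(UnitAddTorus ι, ℂ) := hπq.lift P hfac
  have hf : ∀ x, f (π x) = P x := fun x => by
    have := hπq.lift_comp P hfac
    exact congrArg (fun g => g x) this
  have hmf : ∀ (n : ι → ℤ) (x : ι → ℝ), UnitAddTorus.mFourier (-n) (fun i => (x i : UnitAddCircle))
      = cexp (-(2 * Real.pi * I * ∑ i, (n i : ℂ) * x i)) := by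
    intro n x
    simp only [UnitAddTorus.mFourier, ContinuousMap.coe_mk, fourier_coe_apply]
    rw [← Complex.exp_sum, Finset.mul_sum, ← Finset.sum_neg_distrib]
    congr 1
    refine Finset.sum_congr rfl fun i _ => ?_
    simp; ring
  have hcoef : ∀ n : ι → ℤ, UnitAddTorus.mFourierCoeff f n =
      ∫ x : ι → ℝ, cexp (-(2 * Real.pi * I * ∑ i, (n i : ℂ) * x i)) * F x := by
    intro n
    rw [UnitAddTorus.mFourierCoeff_eq_integral f n 0,
      integral_eq_periodize c C hc hC (fun x : ι → ℝ =>
        cexp (-(2 * Real.pi * I * ∑ i, (n i : ℂ) * x i)) * F x) (by fun_prop) ?_]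
    · have hset : {x : ι → ℝ | ∀ i, x i ∈ Set.Ioc ((0 : ι → ℝ) i) ((0 : ι → ℝ) i + 1)} = ubox 0 := by
        ext x; simp [ubox]
      rw [hset]
      refine integral_congr_ae (Filter.Eventually.of_forall fun x => ?_)
      simp only
      rw [hmf]
      have : f (fun i => (x i : UnitAddCircle)) = P x := hf x
      rw [this, hP, smul_eq_mul, ← tsum_mul_left]
      refine tsum_congr fun k => ?_
      congr 1
      rw [Complex.exp_eq_exp_iff_exists_int]
      refine ⟨∑ i, n i * k i, ?_⟩
      push_cast
      simp only [mul_add, Finset.sum_add_distrib]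
      ring
    · intro x
      rw [norm_mul, Complex.norm_exp]
      have : (-(2 * Real.pi * I * ∑ i, (n i : ℂ) * x i)).re = 0 := by
        have h2 : ∑ i, (n i : ℂ) * x i = ((∑ i, (n i : ℝ) * x i : ℝ) : ℂ) := by push_cast; rfl
        rw [h2]
        simp
      rw [this, Real.exp_zero, one_mul]
      exact hb x
  have hsum : Summable (UnitAddTorus.mFourierCoeff f) := by
    refine hs.congr fun k => (hcoef k).symm
  have hfin := (UnitAddTorus.hasSum_mFourier_series_apply_of_summable hsum (π 0)).tsum_eq
  rw [hf, hP] at hfin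
  simp only [Pi.zero_apply, zero_add] at hfin
  rw [← hfin]
  refine tsum_congr fun k => ?_
  rw [hcoef]
  have : UnitAddTorus.mFourier k (π 0) = 1 := by
    simp [UnitAddTorus.mFourier, π]
  rw [this, smul_eq_mul, mul_one]

end

end

section
open MeasureTheory Complex Matrix

section
variable {ι : Type*} [Fintype ι] [DecidableEq ι]

lemma gau_lower (B A : Matrix ι ι ℝ) (hBA : B * A = 1) :
    ∃ c : ℝ, 0 < c ∧ ∀ x : ι → ℝ, c * ∑ i, x i ^ 2 ≤ ∑ i, (A *ᵥ x) i ^ 2 := by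
  set S := ∑ i, ∑ j, B i j ^ 2 with hS
  have hS0 : 0 ≤ S := Finset.sum_nonneg fun i _ => Finset.sum_nonneg fun j _ => sq_nonneg _
  refine ⟨1 / (S + 1), by positivity, fun x => ?_⟩
  have hx : x = B *ᵥ (A *ᵥ x) := by rw [mulVec_mulVec, hBA, one_mulVec]
  have h1 : ∑ i, x i ^ 2 ≤ S * ∑ j, (A *ᵥ x) j ^ 2 := by
    conv_lhs => rw [hx]
    rw [hS, Finset.sum_mul]
    refine Finset.sum_le_sum fun i _ => ?_
    simp only [mulVec, dotProduct]
    exact Finset.sum_mul_sq_le_sq_mul_sq _ _ _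
  have h2 : 0 ≤ ∑ j, (A *ᵥ x) j ^ 2 := Finset.sum_nonneg fun j _ => sq_nonneg _
  rw [div_mul_eq_mul_div, one_mul, div_le_iff₀ (by positivity)]
  nlinarith

lemma gau_1d (a : ℝ) : ∫ y : ℝ, cexp (-(2 * Real.pi * I * (a * y))) * cexp (-(Real.pi * y ^ 2))
    = cexp (-(Real.pi * a ^ 2)) := by
  have h := fourierIntegral_gaussian (b := (Real.pi : ℂ)) (by simpa using Real.pi_pos)
    (-2 * Real.pi * a)
  have hpi : (Real.pi : ℂ) ≠ 0 := by exact_mod_cast Real.pi_ne_zero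
  rw [div_self hpi, one_cpow, one_mul] at h
  have h2 : -(-2 * (Real.pi : ℂ) * a) ^ 2 / (4 * Real.pi) = -(Real.pi * a ^ 2) := by
    field_simp; ring
  rw [h2] at h
  rw [← h]
  refine integral_congr_ae (Filter.Eventually.of_forall fun y => ?_)
  simp only
  congr 2 <;> ring

lemma gau_nd (a : ι → ℝ) :
    ∫ y : ι → ℝ, cexp (-(2 * Real.pi * I * ∑ i, (a i : ℂ) * y i)) * cexp (-(Real.pi * ∑ i, (y i : ℂ) ^ 2))
    = cexp (-(Real.pi * ∑ i, (a i : ℂ) ^ 2)) := by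
  have := integral_fintype_prod_volume_eq_prod (E := fun _ : ι => ℝ)
    (fun i (y : ℝ) => cexp (-(2 * Real.pi * I * (a i * y))) * cexp (-(Real.pi * y ^ 2)))
  simp only [gau_1d] at this
  rw [← Complex.exp_sum, Finset.sum_neg_distrib, ← Finset.mul_sum] at this
  rw [← this]
  refine integral_congr_ae (Filter.Eventually.of_forall fun y => ?_)
  simp only
  rw [Finset.prod_mul_distrib, ← Complex.exp_sum, ← Complex.exp_sum, Finset.sum_neg_distrib,
    Finset.sum_neg_distrib, ← Finset.mul_sum, ← Finset.mul_sum]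

lemma gau_mat (A B : Matrix ι ι ℝ) (hAB : A * B = 1) (k : ι → ℝ) :
    ∫ x : ι → ℝ, cexp (-(2 * Real.pi * I * ∑ i, (k i : ℂ) * x i)) *
      cexp (-(Real.pi * ∑ i, ((A *ᵥ x) i : ℂ) ^ 2))
    = |A.det|⁻¹ * cexp (-(Real.pi * ∑ i, ((k ᵥ* B) i : ℂ) ^ 2)) := by
  have hBA : B * A = 1 := mul_eq_one_comm.mp hAB
  have hdet : A.det ≠ 0 := by
    have : A.det * B.det = 1 := by rw [← det_mul, hAB, det_one]
    exact left_ne_zero_of_mul_eq_one this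
  rw [← gau_nd]
  have hmap := Real.map_matrix_volume_pi_eq_smul_volume_pi hdet
  set g : (ι → ℝ) → ℂ := fun y => cexp (-(2 * Real.pi * I * ∑ i, ((k ᵥ* B) i : ℂ) * y i)) *
    cexp (-(Real.pi * ∑ i, (y i : ℂ) ^ 2)) with hg
  have h1 : ∫ x, g (toLin' A x) = ∫ y, g y ∂(Measure.map (toLin' A) volume) := by
    rw [integral_map]
    · exact (LinearMap.continuous_of_finiteDimensional _).measurable.aemeasurable
    · exact Continuous.aestronglyMeasurable (by rw [hg]; fun_prop)
  rw [hmap, integral_smul_measure, ENNReal.toReal_ofReal (abs_nonneg _), abs_inv] at h1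
  rw [← Complex.real_smul, ← h1]
  refine integral_congr_ae (Filter.Eventually.of_forall fun x => ?_)
  simp only [hg, toLin'_apply]
  congr 4
  have : (k ᵥ* B) ⬝ᵥ (A *ᵥ x) = k ⬝ᵥ x := by
    rw [dotProduct_mulVec, vecMul_vecMul, hBA, vecMul_one]
  simp only [dotProduct] at this
  exact_mod_cast this.symm

/-- Poisson summation for Gaussians. -/
theorem gauss_poisson (A B : Matrix ι ι ℝ) (hAB : A * B = 1) :
    ∑' k : ι → ℤ, Real.exp (-(Real.pi * ∑ i, (A *ᵥ (fun j => (k j : ℝ))) i ^ 2)) =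
      |A.det|⁻¹ * ∑' k : ι → ℤ, Real.exp (-(Real.pi * ∑ i, ((fun j => (k j : ℝ)) ᵥ* B) i ^ 2)) := by
  have hBA : B * A = 1 := mul_eq_one_comm.mp hAB
  obtain ⟨c, hc, hc'⟩ := gau_lower B A hBA
  obtain ⟨c2, hc2, hc2'⟩ := gau_lower Aᵀ Bᵀ (by rw [← transpose_mul, hBA, transpose_one])
  have hpi := Real.pi_pos
  have hintg : ∀ k : ι → ℤ, ∫ x : ι → ℝ, cexp (-(2 * Real.pi * I * ∑ i, (k i : ℂ) * x i)) *
      cexp (-(Real.pi * ∑ i, ((A *ᵥ x) i : ℂ) ^ 2)) =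
      ((|A.det|⁻¹ * Real.exp (-(Real.pi * ∑ i, ((fun j => (k j : ℝ)) ᵥ* B) i ^ 2)) : ℝ) : ℂ) := by
    intro k
    have := gau_mat A B hAB (fun j => (k j : ℝ))
    simp only [ofReal_intCast] at this
    rw [this]
    push_cast
    rfl
  have hs2 : Summable fun k : ι → ℤ =>
      |A.det|⁻¹ * Real.exp (-(Real.pi * ∑ i, ((fun j => (k j : ℝ)) ᵥ* B) i ^ 2)) := by
    refine Summable.mul_left _ ?_
    refine Summable.of_nonneg_of_le (fun _ => (Real.exp_pos _).le) (fun k => ?_)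
      (summable_gauss_pi (ι := ι) (Real.pi * c2) (by positivity))
    apply Real.exp_le_exp.mpr
    have h := hc2' (fun j => (k j : ℝ))
    simp only [mulVec_transpose] at h
    nlinarith
  have := poisson_pi (Real.pi * c) 1 (by positivity) zero_le_one
    (fun x => cexp (-(Real.pi * ∑ i, ((A *ᵥ x) i : ℂ) ^ 2)))
    (by
      have : Continuous (fun x : ι → ℝ => A *ᵥ x) :=
        (toLin' A).continuous_of_finiteDimensional
      have h2 : ∀ i, Continuous (fun x : ι → ℝ => (A *ᵥ x) i) := fun i =>
        (continuous_apply i).comp this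
      fun_prop)
    (by
      intro x
      have : cexp (-(Real.pi * ∑ i, ((A *ᵥ x) i : ℂ) ^ 2)) =
        ((Real.exp (-(Real.pi * ∑ i, ((A *ᵥ x) i) ^ 2)) : ℝ) : ℂ) := by push_cast; rfl
      rw [this, Complex.norm_real, Real.norm_of_nonneg (Real.exp_pos _).le, one_mul]
      apply Real.exp_le_exp.mpr
      have := hc' x
      nlinarith)
    (by
      simp only [hintg]
      exact (Complex.hasSum_ofReal.mpr hs2.hasSum).summable)
  simp only [hintg] at this
  rw [← Complex.ofReal_tsum, tsum_mul_left] at this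
  apply Complex.ofReal_injective
  rw [← this, Complex.ofReal_tsum]
  refine tsum_congr fun k => ?_
  push_cast
  rfl

theorem summable_gauss_mat (A B : Matrix ι ι ℝ) (hAB : A * B = 1) :
    Summable fun k : ι → ℤ =>
      Real.exp (-(Real.pi * ∑ i, (A *ᵥ (fun j => (k j : ℝ))) i ^ 2)) := by
  obtain ⟨c, hc, hc'⟩ := gau_lower B A (mul_eq_one_comm.mp hAB)
  have hpi := Real.pi_pos
  refine Summable.of_nonneg_of_le (fun _ => (Real.exp_pos _).le) (fun k => ?_)
      (summable_gauss_pi (ι := ι) (Real.pi * c) (by positivity))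
  apply Real.exp_le_exp.mpr
  have h := hc' (fun j => (k j : ℝ))
  nlinarith

/-- version with positive definite matrix -/
theorem gauss_poisson_posDef (G : Matrix ι ι ℝ) (hG : G.PosDef) :
    (Summable fun k : ι → ℤ => Real.exp (-(Real.pi *
      ((fun j => (k j : ℝ)) ⬝ᵥ (G *ᵥ (fun j => (k j : ℝ))))))) ∧
    ∑' k : ι → ℤ, Real.exp (-(Real.pi * ((fun j => (k j : ℝ)) ⬝ᵥ (G *ᵥ (fun j => (k j : ℝ)))))) =
      (Real.sqrt G.det)⁻¹ * ∑' k : ι → ℤ, Real.exp (-(Real.pi *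
        ((fun j => (k j : ℝ)) ⬝ᵥ (G⁻¹ *ᵥ (fun j => (k j : ℝ)))))) := by
  obtain ⟨A, hA⟩ : ∃ A : Matrix ι ι ℝ, G = Aᴴ * A := by
    open scoped MatrixOrder Matrix.Norms.L2Operator in
    exact CStarAlgebra.nonneg_iff_eq_star_mul_self.mp hG.posSemidef.nonneg
  rw [conjTranspose_eq_transpose_of_trivial] at hA
  have hdet : G.det = A.det ^ 2 := by rw [hA, det_mul, det_transpose, sq]
  have hdA : IsUnit A.det := by
    rw [isUnit_iff_ne_zero]
    intro h
    have := hG.det_pos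
    rw [hdet, h] at this
    simp at this
  have h := gauss_poisson A A⁻¹ (mul_nonsing_inv A hdA)
  have e1 : ∀ x : ι → ℝ, ∑ i, (A *ᵥ x) i ^ 2 = x ⬝ᵥ (G *ᵥ x) := by
    intro x
    rw [hA, ← mulVec_mulVec, dotProduct_mulVec, vecMul_transpose]
    simp [dotProduct, sq]
  have e2 : ∀ x : ι → ℝ, ∑ i, (x ᵥ* A⁻¹) i ^ 2 = x ⬝ᵥ (G⁻¹ *ᵥ x) := by
    intro x
    rw [hA, Matrix.mul_inv_rev, ← mulVec_mulVec, dotProduct_mulVec, ← transpose_nonsing_inv,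
      mulVec_transpose]
    simp [dotProduct, sq]
  simp only [e1, e2] at h
  refine ⟨?_, ?_⟩
  · have := summable_gauss_mat A A⁻¹ (mul_nonsing_inv A hdA)
    simpa only [e1] using this
  · rw [h, hdet, Real.sqrt_sq_eq_abs]

end

end

section
open MeasureTheory Complex Matrix NumberField Module

section
variable {K : Type*} [Field K] [NumberField K]

/-- the quadratic form attached to weights at infinite places -/
noncomputable def qf (v : InfinitePlace K → ℝ) (a : K) : ℝ :=
  ∑ σ : K →+* ℂ, Real.exp (v (InfinitePlace.mk σ)) * ‖σ a‖ ^ 2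

lemma trace_ringhom (x : K) : ((Algebra.trace ℚ K x : ℚ) : ℂ) = ∑ σ : K →+* ℂ, σ x := by
  have := trace_eq_sum_embeddings (K := ℚ) (L := K) ℂ (x := x)
  rw [← (RingHom.equivRatAlgHom (R := K) (S := ℂ)).symm.sum_comp]
  simpa using this

variable {ι : Type*} [Fintype ι] [DecidableEq ι]

noncomputable def embMat (b : ι → K) : Matrix (K →+* ℂ) ι ℂ := Matrix.of fun σ i => σ (b i)

lemma embMat_dual (b : Basis ι ℚ K) : (embMat b.traceDual)ᵀ * embMat b = 1 := by
  ext i j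
  simp only [mul_apply, transpose_apply, embMat, of_apply, ← map_mul]
  rw [← trace_ringhom, Basis.trace_traceDual_mul, one_apply]
  split_ifs <;> simp_all

noncomputable def gramR (v : InfinitePlace K → ℝ) (b : ι → K) : Matrix ι ι ℝ :=
  Matrix.of fun i j => ∑ σ : K →+* ℂ,
    Real.exp (v (InfinitePlace.mk σ)) * (σ (b i) * starRingEnd ℂ (σ (b j))).re

lemma gramR_complex (v : InfinitePlace K → ℝ) (b : ι → K) (i j : ι) :
    ((gramR v b i j : ℝ) : ℂ) = ∑ σ : K →+* ℂ,
    (Real.exp (v (InfinitePlace.mk σ)) : ℂ) * (σ (b i) * starRingEnd ℂ (σ (b j))) := by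
  set S := ∑ σ : K →+* ℂ,
    (Real.exp (v (InfinitePlace.mk σ)) : ℂ) * (σ (b i) * starRingEnd ℂ (σ (b j))) with hS
  have h1 : starRingEnd ℂ S = S := by
    rw [hS, map_sum]
    rw [← Equiv.sum_comp (ComplexEmbedding.involutive_conjugate K).toPerm]
    refine Finset.sum_congr rfl fun σ _ => ?_
    rw [map_mul, conj_ofReal]
    simp
  have h2 : (gramR v b i j) = S.re := by
    rw [hS, re_sum]
    simp only [gramR, of_apply, re_ofReal_mul]
  rw [h2]
  exact (Complex.conj_eq_iff_re.mp h1)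

open scoped Classical in
lemma gramR_map (v : InfinitePlace K → ℝ) (b : ι → K) :
    (gramR v b).map (ofRealHom : ℝ →+* ℂ) = (embMat b)ᵀ *
      (diagonal fun σ : K →+* ℂ => (Real.exp (v (InfinitePlace.mk σ)) : ℂ)) *
      (embMat b).map (starRingEnd ℂ) := by
  ext i j
  rw [map_apply, ofRealHom_eq_coe, gramR_complex, mul_apply]
  refine Finset.sum_congr rfl fun σ _ => ?_
  rw [mul_diagonal]
  simp [embMat]
  ring

lemma gramR_symm (v : InfinitePlace K → ℝ) (b : ι → K) : (gramR v b)ᵀ = gramR v b := by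
  ext i j
  simp only [transpose_apply, gramR, of_apply]
  refine Finset.sum_congr rfl fun σ _ => ?_
  congr 1
  simp
  ring

lemma gramR_quad (v : InfinitePlace K → ℝ) (b : ι → K) (x : ι → ℝ) :
    x ⬝ᵥ (gramR v b *ᵥ x) = ∑ σ : K →+* ℂ, Real.exp (v (InfinitePlace.mk σ)) *
      ‖∑ i, (x i : ℂ) * σ (b i)‖ ^ 2 := by
  have h : ∀ σ : K →+* ℂ, ‖∑ i, (x i : ℂ) * σ (b i)‖ ^ 2 = ∑ i, ∑ j, x i * x j *
      (σ (b i) * starRingEnd ℂ (σ (b j))).re := by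
    intro σ
    have : ((‖∑ i, (x i : ℂ) * σ (b i)‖ ^ 2 : ℝ) : ℂ) = ∑ i, ∑ j, (x i * x j : ℝ) *
      (σ (b i) * starRingEnd ℂ (σ (b j))) := by
      rw [ofReal_pow, ← Complex.mul_conj', map_sum, Finset.sum_mul_sum]
      refine Finset.sum_congr rfl fun i _ => Finset.sum_congr rfl fun j _ => ?_
      simp
      ring
    have := congrArg re this
    rw [ofReal_re] at this
    rw [this, re_sum]
    refine Finset.sum_congr rfl fun i _ => ?_
    rw [re_sum]
    refine Finset.sum_congr rfl fun j _ => ?_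
    rw [re_ofReal_mul]
  simp only [h, dotProduct, mulVec, gramR, of_apply, Finset.mul_sum, Finset.sum_mul]
  rw [Finset.sum_comm (s := (Finset.univ : Finset (K →+* ℂ)))]
  refine Finset.sum_congr rfl fun i _ => ?_
  rw [Finset.sum_comm (s := (Finset.univ : Finset (K →+* ℂ)))]
  refine Finset.sum_congr rfl fun j _ => Finset.sum_congr rfl fun σ _ => ?_
  ring

open scoped Classical in
lemma gramR_mul_dual (v : InfinitePlace K → ℝ) (b : Basis ι ℚ K) :
    gramR v b * gramR (-v) b.traceDual = 1 := by
  have hcard : Fintype.card ι = Fintype.card (K →+* ℂ) := by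
    rw [NumberField.Embeddings.card, finrank_eq_card_basis b]
  have e := Fintype.equivOfCardEq hcard
  set M := embMat b
  set M' := embMat (b.traceDual : ι → K)
  have h1 : M'ᵀ * M = 1 := embMat_dual b
  have h2 : M * M'ᵀ = 1 := (mul_eq_one_comm_of_equiv e).mp h1
  have h3 : Mᵀ * M' = 1 := by
    rw [← transpose_transpose M', ← transpose_mul, h1, transpose_one]
  have h4 : M.map (starRingEnd ℂ) * (M'.map (starRingEnd ℂ))ᵀ = 1 := by
    rw [← transpose_map, ← Matrix.map_mul, h2]; simp
  have h5 : ((gramR (-v) b.traceDual).map (ofRealHom : ℝ →+* ℂ)) = (M'.map (starRingEnd ℂ))ᵀ *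
      (diagonal fun σ : K →+* ℂ => (Real.exp ((-v) (InfinitePlace.mk σ)) : ℂ)) * M' := by
    rw [← gramR_symm, transpose_map, gramR_map, transpose_mul, transpose_mul, diagonal_transpose,
      transpose_transpose, Matrix.mul_assoc]
  have h6 : ((gramR v b * gramR (-v) b.traceDual).map (ofRealHom : ℝ →+* ℂ)) = 1 := by
    rw [Matrix.map_mul, gramR_map, h5]
    have hd : (diagonal fun σ : K →+* ℂ => (Real.exp (v (InfinitePlace.mk σ)) : ℂ)) *
       (diagonal fun σ : K →+* ℂ => (Real.exp ((-v) (InfinitePlace.mk σ)) : ℂ)) = 1 := by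
      rw [diagonal_mul_diagonal, ← diagonal_one]
      congr 1
      funext σ
      rw [← ofReal_mul, ← Real.exp_add]
      simp
    calc _ = Mᵀ * (diagonal fun σ : K →+* ℂ => (Real.exp (v (InfinitePlace.mk σ)) : ℂ)) *
         (M.map (starRingEnd ℂ) * (M'.map (starRingEnd ℂ))ᵀ) * (diagonal fun σ : K →+* ℂ => (Real.exp ((-v) (InfinitePlace.mk σ)) : ℂ)) * M' := by
          simp only [Matrix.mul_assoc]
          rfl
      _ = _ := by
        rw [h4, Matrix.mul_one, Matrix.mul_assoc Mᵀ, hd, Matrix.mul_one, h3]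
  have : Function.Injective (fun A : Matrix ι ι ℝ => A.map (ofRealHom : ℝ →+* ℂ)) :=
    Matrix.map_injective ofRealHom.injective
  apply this
  simp only [h6]
  simp

lemma gramR_det (v : InfinitePlace K → ℝ) (b : Basis ι ℚ K) :
    (gramR v b).det = |((Algebra.discr ℚ b : ℚ) : ℝ)| *
      Real.exp (∑ σ : K →+* ℂ, v (InfinitePlace.mk σ)) := by
  have hcard : Fintype.card ι = Fintype.card (K →+* ℂ) := by
    rw [NumberField.Embeddings.card, finrank_eq_card_basis b]
  have e := Fintype.equivOfCardEq hcard
  set N : Matrix ι ι ℂ := (embMat b).submatrix e id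
  have h1 : (Algebra.traceMatrix ℚ b).map (algebraMap ℚ ℂ) = Nᵀ * N := by
    ext i j
    simp only [map_apply, Algebra.traceMatrix_apply, Algebra.traceForm_apply, eq_ratCast]
    rw [trace_ringhom, mul_apply, ← e.sum_comp]
    simp [N, embMat]
  have h2 : ((Algebra.discr ℚ b : ℚ) : ℂ) = N.det ^ 2 := by
    have := congrArg det h1
    rw [det_mul, det_transpose, ← RingHom.mapMatrix_apply, ← RingHom.map_det] at this
    rw [sq, ← this]; rfl
  have h3 : (gramR v b).map (ofRealHom : ℝ →+* ℂ) = Nᵀ *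
      (diagonal fun i => (Real.exp (v (InfinitePlace.mk (e i))) : ℂ)) *
      N.map (starRingEnd ℂ) := by
    ext i j
    rw [map_apply, ofRealHom_eq_coe, gramR_complex, mul_apply, ← e.sum_comp]
    refine Finset.sum_congr rfl fun σ _ => ?_
    rw [mul_diagonal]
    simp [embMat, N]
    ring
  have h4 : (((gramR v b).det : ℝ) : ℂ) = ((‖N.det‖ ^ 2 * Real.exp (∑ σ : K →+* ℂ, v (InfinitePlace.mk σ)) : ℝ) : ℂ) := by
    have := congrArg det h3
    rw [det_mul, det_mul, det_transpose, det_diagonal, ← RingHom.mapMatrix_apply,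
      ← RingHom.map_det, ← RingHom.mapMatrix_apply, ← RingHom.map_det, ofRealHom_eq_coe] at this
    rw [this, ofReal_mul, ofReal_pow, ← Complex.mul_conj', Real.exp_sum, ← e.prod_comp, ofReal_prod]
    ring
  rw [ofReal_injective h4]
  congr 1
  rw [← norm_pow, ← h2]
  simp [← Rat.cast_abs]

lemma gramR_posDef (v : InfinitePlace K → ℝ) (b : Basis ι ℚ K) : (gramR v b).PosDef := by
  have hdet : (gramR v b).det ≠ 0 := by
    rw [gramR_det]
    refine mul_ne_zero (abs_ne_zero.mpr ?_) (Real.exp_pos _).ne'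
    exact_mod_cast Algebra.discr_not_zero_of_basis ℚ b
  have hps : (gramR v b).PosSemidef := by
    refine posSemidef_iff_dotProduct_mulVec.mpr ⟨?_, fun x => ?_⟩
    · rw [IsHermitian, conjTranspose_eq_transpose_of_trivial, gramR_symm]
    · rw [star_trivial, gramR_quad]
      positivity
  exact hps.posDef_iff_isUnit.mpr ((isUnit_iff_isUnit_det _).mpr hdet.isUnit)

lemma qf_basis (v : InfinitePlace K → ℝ) (b : ι → K) (k : ι → ℤ) :
    (fun j => (k j : ℝ)) ⬝ᵥ (gramR v b *ᵥ (fun j => (k j : ℝ))) = qf v (∑ i, k i • b i) := by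
  rw [gramR_quad, qf]
  simp

theorem theta_basis (v : InfinitePlace K → ℝ) (b : Basis ι ℚ K) :
    (Summable fun k : ι → ℤ => Real.exp (-(Real.pi * qf v (∑ i, k i • b i)))) ∧
    ∑' k : ι → ℤ, Real.exp (-(Real.pi * qf v (∑ i, k i • b i))) =
      (Real.sqrt |((Algebra.discr ℚ b : ℚ) : ℝ)| *
        Real.exp ((∑ σ : K →+* ℂ, v (InfinitePlace.mk σ)) / 2))⁻¹ *
      ∑' k : ι → ℤ, Real.exp (-(Real.pi * qf (-v) (∑ i, k i • b.traceDual i))) := by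
  have h := gauss_poisson_posDef _ (gramR_posDef v b)
  rw [inv_eq_right_inv (gramR_mul_dual v b), gramR_det, Real.sqrt_mul (abs_nonneg _),
    ← Real.exp_half] at h
  simpa only [qf_basis] using h

end

end

section
open MeasureTheory Complex Matrix NumberField Module
open scoped nonZeroDivisors ENNReal

section
variable {K : Type*} [Field K] [NumberField K]
variable {ι : Type*} [Fintype ι] [DecidableEq ι]

noncomputable def spanEquiv (b : Basis ι ℚ K) (S : Set K)
    (hS : ∀ x, x ∈ Submodule.span ℤ (Set.range b) ↔ x ∈ S) : (ι → ℤ) ≃ S :=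
  ((b.restrictScalars ℤ).equivFun.symm.toEquiv).trans (Equiv.subtypeEquivRight hS)

lemma spanEquiv_apply (b : Basis ι ℚ K) (S : Set K)
    (hS : ∀ x, x ∈ Submodule.span ℤ (Set.range b) ↔ x ∈ S) (k : ι → ℤ) :
    (spanEquiv b S hS k : K) = ∑ i, k i • b i := by
  simp [spanEquiv, Basis.equivFun_symm_apply]

lemma theta_sets (v : InfinitePlace K → ℝ) (b : Basis ι ℚ K) (S S' : Set K)
    (hS : ∀ x, x ∈ Submodule.span ℤ (Set.range b) ↔ x ∈ S)
    (hS' : ∀ x, x ∈ Submodule.span ℤ (Set.range b.traceDual) ↔ x ∈ S') :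
    (Summable fun a : S => Real.exp (-(Real.pi * qf v (a : K)))) ∧
    ∑' a : S, Real.exp (-(Real.pi * qf v (a : K))) =
      (Real.sqrt |((Algebra.discr ℚ b : ℚ) : ℝ)| *
        Real.exp ((∑ σ : K →+* ℂ, v (InfinitePlace.mk σ)) / 2))⁻¹ *
      ∑' a : S', Real.exp (-(Real.pi * qf (-v) (a : K))) := by
  have h := theta_basis v b
  rw [← (spanEquiv b S hS).summable_iff, ← (spanEquiv b S hS).tsum_eq,
    ← (spanEquiv _ S' hS').tsum_eq]
  simpa only [Function.comp_def, spanEquiv_apply] using h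

lemma discr_ideal (J : (FractionalIdeal (𝓞 K)⁰ K)ˣ) :
    Real.sqrt |((Algebra.discr ℚ (basisOfFractionalIdeal K J) : ℚ) : ℝ)| =
      (FractionalIdeal.absNorm J.1 : ℝ) * Real.sqrt |(NumberField.discr K : ℝ)| := by
  classical
  have e : (Free.ChooseBasisIndex ℤ (𝓞 K)) ≃ (Free.ChooseBasisIndex ℤ J) :=
    Fintype.equivOfCardEq (by
      rw [← finrank_eq_card_chooseBasisIndex, ← finrank_eq_card_chooseBasisIndex,
        fractionalIdeal_rank])
  have h1 := det_basisOfFractionalIdeal_eq_absNorm K J e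
  have h2 : Algebra.discr ℚ (basisOfFractionalIdeal K J) =
      Algebra.discr ℚ ((basisOfFractionalIdeal K J).reindex e.symm) := by
    rw [Basis.coe_reindex, Equiv.symm_symm]
    exact (Algebra.discr_reindex ℚ (basisOfFractionalIdeal K J) e.symm).symm
  have h3 : Algebra.discr ℚ ((basisOfFractionalIdeal K J).reindex e.symm) =
      ((integralBasis K).det ((basisOfFractionalIdeal K J).reindex e.symm)) ^ 2 *
        Algebra.discr ℚ (integralBasis K) := by
    rw [Basis.det_apply, ← Algebra.discr_of_matrix_vecMul]
    congr 1
    rw [Basis.toMatrix_map_vecMul]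
  rw [h2, h3, ← coe_discr, Rat.cast_mul, abs_mul, Rat.cast_pow, abs_pow,
    Real.sqrt_mul (by positivity), Real.sqrt_sq (abs_nonneg _), ← Rat.cast_abs, h1]
  simp

theorem theta_ideal (J : (FractionalIdeal (𝓞 K)⁰ K)ˣ) (v : InfinitePlace K → ℝ) :
    (Summable fun a : {a : K // a ∈ J.1} => Real.exp (-(Real.pi * qf v (a : K)))) ∧
    ∑' a : {a : K // a ∈ J.1}, Real.exp (-(Real.pi * qf v (a : K))) =
      ((FractionalIdeal.absNorm J.1 : ℝ) * Real.sqrt |(NumberField.discr K : ℝ)| *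
        Real.exp ((∑ σ : K →+* ℂ, v (InfinitePlace.mk σ)) / 2))⁻¹ *
      ∑' a : {a : K // a ∈ FractionalIdeal.dual ℤ ℚ J.1},
        Real.exp (-(Real.pi * qf (-v) (a : K))) := by
  classical
  rw [← discr_ideal]
  refine theta_sets v (basisOfFractionalIdeal K J) {a | a ∈ J.1} {a | a ∈ FractionalIdeal.dual ℤ ℚ J.1}
    (fun x => mem_span_basisOfFractionalIdeal K) (fun x => ?_)
  have h := Submodule.traceDual_span_of_basis ℤ (J.1 : Submodule (𝓞 K) K)
    (basisOfFractionalIdeal K J) (by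
      ext x
      exact (mem_span_basisOfFractionalIdeal K).symm)
  rw [← h]
  show x ∈ Submodule.traceDual ℤ ℚ (J.1 : Submodule (𝓞 K) K) ↔ x ∈ FractionalIdeal.dual ℤ ℚ J.1
  rw [← FractionalIdeal.coe_dual ℤ ℚ J.ne_zero]
  rfl

/-- theta function as extended nonnegative real -/
noncomputable def Th (J : (FractionalIdeal (𝓞 K)⁰ K)ˣ) (v : InfinitePlace K → ℝ) : ℝ≥0∞ :=
  ∑' a : {a : K // a ∈ J.1}, ENNReal.ofReal (Real.exp (-(Real.pi * qf v (a : K))))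

noncomputable def dualU (J : (FractionalIdeal (𝓞 K)⁰ K)ˣ) : (FractionalIdeal (𝓞 K)⁰ K)ˣ :=
  Units.mk0 (FractionalIdeal.dual ℤ ℚ J.1) (FractionalIdeal.dual_ne_zero ℤ ℚ J.ne_zero)

theorem Th_fe (J : (FractionalIdeal (𝓞 K)⁰ K)ˣ) (v : InfinitePlace K → ℝ) :
    Th J v = ENNReal.ofReal ((FractionalIdeal.absNorm J.1 : ℝ) * Real.sqrt |(NumberField.discr K : ℝ)| *
        Real.exp ((∑ σ : K →+* ℂ, v (InfinitePlace.mk σ)) / 2))⁻¹ * Th (dualU J) (-v) := by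
  obtain ⟨h1, h2⟩ := theta_ideal J v
  have h3 := (theta_ideal (dualU J) (-v)).1
  rw [Th, ← ENNReal.ofReal_tsum_of_nonneg (fun _ => (Real.exp_pos _).le) h1, h2,
    ENNReal.ofReal_mul, Th, ← ENNReal.ofReal_tsum_of_nonneg (fun _ => (Real.exp_pos _).le) h3]
  · rfl
  · have : 0 ≤ (FractionalIdeal.absNorm J.1 : ℝ) := by
      exact_mod_cast FractionalIdeal.absNorm_nonneg J.1
    positivity

lemma Th_ne_top (J : (FractionalIdeal (𝓞 K)⁰ K)ˣ) (v : InfinitePlace K → ℝ) : Th J v ≠ ⊤ := by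
  obtain ⟨h1, h2⟩ := theta_ideal J v
  rw [Th, ← ENNReal.ofReal_tsum_of_nonneg (fun _ => (Real.exp_pos _).le) h1]
  exact ENNReal.ofReal_ne_top

lemma dualU_eq (J : (FractionalIdeal (𝓞 K)⁰ K)ˣ) : dualU J = dualU 1 * J⁻¹ := by
  ext1
  simp only [dualU, Units.val_mk0, Units.val_mul, Units.val_one]
  rw [FractionalIdeal.dual_eq_mul_inv]
  simp

end

end

section
open MeasureTheory Complex NumberField Module NumberField.Units NumberField.Units.dirichletUnitTheorem
open NumberField.InfinitePlace
open scoped nonZeroDivisors ENNReal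

section
variable {K : Type*} [Field K] [NumberField K]

lemma sum_emb (g : InfinitePlace K → ℝ) :
    ∑ σ : K →+* ℂ, g (InfinitePlace.mk σ) = ∑ w : InfinitePlace K, (mult w : ℝ) * g w := by
  classical
  rw [← Finset.sum_fiberwise (s := Finset.univ) (g := fun σ : K →+* ℂ => InfinitePlace.mk σ)]
  refine Finset.sum_congr rfl fun w _ => ?_
  rw [Finset.sum_congr rfl (g := fun _ => g w)]
  · rw [Finset.sum_const, card_filter_mk_eq, nsmul_eq_mul]
  · intro σ hσ
    simp only [Finset.mem_filter] at hσ
    rw [hσ.2]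

lemma mult_pos' (w : InfinitePlace K) : (0 : ℝ) < mult w := by exact_mod_cast mult_pos

lemma sum_mult' : ∑ w : InfinitePlace K, (mult w : ℝ) = finrank ℚ K := by
  exact_mod_cast sum_mult_eq

noncomputable def nn (K : Type*) [Field K] [NumberField K] : ℝ := finrank ℚ K

lemma nn_pos : 0 < nn K := by
  have : 0 < finrank ℚ K := finrank_pos
  unfold nn
  exact_mod_cast this

noncomputable def tauV (v : InfinitePlace K → ℝ) : ℝ := (∑ w, (mult w : ℝ) * v w) / nn K

open scoped Classical in
noncomputable def phi (τ : ℝ) (l : logSpace K) (w : InfinitePlace K) : ℝ :=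
  τ + if h : w = w₀ then -(2 * (∑ w', l w') / mult w) else 2 * l ⟨w, h⟩ / mult w

noncomputable def ellV (v : InfinitePlace K → ℝ) : logSpace K :=
  fun w => mult w.1 * (v w.1 - tauV v) / 2

lemma sum_mult_phi (τ : ℝ) (l : logSpace K) : ∑ w, (mult w : ℝ) * phi τ l w = nn K * τ := by
  classical
  simp only [phi, mul_add, Finset.sum_add_distrib]
  rw [← Finset.sum_mul, sum_mult']
  change nn K * τ + _ = nn K * τ
  rw [add_eq_left]
  rw [Fintype.sum_eq_add_sum_subtype_ne _ w₀, dif_pos rfl]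
  have : ∀ w : {w : InfinitePlace K // w ≠ w₀}, (mult w.1 : ℝ) *
      (if h : w.1 = w₀ then -(2 * (∑ w', l w') / mult w.1) else 2 * l ⟨w.1, h⟩ / mult w.1) =
      2 * l w := by
    intro w
    rw [dif_neg w.2]
    have := (mult_pos' w.1).ne'
    field_simp
  simp only [this, ← Finset.mul_sum]
  have := (mult_pos' (w₀ : InfinitePlace K)).ne'
  field_simp
  ring

lemma tauV_phi (τ : ℝ) (l : logSpace K) : tauV (phi τ l) = τ := by
  rw [tauV, sum_mult_phi]
  have := (nn_pos (K := K)).ne'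
  field_simp

lemma ellV_phi (τ : ℝ) (l : logSpace K) : ellV (phi τ l) = l := by
  funext w
  rw [ellV, tauV_phi, phi, dif_neg w.2]
  have := (mult_pos' w.1).ne'
  field_simp
  ring

lemma phi_ell (v : InfinitePlace K → ℝ) : phi (tauV v) (ellV v) = v := by
  classical
  have h0 : ∑ w : {w : InfinitePlace K // w ≠ w₀}, ellV v w =
      - (mult (w₀ : InfinitePlace K) : ℝ) * (v w₀ - tauV v) / 2 := by
    have h1 : ∑ w : InfinitePlace K, (mult w : ℝ) * (v w - tauV v) / 2 = 0 := by
      rw [← Finset.sum_div]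
      simp only [mul_sub, Finset.sum_sub_distrib]
      rw [← Finset.sum_mul, sum_mult', tauV]
      have := (nn_pos (K := K)).ne'
      unfold nn at *
      field_simp
      ring
    rw [Fintype.sum_eq_add_sum_subtype_ne _ w₀] at h1
    simp only [ellV]
    linarith
  funext w
  rw [phi]
  split_ifs with h
  · subst h
    rw [h0]
    have := (mult_pos' (w₀ : InfinitePlace K)).ne'
    field_simp
    ring
  · have := (mult_pos' w).ne'
    simp only [ellV]
    field_simp
    ring

lemma phi_add (τ τ' : ℝ) (l l' : logSpace K) : phi (τ + τ') (l + l') = phi τ l + phi τ' l' := by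
  classical
  funext w
  simp only [phi, Pi.add_apply, Finset.sum_add_distrib]
  split_ifs <;> ring

lemma phi_neg (τ : ℝ) (l : logSpace K) : phi (-τ) (-l) = -phi τ l := by
  classical
  funext w
  simp only [phi, Pi.neg_apply, Finset.sum_neg_distrib]
  split_ifs <;> ring

/-- log vector of an element -/
noncomputable def lamV (a : K) : InfinitePlace K → ℝ := fun w => 2 * Real.log (w a)

lemma lamV_mul {a b : K} (ha : a ≠ 0) (hb : b ≠ 0) : lamV (a * b) = lamV a + lamV b := by
  funext w
  simp only [lamV, map_mul, Pi.add_apply]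
  rw [Real.log_mul (by simpa using ha) (by simpa using hb)]
  ring

lemma tauV_lam {a : K} (ha : a ≠ 0) :
    tauV (lamV a) = 2 / nn K * Real.log |(Algebra.norm ℚ a : ℝ)| := by
  have h := prod_eq_abs_norm a
  have : Real.log |(Algebra.norm ℚ a : ℝ)| = ∑ w : InfinitePlace K, (mult w : ℝ) * Real.log (w a) := by
    rw [← Rat.cast_abs, ← h, Real.log_prod (fun w _ => pow_ne_zero _ (by simpa using ha))]
    simp
  rw [this, tauV]
  simp only [lamV]
  rw [div_mul_eq_mul_div, Finset.mul_sum]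
  congr 1
  refine Finset.sum_congr rfl fun w _ => ?_
  ring

lemma lamV_unit (u : (𝓞 K)ˣ) : lamV ((u : 𝓞 K) : K) = phi 0 (logEmbedding K (Additive.ofMul u)) := by
  have hu : ((u : 𝓞 K) : K) ≠ 0 := by simp
  have h0 : tauV (lamV ((u : 𝓞 K) : K)) = 0 := by
    rw [tauV_lam hu]
    have : |Algebra.norm ℚ ((u : 𝓞 K) : K)| = 1 := by
      simpa using Units.norm (K := K) u
    rw [← Rat.cast_abs, this]; simp
  rw [← phi_ell (lamV ((u : 𝓞 K) : K)), h0]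
  congr 1
  funext w
  rw [ellV, h0, logEmbedding_component]
  simp only [lamV]
  ring

/-- the basic Gaussian weight -/
noncomputable def EE (v : InfinitePlace K → ℝ) : ℝ≥0∞ :=
  ENNReal.ofReal (Real.exp (-(Real.pi * ∑ w, (mult w : ℝ) * Real.exp (v w))))

lemma qf_lam (v : InfinitePlace K → ℝ) {a : K} (ha : a ≠ 0) :
    qf v a = ∑ w, (mult w : ℝ) * Real.exp ((v + lamV a) w) := by
  rw [← sum_emb (fun w => Real.exp ((v + lamV a) w)), qf]
  refine Finset.sum_congr rfl fun σ _ => ?_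
  simp only [Pi.add_apply, Real.exp_add, lamV]
  rw [mul_comm 2, Real.exp_mul, Real.exp_log (by simpa using ha)]
  norm_cast

lemma EE_qf (v : InfinitePlace K → ℝ) {a : K} (ha : a ≠ 0) :
    ENNReal.ofReal (Real.exp (-(Real.pi * qf v a))) = EE (v + lamV a) := by
  rw [EE, qf_lam v ha]

lemma Th_unit (J : (FractionalIdeal (𝓞 K)⁰ K)ˣ) (v : InfinitePlace K → ℝ) (u : (𝓞 K)ˣ) :
    Th J (v + lamV ((u : 𝓞 K) : K)) = Th J v := by
  have hu : ((u : 𝓞 K) : K) ≠ 0 := by simp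
  let e : {a : K // a ∈ J.1} ≃ {a : K // a ∈ J.1} :=
    { toFun := fun a => ⟨((u : 𝓞 K) : K) * a, by
        have := (J.1 : Submodule (𝓞 K) K).smul_mem (u : 𝓞 K) a.2
        simpa [Algebra.smul_def] using this⟩
      invFun := fun a => ⟨(((u⁻¹ : (𝓞 K)ˣ) : 𝓞 K) : K) * a, by
        have := (J.1 : Submodule (𝓞 K) K).smul_mem ((u⁻¹ : (𝓞 K)ˣ) : 𝓞 K) a.2
        simpa [Algebra.smul_def] using this⟩
      left_inv := fun a => by ext; simp [← mul_assoc]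
      right_inv := fun a => by ext; simp [← mul_assoc] }
  rw [Th, Th, ← e.tsum_eq (fun a => ENNReal.ofReal (Real.exp (-(Real.pi * qf v a))))]
  refine tsum_congr fun a => ?_
  show _ = ENNReal.ofReal (Real.exp (-(Real.pi * qf v (((u : 𝓞 K) : K) * a))))
  congr 3
  congr 1
  simp only [qf]
  refine Finset.sum_congr rfl fun σ _ => ?_
  have : Real.exp (lamV ((u : 𝓞 K) : K) (InfinitePlace.mk σ)) = ‖σ ((u : 𝓞 K) : K)‖ ^ 2 := by
    simp only [lamV]
    rw [mul_comm 2, Real.exp_mul, Real.exp_log (by simpa using hu)]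
    norm_cast
  rw [Pi.add_apply, Real.exp_add, this, map_mul, norm_mul]
  ring

open scoped Classical

/-- fundamental domain for the unit lattice -/
noncomputable def DD (K : Type*) [Field K] [NumberField K] : Set (logSpace K) :=
  ZSpan.fundamentalDomain ((basisUnitLattice K).ofZLatticeBasis ℝ)

lemma DD_fund : IsAddFundamentalDomain (unitLattice K) (DD K) volume :=
  ZLattice.isAddFundamentalDomain (basisUnitLattice K) volume

lemma DD_bdd : Bornology.IsBounded (DD K) := ZSpan.fundamentalDomain_isBounded _

lemma DD_vol_lt : volume (DD K) < ⊤ := DD_bdd.measure_lt_top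

lemma DD_meas : MeasurableSet (DD K) := ZSpan.fundamentalDomain_measurableSet _

lemma DD_vol_ne : volume (DD K) ≠ 0 := ZSpan.measure_fundamentalDomain_ne_zero _

lemma Th_lattice (J : (FractionalIdeal (𝓞 K)⁰ K)ˣ) (τ : ℝ) (l : logSpace K) (γ : unitLattice K) :
    Th J (phi τ (γ +ᵥ l)) = Th J (phi τ l) := by
  obtain ⟨g, hg⟩ := γ
  obtain ⟨u, -, rfl⟩ := hg
  change Th J (phi τ (logEmbedding K (Additive.ofMul (Additive.toMul u)) + l)) = _
  rw [add_comm]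
  have h2 : phi τ (l + logEmbedding K (Additive.ofMul (Additive.toMul u))) =
      phi τ l + lamV (((Additive.toMul u : (𝓞 K)ˣ) : 𝓞 K) : K) := by
    rw [lamV_unit, ← phi_add, add_zero]
  rw [h2, Th_unit]

instance vaddInv : VAddInvariantMeasure (unitLattice K) (logSpace K) volume :=
  inferInstanceAs (VAddInvariantMeasure (unitLattice K).toAddSubgroup (logSpace K) volume)

lemma DD_neg_fund : IsAddFundamentalDomain (unitLattice K) (Neg.neg ⁻¹' (DD K)) volume := by
  refine DD_fund.preimage_of_equiv (f := Neg.neg) (e := Neg.neg) ?_ (Equiv.neg _).bijective ?_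
  · exact (Measure.measurePreserving_neg _).quasiMeasurePreserving
  · intro g x
    show -((-g : unitLattice K) +ᵥ x) = g +ᵥ (-x)
    show -(((-g : unitLattice K) : logSpace K) + x) = (g : logSpace K) + (-x)
    simp [add_comm]

lemma Th_int_neg (J : (FractionalIdeal (𝓞 K)⁰ K)ˣ) (τ : ℝ) :
    ∫⁻ l in DD K, Th J (phi τ (-l)) = ∫⁻ l in DD K, Th J (phi τ l) := by
  rw [DD_fund.setLIntegral_eq DD_neg_fund (fun l => Th J (phi τ l)) (fun γ l => Th_lattice J τ l γ)]
  have := (Measure.measurePreserving_neg (volume : Measure (logSpace K))).setLIntegral_comp_preimage_emb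
    (MeasurableEquiv.neg _).measurableEmbedding (fun l => Th J (phi τ (-l))) (DD K)
  rw [← this]
  simp

end

end

section
open MeasureTheory Complex NumberField Module NumberField.Units NumberField.Units.dirichletUnitTheorem
open NumberField.InfinitePlace
open scoped nonZeroDivisors ENNReal

section
variable {K : Type*} [Field K] [NumberField K]
open scoped Classical

noncomputable def nrm (J : (FractionalIdeal (𝓞 K)⁰ K)ˣ) : ℝ := (FractionalIdeal.absNorm J.1 : ℝ)

lemma nrm_pos (J : (FractionalIdeal (𝓞 K)⁰ K)ˣ) : 0 < nrm J := by
  have h1 : 0 ≤ FractionalIdeal.absNorm J.1 := FractionalIdeal.absNorm_nonneg _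
  have h2 : FractionalIdeal.absNorm J.1 ≠ 0 := by
    rw [Ne, FractionalIdeal.absNorm_eq_zero_iff]; exact J.ne_zero
  unfold nrm
  exact_mod_cast lt_of_le_of_ne h1 h2.symm

lemma nrm_mul (J J' : (FractionalIdeal (𝓞 K)⁰ K)ˣ) : nrm (J * J') = nrm J * nrm J' := by
  simp [nrm]

lemma nrm_inv (J : (FractionalIdeal (𝓞 K)⁰ K)ˣ) : nrm J⁻¹ = (nrm J)⁻¹ := by
  have : nrm (J * J⁻¹) = 1 := by rw [mul_inv_cancel]; simp [nrm]
  rw [nrm_mul] at this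
  exact eq_inv_of_mul_eq_one_right this

noncomputable def del (K : Type*) [Field K] [NumberField K] : ℝ :=
  nrm (dualU (1 : (FractionalIdeal (𝓞 K)⁰ K)ˣ))

lemma del_pos : 0 < del K := nrm_pos _

/-- shift -/
noncomputable def sh (J : (FractionalIdeal (𝓞 K)⁰ K)ˣ) : ℝ :=
  (Real.log (del K) / 2 - Real.log (nrm J)) * (2 / nn K)

lemma sh_dual (J : (FractionalIdeal (𝓞 K)⁰ K)ˣ) : sh (dualU J) = - sh J := by
  rw [sh, sh, dualU_eq, nrm_mul, nrm_inv, ← del, Real.log_mul del_pos.ne' (inv_pos.2 (nrm_pos J)).ne',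
    Real.log_inv]
  ring

noncomputable def FJ (J : (FractionalIdeal (𝓞 K)⁰ K)ˣ) (τ : ℝ) : ℝ≥0∞ :=
  ∫⁻ l in DD K, Th J (phi (τ + sh J) l)

noncomputable def epsK (K : Type*) [Field K] [NumberField K] : ℝ :=
  (Real.sqrt |(NumberField.discr K : ℝ)| * Real.sqrt (del K))⁻¹

lemma epsK_pos : 0 < epsK K := by
  unfold epsK
  have h : (0:ℝ) < |(NumberField.discr K : ℝ)| := by
    simpa using NumberField.discr_ne_zero K
  have := del_pos (K := K)
  positivity

lemma FJ_fe (J : (FractionalIdeal (𝓞 K)⁰ K)ˣ) (τ : ℝ) :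
    FJ J (-τ) = ENNReal.ofReal (epsK K * Real.exp (nn K / 2 * τ)) * FJ (dualU J) τ := by
  rw [FJ, FJ, ← Th_int_neg]
  rw [← lintegral_const_mul' _ _ ENNReal.ofReal_ne_top]
  refine lintegral_congr fun l => ?_
  rw [Th_fe, sh_dual, ← phi_neg, neg_neg, neg_add, neg_neg]
  congr 2
  rw [sum_emb, sum_mult_phi]
  have hn := (nn_pos (K := K)).ne'
  have e1 : nn K * (-τ + sh J) / 2 = -(nn K / 2 * τ) + (Real.log (del K) / 2 - Real.log (nrm J)) := by
    rw [sh]; field_simp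
  rw [e1, Real.exp_add, Real.exp_sub, Real.exp_log (nrm_pos J), Real.exp_neg, epsK]
  have : Real.exp (Real.log (del K) / 2) = Real.sqrt (del K) := by
    rw [Real.sqrt_eq_rpow, Real.rpow_def_of_pos del_pos]; congr 1; ring
  rw [this, ← nrm]
  have := nrm_pos J
  have := del_pos (K := K)
  have h : (0:ℝ) < |(NumberField.discr K : ℝ)| := by
    simpa using NumberField.discr_ne_zero K
  have h1 := Real.sqrt_pos.2 h
  have h2 := Real.sqrt_pos.2 (del_pos (K := K))
  have h3 := Real.exp_pos (nn K / 2 * τ)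
  field_simp

/-- nonzero part of theta -/
noncomputable def Th' (J : (FractionalIdeal (𝓞 K)⁰ K)ˣ) (v : InfinitePlace K → ℝ) : ℝ≥0∞ :=
  ∑' a : {a : K // a ∈ J.1 ∧ a ≠ 0}, EE (v + lamV a.1)

lemma tsum_split_zero {K : Type*} [Zero K] (p : K → Prop) (hz : p 0) (f : K → ℝ≥0∞) :
    ∑' a : {a : K // p a}, f a = f 0 + ∑' a : {a : K // p a ∧ a ≠ 0}, f a := by
  rw [ENNReal.tsum_eq_add_tsum_ite (⟨0, hz⟩ : {a : K // p a})]
  congr 1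
  let g : {a : K // p a ∧ a ≠ 0} → {a : K // p a} := fun a => ⟨a.1, a.2.1⟩
  have hg : Function.Injective g := fun a b h => Subtype.ext (congrArg (fun x => x.1) h)
  rw [← hg.tsum_eq]
  · refine tsum_congr fun a => ?_
    have : g a ≠ ⟨0, hz⟩ := fun h => a.2.2 (congrArg (fun x => x.1) h)
    rw [if_neg this]
  · intro a ha
    rw [Function.mem_support] at ha
    have : a.1 ≠ 0 := by
      intro h
      apply ha
      rw [if_pos (Subtype.ext h)]
    exact ⟨⟨a.1, a.2, this⟩, rfl⟩

lemma Th_eq (J : (FractionalIdeal (𝓞 K)⁰ K)ˣ) (v : InfinitePlace K → ℝ) : Th J v = 1 + Th' J v := by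
  have hz : (0 : K) ∈ J.1 := zero_mem J.1.1
  rw [Th, tsum_split_zero (fun a => a ∈ J.1) hz
    (fun a => ENNReal.ofReal (Real.exp (-(Real.pi * qf v a))))]
  congr 1
  · simp [qf]
  · exact tsum_congr fun a => EE_qf v a.2.2

noncomputable def FJ' (J : (FractionalIdeal (𝓞 K)⁰ K)ˣ) (τ : ℝ) : ℝ≥0∞ :=
  ∫⁻ l in DD K, Th' J (phi (τ + sh J) l)

lemma FJ_eq (J : (FractionalIdeal (𝓞 K)⁰ K)ˣ) (τ : ℝ) : FJ J τ = volume (DD K) + FJ' J τ := by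
  rw [FJ, FJ']
  simp only [Th_eq]
  rw [lintegral_add_left measurable_const]
  simp

lemma EE_anti {v v' : InfinitePlace K → ℝ} (h : v ≤ v') : EE v' ≤ EE v := by
  unfold EE
  gcongr with w
  exact h w

lemma phi_mono {τ τ' : ℝ} (h : τ ≤ τ') (l : logSpace K) : phi τ l ≤ phi τ' l := by
  intro w
  simp only [phi]
  gcongr

lemma FJ'_anti (J : (FractionalIdeal (𝓞 K)⁰ K)ˣ) : Antitone (FJ' J) := by
  intro τ τ' h
  unfold FJ'
  refine lintegral_mono fun l => ?_
  refine ENNReal.tsum_le_tsum fun a => EE_anti ?_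
  gcongr
  exact phi_mono (by linarith) l

lemma exists_lower_of_summable {α : Type*} (q : α → ℝ) (hq : ∀ a, 0 < q a)
    (h1 : Summable fun a => Real.exp (-(Real.pi * q a))) : ∃ c > 0, ∀ a, c ≤ q a := by
  have h3 := h1.tendsto_cofinite_zero.eventually (gt_mem_nhds (Real.exp_pos (-(Real.pi * 1))))
  rw [Filter.eventually_cofinite] at h3
  set S := {a | ¬ Real.exp (-(Real.pi * q a)) < Real.exp (-(Real.pi * 1))}
  have h4 : ∃ c > 0, ∀ a ∈ S, c ≤ q a := by
    by_cases hS : S.Nonempty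
    · obtain ⟨a, ha, hmin⟩ := Set.exists_min_image S q h3 hS
      exact ⟨_, hq a, hmin⟩
    · refine ⟨1, one_pos, fun a ha => (hS ⟨a, ha⟩).elim⟩
  obtain ⟨c, hc, h⟩ := h4
  refine ⟨min c 1, lt_min hc one_pos, fun a => ?_⟩
  by_cases hm : a ∈ S
  · exact (min_le_left _ _).trans (h _ hm)
  · refine (min_le_right _ _).trans ?_
    have hm' : Real.exp (-(Real.pi * q a)) < Real.exp (-(Real.pi * 1)) := not_not.1 hm
    rw [Real.exp_lt_exp] at hm'
    have := Real.pi_pos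
    nlinarith

lemma qf_lower (J : (FractionalIdeal (𝓞 K)⁰ K)ˣ) :
    ∃ c > 0, ∀ a ∈ J.1, a ≠ 0 → c ≤ qf 0 a := by
  have h1 := (theta_ideal J 0).1
  have hpos : ∀ a : K, a ≠ 0 → 0 < qf 0 a := by
    intro a ha
    rw [qf_lam _ ha]
    refine Finset.sum_pos (fun w _ => mul_pos (mult_pos' w) (Real.exp_pos _)) ?_
    exact Finset.univ_nonempty
  have hs : Summable (fun a : {a : K // a ∈ J.1 ∧ a ≠ 0} => Real.exp (-(Real.pi * qf 0 a.1))) :=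
    h1.comp_injective (i := fun a : {a : K // a ∈ J.1 ∧ a ≠ 0} => (⟨a.1, a.2.1⟩ : {a : K // a ∈ J.1}))
      (fun a b h => Subtype.ext (Subtype.mk.inj h))
  obtain ⟨c, hc, h⟩ := exists_lower_of_summable _ (fun a => hpos _ a.2.2) hs
  exact ⟨c, hc, fun a ha h0 => h ⟨a, ha, h0⟩⟩

lemma phi_bdd : ∃ M : ℝ, ∀ l ∈ DD K, ∀ w : InfinitePlace K, -M ≤ phi 0 l w := by
  have hc : Continuous (fun l : logSpace K => phi 0 l) := by
    refine continuous_pi fun w => ?_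
    unfold phi
    by_cases h : w = w₀
    · simp only [h, dite_true]; fun_prop
    · simp only [h, dite_false]; fun_prop
  have hb : Bornology.IsBounded ((fun l : logSpace K => phi 0 l) '' closure (DD K)) :=
    ((DD_bdd (K := K)).isCompact_closure.image hc).isBounded
  obtain ⟨M, hM⟩ := hb.exists_norm_le
  refine ⟨M, fun l hl w => ?_⟩
  have h1 := hM _ ⟨l, subset_closure hl, rfl⟩
  have h2 := (norm_le_pi_norm (phi 0 l) w).trans h1
  exact (abs_le.1 h2).1

lemma FJ'_bound (J : (FractionalIdeal (𝓞 K)⁰ K)ˣ) (τ₀ : ℝ) :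
    ∃ C c : ℝ, 0 ≤ C ∧ 0 < c ∧ ∀ τ, τ₀ ≤ τ → FJ' J τ ≤ ENNReal.ofReal (C * Real.exp (-(c * Real.exp τ))) := by
  obtain ⟨c, hc, hq⟩ := qf_lower J
  obtain ⟨M, hM⟩ := phi_bdd (K := K)
  set m : ℝ := sh J - M
  set y₀ := Real.exp (τ₀ + m)
  set v₀ : InfinitePlace K → ℝ := fun _ => τ₀ + m
  have hkey : ∀ τ, τ₀ ≤ τ → ∀ l ∈ DD K, Th' J (phi (τ + sh J) l) ≤
      ENNReal.ofReal (Real.exp (-(Real.pi * (c * (Real.exp (τ + m) - y₀))))) * Th' J v₀ := by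
    intro τ hτ l hl
    rw [Th', Th', ← ENNReal.tsum_mul_left]
    refine ENNReal.tsum_le_tsum fun a => ?_
    have h1 : (fun _ => τ + m) ≤ phi (τ + sh J) l := by
      intro w
      have := hM l hl w
      simp only [phi] at this ⊢
      simp only [m]
      linarith
    refine (EE_anti (add_le_add_left h1 (lamV a.1))).trans ?_
    rw [← EE_qf _ a.2.2, ← EE_qf _ a.2.2, ← ENNReal.ofReal_mul (Real.exp_pos _).le, ← Real.exp_add]
    apply ENNReal.ofReal_le_ofReal
    apply Real.exp_le_exp.2
    have e : ∀ r : ℝ, qf (fun _ : InfinitePlace K => r) a.1 = Real.exp r * qf 0 a.1 := by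
      intro r
      simp [qf, Finset.mul_sum]
    rw [e, e]
    have h2 := hq a.1 a.2.1 a.2.2
    have h3 : y₀ ≤ Real.exp (τ + m) := Real.exp_le_exp.2 (by linarith)
    have h4 : c * (Real.exp (τ + m) - y₀) ≤ qf 0 a.1 * (Real.exp (τ + m) - y₀) :=
      mul_le_mul_of_nonneg_right h2 (by linarith)
    have h5 := mul_le_mul_of_nonneg_left h4 Real.pi_pos.le
    change _ ≤ -(Real.pi * (c * (Real.exp (τ + m) - y₀))) + -(Real.pi * (y₀ * qf 0 a.1))
    nlinarith
  have hfin : Th' J v₀ ≠ ⊤ := by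
    intro h
    apply Th_ne_top J v₀
    rw [Th_eq, h]; simp
  refine ⟨Real.exp (Real.pi * c * y₀) * (Th' J v₀).toReal * (volume (DD K)).toReal,
    Real.pi * c * Real.exp m, by positivity, by have := Real.pi_pos; positivity, fun τ hτ => ?_⟩
  calc FJ' J τ ≤ ∫⁻ l in DD K, ENNReal.ofReal (Real.exp (-(Real.pi * (c * (Real.exp (τ + m) - y₀))))) * Th' J v₀ :=
        setLIntegral_mono' DD_meas (hkey τ hτ)
    _ = ENNReal.ofReal (Real.exp (-(Real.pi * (c * (Real.exp (τ + m) - y₀))))) * Th' J v₀ * volume (DD K) := by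
        simp
    _ = _ := by
        have h1 := ENNReal.ofReal_toReal hfin
        have h2 := ENNReal.ofReal_toReal (DD_vol_lt (K := K)).ne
        rw [← h1, ← h2, ← ENNReal.ofReal_mul (by positivity), ← ENNReal.ofReal_mul (by positivity),
          ENNReal.toReal_ofReal (by positivity), ENNReal.toReal_ofReal (by positivity)]
        congr 1
        have : -(Real.pi * (c * (Real.exp (τ + m) - y₀))) =
          Real.pi * c * y₀ + -(Real.pi * c * Real.exp m * Real.exp τ) := by
          rw [Real.exp_add]; ring
        rw [this, Real.exp_add]
        ring

lemma FJ'_ne_top (J : (FractionalIdeal (𝓞 K)⁰ K)ˣ) (τ : ℝ) : FJ' J τ ≠ ⊤ := by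
  obtain ⟨C, c, _, _, h⟩ := FJ'_bound J τ
  exact ne_top_of_le_ne_top ENNReal.ofReal_ne_top (h τ le_rfl)

end

end

section
open MeasureTheory Complex NumberField Module NumberField.Units NumberField.Units.dirichletUnitTheorem
open NumberField.InfinitePlace
open scoped nonZeroDivisors ENNReal

section
variable {K : Type*} [Field K] [NumberField K] {ι : Type*} [Fintype ι]
open scoped Classical

noncomputable def FF (J : ι → (FractionalIdeal (𝓞 K)⁰ K)ˣ) (x : ℝ) : ℝ :=
  (∑ c, FJ' (J c) (Real.log x)).toReal

lemma FFsum_ne_top (J : ι → (FractionalIdeal (𝓞 K)⁰ K)ˣ) (τ : ℝ) :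
    ∑ c, FJ' (J c) τ ≠ ⊤ := by
  rw [ENNReal.sum_ne_top]
  exact fun c _ => FJ'_ne_top _ _

lemma FF_nonneg (J : ι → (FractionalIdeal (𝓞 K)⁰ K)ˣ) (x : ℝ) : 0 ≤ FF J x := ENNReal.toReal_nonneg

lemma FF_anti (J : ι → (FractionalIdeal (𝓞 K)⁰ K)ˣ) : AntitoneOn (FF J) (Set.Ioi 0) := by
  intro x hx y hy h
  refine ENNReal.toReal_mono (FFsum_ne_top J _) ?_
  refine Finset.sum_le_sum fun c _ => FJ'_anti _ (Real.log_le_log hx h)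

lemma FF_bound (J : ι → (FractionalIdeal (𝓞 K)⁰ K)ˣ) :
    ∃ C c : ℝ, 0 ≤ C ∧ 0 < c ∧ ∀ x, 1 ≤ x → FF J x ≤ C * Real.exp (-(c * x)) := by
  choose C c hC hc h using fun i => FJ'_bound (J i) 0
  obtain ⟨c', h', hc'⟩ : ∃ c' : ℝ, (∀ i, c' < c i) ∧ 0 < c' := by
    have : ∀ᶠ c' in nhdsWithin (0:ℝ) (Set.Ioi 0), ∀ i, c' < c i :=
      Filter.eventually_all.2 fun i => nhdsWithin_le_nhds (gt_mem_nhds (hc i))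
    exact (this.and self_mem_nhdsWithin).exists
  refine ⟨∑ i, C i, c', Finset.sum_nonneg fun i _ => hC i, hc', fun x hx => ?_⟩
  have hx0 : 0 < x := by linarith
  rw [FF, ENNReal.toReal_sum (fun i _ => FJ'_ne_top _ _), Finset.sum_mul]
  refine Finset.sum_le_sum fun i _ => ?_
  have := ENNReal.toReal_mono ENNReal.ofReal_ne_top (h i (Real.log x) (Real.log_nonneg hx))
  rw [Real.exp_log hx0, ENNReal.toReal_ofReal (mul_nonneg (hC i) (Real.exp_pos _).le)] at this
  refine this.trans ?_
  gcongr
  · exact hC i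
  · exact (h' i).le

noncomputable def VV (K : Type*) [Field K] [NumberField K] (ι : Type*) [Fintype ι] : ℝ :=
  Fintype.card ι * (volume (DD K)).toReal

lemma VV_FF (J : ι → (FractionalIdeal (𝓞 K)⁰ K)ˣ) (x : ℝ) :
    VV K ι + FF J x = (∑ c, FJ (J c) (Real.log x)).toReal := by
  simp only [FJ_eq]
  rw [Finset.sum_add_distrib, ENNReal.toReal_add _ (FFsum_ne_top J _), FF, VV]
  · simp
  · simp [ENNReal.mul_eq_top, DD_vol_lt.ne]

lemma FF_fe (J : ι → (FractionalIdeal (𝓞 K)⁰ K)ˣ) {x : ℝ} (hx : 0 < x) :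
    VV K ι + FF J (1 / x) = epsK K * x ^ (nn K / 2) * (VV K ι + FF (fun c => dualU (J c)) x) := by
  rw [VV_FF, VV_FF, one_div, Real.log_inv]
  simp only [FJ_fe]
  rw [← Finset.mul_sum, ENNReal.toReal_mul, ENNReal.toReal_ofReal, Real.rpow_def_of_pos hx,
    mul_comm (nn K / 2)]
  have := epsK_pos (K := K)
  positivity

lemma FF_locint (J : ι → (FractionalIdeal (𝓞 K)⁰ K)ˣ) :
    LocallyIntegrableOn (fun x => ((VV K ι + FF J x : ℝ) : ℂ)) (Set.Ioi 0) := by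
  rw [MeasureTheory.locallyIntegrableOn_iff (isLocallyClosed_Ioi)]
  intro k hk hc
  have h1 : IntegrableOn (fun x => VV K ι + FF J x) k := by
    refine AntitoneOn.integrableOn_isCompact hc ?_
    intro x hx y hy h
    have := FF_anti J (hk hx) (hk hy) h
    simpa using this
  exact h1.ofReal

lemma FF_top (J : ι → (FractionalIdeal (𝓞 K)⁰ K)ˣ) (r : ℝ) :
    (fun x => ((VV K ι + FF J x : ℝ) : ℂ) - (VV K ι : ℂ)) =O[Filter.atTop] (fun x : ℝ => x ^ r) := by
  obtain ⟨C, c, hC, hc, h⟩ := FF_bound J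
  have h2 := (isLittleO_exp_neg_mul_rpow_atTop hc r).isBigO
  refine Asymptotics.IsBigO.trans ?_ h2
  refine Asymptotics.IsBigO.of_bound C ?_
  filter_upwards [Filter.eventually_ge_atTop 1] with x hx
  have e : ((VV K ι + FF J x : ℝ) : ℂ) - (VV K ι : ℂ) = ((FF J x : ℝ) : ℂ) := by push_cast; ring
  rw [e, Complex.norm_real, Real.norm_of_nonneg (FF_nonneg J x), Real.norm_of_nonneg (Real.exp_pos _).le,
    neg_mul]
  exact h x hx

noncomputable def pairK (J : ι → (FractionalIdeal (𝓞 K)⁰ K)ˣ) : WeakFEPair ℂ where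
  f := fun x => ((VV K ι + FF J x : ℝ) : ℂ)
  g := fun x => ((VV K ι + FF (fun c => dualU (J c)) x : ℝ) : ℂ)
  k := nn K / 2
  ε := epsK K
  f₀ := (VV K ι : ℂ)
  g₀ := (VV K ι : ℂ)
  hf_int := FF_locint J
  hg_int := FF_locint _
  hk := half_pos nn_pos
  hε := by exact_mod_cast (epsK_pos (K := K)).ne'
  h_feq := by
    intro x hx
    rw [FF_fe J hx]
    push_cast
    rw [smul_eq_mul]
  hf_top := FF_top J
  hg_top := FF_top _

end

end

section
open MeasureTheory Complex NumberField Module NumberField.Units NumberField.Units.dirichletUnitTheorem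
open NumberField.InfinitePlace
open scoped nonZeroDivisors ENNReal

section
variable {K : Type*} [Field K] [NumberField K] {ι : Type*} [Fintype ι]
open scoped Classical

lemma countK (K : Type*) [Field K] [NumberField K] : Countable K :=
  (finBasis ℚ K).equivFun.toEquiv.countable_iff.2 inferInstance

lemma meas_phi : Measurable (fun p : ℝ × logSpace K => phi p.1 p.2) := by
  refine measurable_pi_iff.2 fun w => ?_
  unfold phi
  by_cases h : w = w₀
  · simp only [h, dite_true]; fun_prop
  · simp only [h, dite_false]; fun_prop

lemma meas_EE : Measurable (EE : (InfinitePlace K → ℝ) → ℝ≥0∞) := by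
  unfold EE; fun_prop

noncomputable def Gu (u : ℝ) (l : logSpace K) : ℝ≥0∞ :=
  ∫⁻ τ : ℝ, ENNReal.ofReal (Real.exp (u * τ)) * EE (phi τ l)

lemma phi_add_lam (τ s : ℝ) (l : logSpace K) (v : InfinitePlace K → ℝ) :
    phi (τ + s) l + v = phi (τ + (s + tauV v)) (l + ellV v) := by
  rw [← add_assoc, phi_add, phi_ell]

lemma mel_FJ' (J : (FractionalIdeal (𝓞 K)⁰ K)ˣ) (u : ℝ) :
    ∫⁻ τ : ℝ, ENNReal.ofReal (Real.exp (u * τ)) * FJ' J τ =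
    ∑' a : {a : K // a ∈ J.1 ∧ a ≠ 0}, ENNReal.ofReal (Real.exp (-(u * (sh J + tauV (lamV a.1))))) *
      ∫⁻ l in DD K, Gu u (l + ellV (lamV a.1)) := by
  have := countK K
  have hm : ∀ (a : K) (s : ℝ), Measurable (fun p : ℝ × logSpace K => EE (phi (p.1 + s) p.2 + lamV a)) := by
    intro a s
    apply meas_EE.comp
    have : Measurable (fun p : ℝ × logSpace K => phi (p.1 + s) p.2) :=
      meas_phi.comp (f := fun p : ℝ × logSpace K => (p.1 + s, p.2)) (by fun_prop)
    fun_prop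
  have h1 : ∀ τ : ℝ, FJ' J τ = ∑' a : {a : K // a ∈ J.1 ∧ a ≠ 0},
      ∫⁻ l in DD K, EE (phi (τ + sh J) l + lamV a.1) := by
    intro τ
    rw [FJ']
    simp only [Th']
    rw [lintegral_tsum]
    intro a
    exact ((hm a.1 (sh J)).comp (measurable_prodMk_left (x := τ))).aemeasurable
  simp only [h1, ← ENNReal.tsum_mul_left]
  rw [lintegral_tsum]
  · refine tsum_congr fun a => ?_
    simp only [← lintegral_const_mul' _ _ ENNReal.ofReal_ne_top]
    rw [lintegral_lintegral_swap]
    · refine lintegral_congr fun l => ?_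
      rw [Gu, ← lintegral_add_right_eq_self (fun τ : ℝ => ENNReal.ofReal (Real.exp (u * τ)) *
          EE (phi τ (l + ellV (lamV a.1)))) (sh J + tauV (lamV a.1)),
        ← lintegral_const_mul' _ _ ENNReal.ofReal_ne_top]
      refine lintegral_congr fun τ => ?_
      rw [phi_add_lam, ← mul_assoc, ← ENNReal.ofReal_mul (Real.exp_pos _).le, ← Real.exp_add]
      congr 3
      ring
    · exact (Measurable.mul (f := fun p : ℝ × logSpace K => ENNReal.ofReal (Real.exp (u * p.1)))
        (by fun_prop) (hm a.1 (sh J))).aemeasurable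
  · intro a
    apply AEMeasurable.mul
    · fun_prop
    · exact ((hm a.1 (sh J)).lintegral_prod_right' (ν := volume.restrict (DD K))).aemeasurable

noncomputable def wK (K : Type*) [Field K] [NumberField K] : ℕ := Nat.card (torsion K)

lemma wK_pos : 0 < wK K := Nat.card_pos

lemma units_sum (F : unitLattice K → ℝ≥0∞) :
    ∑' u : (𝓞 K)ˣ, F ⟨logEmbedding K (Additive.ofMul u), ⟨Additive.ofMul u, trivial, rfl⟩⟩ =
      wK K * ∑' γ, F γ := by
  set p : (𝓞 K)ˣ → unitLattice K :=
    fun u => ⟨logEmbedding K (Additive.ofMul u), ⟨Additive.ofMul u, trivial, rfl⟩⟩ with hp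
  change ∑' u, F (p u) = _
  rw [← (Equiv.sigmaFiberEquiv p).tsum_eq, ENNReal.tsum_sigma', ← ENNReal.tsum_mul_left]
  refine tsum_congr fun γ => ?_
  have h1 : ∀ b : {u // p u = γ}, F (p ((Equiv.sigmaFiberEquiv p) ⟨γ, b⟩)) = F γ := by
    intro b
    rw [show (Equiv.sigmaFiberEquiv p) ⟨γ, b⟩ = b.1 from rfl, b.2]
  simp only [h1]
  obtain ⟨u₀, hu₀⟩ : ∃ u₀, logEmbedding K u₀ = γ.1 := by
    obtain ⟨u, -, h⟩ := γ.2
    exact ⟨u, h⟩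
  have e : {u // p u = γ} ≃ torsion K :=
    { toFun := fun u => ⟨(Additive.toMul u₀)⁻¹ * u.1, by
        rw [← logEmbedding_eq_zero_iff, ofMul_mul, map_add, ofMul_inv, map_neg]
        have := congrArg Subtype.val u.2
        change logEmbedding K (Additive.ofMul u.1) = _ at this
        rw [this, ← hu₀]
        simp⟩
      invFun := fun t => ⟨Additive.toMul u₀ * t.1, by
        apply Subtype.ext
        change logEmbedding K (Additive.ofMul (Additive.toMul u₀ * t.1)) = _
        rw [← hu₀, ofMul_mul, map_add, logEmbedding_eq_zero_iff.2 t.2]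
        simp⟩
      left_inv := fun u => by ext; simp
      right_inv := fun u => by ext; simp }
  have := Fintype.ofFinite (torsion K)
  rw [← e.symm.tsum_eq, tsum_fintype]
  simp [wK, Nat.card_eq_fintype_card]

lemma units_unfold (g : logSpace K → ℝ≥0∞) :
    ∑' u : (𝓞 K)ˣ, ∫⁻ l in DD K, g (l + logEmbedding K (Additive.ofMul u)) =
      wK K * ∫⁻ l, g l := by
  rw [DD_fund.lintegral_eq_tsum'', ← units_sum]
  refine tsum_congr fun u => lintegral_congr fun l => ?_
  rw [add_comm]
  rfl

/-- the family represents the class group -/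
def IsRep (J : ι → (FractionalIdeal (𝓞 K)⁰ K)ˣ) : Prop :=
  ∀ I : (FractionalIdeal (𝓞 K)⁰ K)ˣ, ∃! c, ∃ a : Kˣ, I * J c = toPrincipalIdeal (𝓞 K) K a

lemma IsRep.dual {J : ι → (FractionalIdeal (𝓞 K)⁰ K)ˣ} (h : IsRep J) :
    IsRep (fun c => dualU (J c)) := by
  intro I
  have key : ∀ c, (∃ a : Kˣ, I * dualU (J c) = toPrincipalIdeal (𝓞 K) K a) ↔
      (∃ a : Kˣ, (I * dualU 1)⁻¹ * J c = toPrincipalIdeal (𝓞 K) K a) := by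
    intro c
    rw [dualU_eq]
    constructor
    · rintro ⟨a, ha⟩
      refine ⟨a⁻¹, ?_⟩
      rw [map_inv, ← ha]
      simp [mul_comm, mul_left_comm]
    · rintro ⟨a, ha⟩
      refine ⟨a⁻¹, ?_⟩
      rw [map_inv, ← ha]
      simp [mul_comm, mul_left_comm]
  simp only [key]
  exact h _

abbrev NZI (K : Type*) [Field K] [NumberField K] := {I : Ideal (𝓞 K) // I ≠ ⊥}

noncomputable def iU (I : NZI K) : (FractionalIdeal (𝓞 K)⁰ K)ˣ :=
  Units.mk0 (I.1 : FractionalIdeal (𝓞 K)⁰ K) (FractionalIdeal.coeIdeal_ne_zero.2 I.2)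

lemma nrm_iU (I : NZI K) : nrm (iU I) = (Ideal.absNorm I.1 : ℝ) := by
  rw [nrm, iU, Units.val_mk0, FractionalIdeal.coeIdeal_absNorm]
  simp

lemma nrm_princ (a : Kˣ) : nrm (toPrincipalIdeal (𝓞 K) K a) = |(Algebra.norm ℚ (a : K) : ℝ)| := by
  rw [nrm, coe_toPrincipalIdeal, FractionalIdeal.absNorm_span_singleton]
  simp

lemma iU_inj : Function.Injective (iU : NZI K → _) := by
  intro I I' h
  have := congrArg Units.val h
  simp only [iU, Units.val_mk0] at this
  exact Subtype.ext (FractionalIdeal.coeIdeal_injective this)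

lemma princ_eq {a b : Kˣ} (h : toPrincipalIdeal (𝓞 K) K a = toPrincipalIdeal (𝓞 K) K b) :
    ∃ u : (𝓞 K)ˣ, (b : K) = a * ((u : 𝓞 K) : K) := by
  have := congrArg Units.val h
  rw [coe_toPrincipalIdeal, coe_toPrincipalIdeal, FractionalIdeal.spanSingleton_eq_spanSingleton] at this
  obtain ⟨z, hz⟩ := this
  refine ⟨z, ?_⟩
  rw [← hz, mul_comm]
  rfl

/-- the parametrization of nonzero elements by ideals and units -/
theorem param {J : ι → (FractionalIdeal (𝓞 K)⁰ K)ˣ} (hJ : IsRep J) :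
    ∃ (c : NZI K → ι) (a : NZI K → Kˣ)
      (hm : ∀ I (u : (𝓞 K)ˣ), (a I : K) * ((u : 𝓞 K) : K) ∈ (J (c I)).1 ∧ (a I : K) * ((u : 𝓞 K) : K) ≠ 0),
      (∀ I, |(Algebra.norm ℚ (a I : K) : ℝ)| = (Ideal.absNorm I.1 : ℝ) * nrm (J (c I))) ∧
      Function.Bijective (fun p : NZI K × (𝓞 K)ˣ =>
        (⟨c p.1, ⟨(a p.1 : K) * ((p.2 : 𝓞 K) : K), hm p.1 p.2⟩⟩ :
          Σ c, {x : K // x ∈ (J c).1 ∧ x ≠ 0})) := by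
  choose c hc huniq using fun I : NZI K => hJ (iU I)
  simp only at hc huniq
  choose a ha using hc
  have hmem : ∀ I, (a I : K) ∈ (J (c I)).1 := by
    intro I
    have h1 : (a I : K) ∈ FractionalIdeal.spanSingleton (𝓞 K)⁰ (a I : K) :=
      FractionalIdeal.mem_spanSingleton_self _ _
    rw [← coe_toPrincipalIdeal, ← ha I, Units.val_mul] at h1
    have h2 : (iU I).1 * (J (c I)).1 ≤ 1 * (J (c I)).1 :=
      mul_le_mul_left (by rw [iU, Units.val_mk0]; exact FractionalIdeal.coeIdeal_le_one) _
    rw [one_mul] at h2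
    exact h2 h1
  have hm : ∀ I (u : (𝓞 K)ˣ), (a I : K) * ((u : 𝓞 K) : K) ∈ (J (c I)).1 ∧
      (a I : K) * ((u : 𝓞 K) : K) ≠ 0 := by
    intro I u
    refine ⟨?_, by simp⟩
    have := (J (c I)).1.1.smul_mem (u : 𝓞 K) (hmem I)
    rw [Algebra.smul_def, mul_comm] at this
    exact this
  refine ⟨c, a, hm, ?_, ?_, ?_⟩
  · intro I
    rw [← nrm_princ, ← ha I, nrm_mul, nrm_iU]
  · rintro ⟨I, u⟩ ⟨I', u'⟩ h
    have hcc : c I = c I' := congrArg Sigma.fst h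
    have hv : (a I : K) * ((u : 𝓞 K) : K) = (a I' : K) * ((u' : 𝓞 K) : K) := by
      have := congrArg (fun q : Σ c, {x : K // x ∈ (J c).1 ∧ x ≠ 0} => (q.2 : K)) h
      exact this
    have hI : I = I' := by
      apply iU_inj
      have h1 := ha I
      have h2 := ha I'
      have h3 : toPrincipalIdeal (𝓞 K) K (a I) = toPrincipalIdeal (𝓞 K) K (a I') := by
        ext1
        rw [coe_toPrincipalIdeal, coe_toPrincipalIdeal, FractionalIdeal.spanSingleton_eq_spanSingleton]
        refine ⟨u * u'⁻¹, ?_⟩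
        rw [Units.smul_def, Algebra.smul_def]
        change ((u * u'⁻¹ : (𝓞 K)ˣ) : 𝓞 K) * (a I : K) = _
        have e : (((u'⁻¹ : (𝓞 K)ˣ) : 𝓞 K) : K) * (u' : 𝓞 K) = 1 := by simp
        have e2 : (((u * u'⁻¹ : (𝓞 K)ˣ) : 𝓞 K) : K) = (((u'⁻¹ : (𝓞 K)ˣ) : 𝓞 K) : K) * (u : 𝓞 K) := by
          push_cast; ring
        rw [e2, mul_assoc, mul_comm _ (a I : K), hv, mul_comm _ ((u' : 𝓞 K) : K), ← mul_assoc, e, one_mul]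
      rw [← h1, ← h2, hcc] at h3
      exact mul_right_cancel h3
    subst hI
    have : ((u : 𝓞 K) : K) = ((u' : 𝓞 K) : K) := mul_left_cancel₀ (a I).ne_zero hv
    have : u = u' := Units.ext (RingOfIntegers.ext this)
    rw [this]
  · rintro ⟨d, x, hx, hx0⟩
    let x' : Kˣ := Units.mk0 x hx0
    have hle : (toPrincipalIdeal (𝓞 K) K x' * (J d)⁻¹).1 ≤ 1 := by
      rw [Units.val_mul, coe_toPrincipalIdeal]
      have : FractionalIdeal.spanSingleton (𝓞 K)⁰ (x' : K) ≤ (J d).1 := by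
        rw [FractionalIdeal.spanSingleton_le_iff_mem]; exact hx
      calc _ ≤ (J d).1 * ((J d)⁻¹).1 := mul_le_mul_left this _
        _ = 1 := by rw [← Units.val_mul]; simp
    obtain ⟨I, hI⟩ := FractionalIdeal.le_one_iff_exists_coeIdeal.1 hle
    have hI0 : I ≠ ⊥ := by
      rintro rfl
      rw [FractionalIdeal.coeIdeal_bot] at hI
      exact (toPrincipalIdeal (𝓞 K) K x' * (J d)⁻¹).ne_zero hI.symm
    have hIU : iU ⟨I, hI0⟩ = toPrincipalIdeal (𝓞 K) K x' * (J d)⁻¹ := by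
      ext1
      rw [iU, Units.val_mk0, hI]
    have hp : iU ⟨I, hI0⟩ * J d = toPrincipalIdeal (𝓞 K) K x' := by
      rw [hIU]; simp
    have hd : d = c ⟨I, hI0⟩ := huniq _ _ ⟨x', hp⟩
    subst hd
    rw [ha] at hp
    obtain ⟨u, hu⟩ := princ_eq hp
    refine ⟨⟨⟨I, hI0⟩, u⟩, ?_⟩
    have hu' : (a ⟨I, hI0⟩ : K) * ((u : 𝓞 K) : K) = x := hu.symm
    simp only [hu']

end

end

section
open MeasureTheory Complex NumberField Module NumberField.Units NumberField.Units.dirichletUnitTheorem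
open NumberField.InfinitePlace
open scoped nonZeroDivisors ENNReal

section
variable {K : Type*} [Field K] [NumberField K] {ι : Type*} [Fintype ι]
open scoped Classical

lemma tauV_add (v v' : InfinitePlace K → ℝ) : tauV (v + v') = tauV v + tauV v' := by
  simp only [tauV, Pi.add_apply, mul_add, Finset.sum_add_distrib, add_div]

lemma ellV_add (v v' : InfinitePlace K → ℝ) : ellV (v + v') = ellV v + ellV v' := by
  funext w
  simp only [ellV, Pi.add_apply, tauV_add]
  ring

lemma tsum_fin_sigma {β : ι → Type*} (f : ∀ c, β c → ℝ≥0∞) :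
    ∑ c, ∑' b, f c b = ∑' p : (Σ c, β c), f p.1 p.2 := by
  rw [ENNReal.tsum_sigma, tsum_fintype]

theorem unfold_main {J : ι → (FractionalIdeal (𝓞 K)⁰ K)ˣ} (hJ : IsRep J) (σ : ℝ) :
    ∫⁻ τ : ℝ, ENNReal.ofReal (Real.exp (nn K * σ / 2 * τ)) * ∑ c, FJ' (J c) τ =
    ENNReal.ofReal (del K ^ (-(σ / 2))) * (wK K * ∫⁻ l : logSpace K, Gu (nn K * σ / 2) l) *
      ∑' I : NZI K, ENNReal.ofReal ((Ideal.absNorm I.1 : ℝ) ^ (-σ)) := by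
  set u := nn K * σ / 2 with hu
  have hn := (nn_pos (K := K)).ne'
  have hmeas : ∀ c, Measurable (FJ' (J c)) := fun c => (FJ'_anti (J c)).measurable
  simp only [Finset.mul_sum]
  have hsum : ∫⁻ τ : ℝ, ∑ c, ENNReal.ofReal (Real.exp (u * τ)) * FJ' (J c) τ =
      ∑ c, ∫⁻ τ : ℝ, ENNReal.ofReal (Real.exp (u * τ)) * FJ' (J c) τ :=
    lintegral_finsetSum _ (fun c _ => Measurable.mul (f := fun τ : ℝ => ENNReal.ofReal (Real.exp (u * τ)))
      (by fun_prop) (hmeas c))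
  rw [hsum]
  simp only [mel_FJ']
  rw [tsum_fin_sigma]
  obtain ⟨c, a, hm, hN, hbij⟩ := param hJ
  rw [← (Equiv.ofBijective _ hbij).tsum_eq, ENNReal.tsum_prod', ← ENNReal.tsum_mul_left]
  refine tsum_congr fun I => ?_
  change ∑' v : (𝓞 K)ˣ, ENNReal.ofReal (Real.exp (-(u * (sh (J (c I)) +
    tauV (lamV ((a I : K) * ((v : 𝓞 K) : K))))))) *
    ∫⁻ l in DD K, Gu u (l + ellV (lamV ((a I : K) * ((v : 𝓞 K) : K)))) = _
  have e1 : ∀ v : (𝓞 K)ˣ, lamV ((a I : K) * ((v : 𝓞 K) : K)) = lamV (a I : K) +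
      phi 0 (logEmbedding K (Additive.ofMul v)) := by
    intro v
    rw [lamV_mul (a I).ne_zero (by simp), lamV_unit]
  have hNpos : 0 < (Ideal.absNorm I.1 : ℝ) := by
    rw [← nrm_iU]; exact nrm_pos _
  have e2 : ∀ v : (𝓞 K)ˣ, Real.exp (-(u * (sh (J (c I)) + tauV (lamV ((a I : K) * ((v : 𝓞 K) : K)))))) =
      del K ^ (-(σ / 2)) * (Ideal.absNorm I.1 : ℝ) ^ (-σ) := by
    intro v
    rw [e1, tauV_add, tauV_phi, add_zero, tauV_lam (a I).ne_zero, hN I,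
      Real.log_mul hNpos.ne' (nrm_pos _).ne', sh, Real.rpow_def_of_pos del_pos,
      Real.rpow_def_of_pos hNpos, ← Real.exp_add]
    congr 1
    rw [hu]
    field_simp
    ring
  simp only [e2]
  rw [ENNReal.tsum_mul_left]
  have e3 : ∀ v : (𝓞 K)ˣ, ∀ l, l + ellV (lamV ((a I : K) * ((v : 𝓞 K) : K))) =
      (l + logEmbedding K (Additive.ofMul v)) + ellV (lamV (a I : K)) := by
    intro v l
    rw [e1, ellV_add, ellV_phi]; abel
  simp only [e3]
  rw [units_unfold (fun l => Gu u (l + ellV (lamV (a I : K)))), lintegral_add_right_eq_self,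
    ENNReal.ofReal_mul (Real.rpow_nonneg del_pos.le _)]
  ring

lemma cont_phi : Continuous (fun p : ℝ × logSpace K => phi p.1 p.2) := by
  refine continuous_pi fun w => ?_
  unfold phi
  by_cases h : w = w₀
  · simp only [h, dite_true]; fun_prop
  · simp only [h, dite_false]; fun_prop

lemma haar_phi : ∃ κ : ℝ, 0 < κ ∧ ∀ F : (InfinitePlace K → ℝ) → ℝ≥0∞, Measurable F →
    ∫⁻ l : logSpace K, ∫⁻ τ : ℝ, F (phi τ l) = ENNReal.ofReal κ * ∫⁻ v, F v := by
  let e : (ℝ × logSpace K) ≃+ (InfinitePlace K → ℝ) :=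
    { toFun := fun p => phi p.1 p.2
      invFun := fun v => (tauV v, ellV v)
      left_inv := fun p => by simp [tauV_phi, ellV_phi]
      right_inv := fun v => phi_ell v
      map_add' := fun p q => phi_add _ _ _ _ }
  have hsymm : Continuous e.symm := by
    change Continuous (fun v : InfinitePlace K → ℝ => (tauV v, ellV v))
    unfold ellV tauV
    fun_prop
  have h0 : (volume : Measure (ℝ × logSpace K)).IsAddHaarMeasure :=
    inferInstanceAs ((volume : Measure ℝ).prod (volume : Measure (logSpace K))).IsAddHaarMeasure
  have h1 : ((volume : Measure (ℝ × logSpace K)).map e).IsAddHaarMeasure :=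
    e.isAddHaarMeasure_map volume cont_phi hsymm
  refine ⟨(((volume : Measure (ℝ × logSpace K)).map e).addHaarScalarFactor volume : NNReal), ?_, ?_⟩
  · exact_mod_cast Measure.addHaarScalarFactor_pos_of_isAddHaarMeasure _ _
  · intro F hF
    rw [ENNReal.ofReal_coe_nnreal]
    have h2 := Measure.isAddLeftInvariant_eq_smul ((volume : Measure (ℝ × logSpace K)).map e) volume
    have h3 : ∫⁻ v, F v ∂((volume : Measure (ℝ × logSpace K)).map e) =
        ∫⁻ p : ℝ × logSpace K, F (phi p.1 p.2) := lintegral_map hF meas_phi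
    have h4 : ∫⁻ p : ℝ × logSpace K, F (phi p.1 p.2) = ∫⁻ l : logSpace K, ∫⁻ τ : ℝ, F (phi τ l) := by
      rw [Measure.volume_eq_prod]
      exact lintegral_prod_symm (fun p : ℝ × logSpace K => F (phi p.1 p.2)) (hF.comp meas_phi).aemeasurable
    rw [h2, lintegral_smul_measure] at h3
    rw [← h4, ← h3]
    rfl

/-- local factor -/
lemma local_factor (m σ : ℝ) (hm : 0 < m) (hσ : 0 < σ) :
    Integrable (fun x : ℝ => Real.exp (σ / 2 * (m * x) - Real.pi * (m * Real.exp x))) ∧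
    ∫ x : ℝ, Real.exp (σ / 2 * (m * x) - Real.pi * (m * Real.exp x)) =
      (1 / (Real.pi * m)) ^ (m * σ / 2) * Real.Gamma (m * σ / 2) := by
  have ha : 0 < m * σ / 2 := by positivity
  have hr : 0 < Real.pi * m := by have := Real.pi_pos; positivity
  have key := Real.integral_rpow_mul_exp_neg_mul_Ioi ha hr
  have hintg : IntegrableOn (fun t : ℝ => t ^ (m * σ / 2 - 1) * Real.exp (-(Real.pi * m * t))) (Set.Ioi 0) := by
    by_contra h
    rw [integral_undef h] at key
    have : 0 < (1 / (Real.pi * m)) ^ (m * σ / 2) * Real.Gamma (m * σ / 2) :=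
      mul_pos (by positivity) (Real.Gamma_pos_of_pos ha)
    linarith
  have himg : Real.exp '' Set.univ = Set.Ioi 0 := by simp [Set.image_univ, Real.range_exp]
  have hconv : ∀ x : ℝ, |Real.exp x| • (Real.exp x ^ (m * σ / 2 - 1) * Real.exp (-(Real.pi * m * Real.exp x))) =
      Real.exp (σ / 2 * (m * x) - Real.pi * (m * Real.exp x)) := by
    intro x
    rw [abs_of_pos (Real.exp_pos x), smul_eq_mul, ← Real.exp_mul, ← Real.exp_add, ← Real.exp_add]
    congr 1; ring
  have hd : ∀ x ∈ (Set.univ : Set ℝ), HasDerivWithinAt Real.exp (Real.exp x) Set.univ x :=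
    fun x _ => (Real.hasDerivAt_exp x).hasDerivWithinAt
  have hinj : Set.InjOn Real.exp Set.univ := Real.exp_injective.injOn
  constructor
  · rw [← himg, integrableOn_image_iff_integrableOn_abs_deriv_smul MeasurableSet.univ hd hinj] at hintg
    simpa only [hconv, integrableOn_univ] using hintg
  · rw [← key, ← himg, integral_image_eq_integral_abs_deriv_smul MeasurableSet.univ hd hinj]
    simp only [hconv, setIntegral_univ]

noncomputable def gamK (K : Type*) [Field K] [NumberField K] (σ : ℝ) : ℝ :=
  ∏ w : InfinitePlace K, ((1 / (Real.pi * mult w)) ^ (mult w * σ / 2) * Real.Gamma (mult w * σ / 2))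

lemma int_EE (σ : ℝ) (hσ : 0 < σ) :
    ∫⁻ v : InfinitePlace K → ℝ, ENNReal.ofReal (Real.exp (nn K * σ / 2 * tauV v)) * EE v =
      ENNReal.ofReal (gamK K σ) := by
  have hn := (nn_pos (K := K)).ne'
  have e : ∀ v : InfinitePlace K → ℝ, ENNReal.ofReal (Real.exp (nn K * σ / 2 * tauV v)) * EE v =
      ENNReal.ofReal (∏ w, Real.exp (σ / 2 * (mult w * v w) - Real.pi * (mult w * Real.exp (v w)))) := by
    intro v
    rw [EE, ← ENNReal.ofReal_mul (Real.exp_pos _).le, ← Real.exp_add, ← Real.exp_sum,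
      Finset.sum_sub_distrib, ← Finset.mul_sum, ← Finset.mul_sum, tauV]
    congr 2
    field_simp
    ring
  simp only [e]
  rw [← ofReal_integral_eq_lintegral_ofReal]
  · rw [integral_fintype_prod_volume_eq_prod
      (fun (w : InfinitePlace K) (x : ℝ) => Real.exp (σ / 2 * (mult w * x) - Real.pi * (mult w * Real.exp x)))]
    congr 1
    refine Finset.prod_congr rfl fun w _ => ?_
    exact (local_factor _ σ (mult_pos' w) hσ).2
  · exact Integrable.fintype_prod (fun w => (local_factor _ σ (mult_pos' w) hσ).1)
  · exact Filter.Eventually.of_forall fun v => by positivity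

lemma exists_kap : ∃ κ : ℝ, 0 < κ ∧ ∀ σ, 0 < σ →
    (wK K : ℝ≥0∞) * ∫⁻ l : logSpace K, Gu (nn K * σ / 2) l = ENNReal.ofReal (κ * gamK K σ) := by
  obtain ⟨κ, hκ, h⟩ := haar_phi (K := K)
  have hw : (0 : ℝ) < wK K := by exact_mod_cast wK_pos
  refine ⟨wK K * κ, by positivity, fun σ hσ => ?_⟩
  have := h (fun v => ENNReal.ofReal (Real.exp (nn K * σ / 2 * tauV v)) * EE v)
    (Measurable.mul (f := fun v : InfinitePlace K → ℝ => ENNReal.ofReal (Real.exp (nn K * σ / 2 * tauV v)))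
      (by unfold tauV; fun_prop) meas_EE)
  simp only [tauV_phi] at this
  rw [int_EE σ hσ] at this
  simp only [Gu]
  rw [this, ENNReal.ofReal_mul (by positivity), ENNReal.ofReal_mul (by positivity), mul_assoc]
  simp

end

end

section
open MeasureTheory Complex NumberField Module NumberField.Units NumberField.Units.dirichletUnitTheorem
open NumberField.InfinitePlace
open scoped nonZeroDivisors ENNReal

section
variable {K : Type*} [Field K] [NumberField K] {ι : Type*} [Fintype ι]
open scoped Classical

lemma exists_rep : ∃ J : ClassGroup (𝓞 K) → (FractionalIdeal (𝓞 K)⁰ K)ˣ, IsRep J := by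
  let e := ClassGroup.equiv (R := 𝓞 K) K
  let Q := (FractionalIdeal (𝓞 K)⁰ K)ˣ ⧸ (toPrincipalIdeal (𝓞 K) K).range
  refine ⟨fun c => (Quotient.out (e c : Q))⁻¹, fun I => ?_⟩
  have key : ∀ c, (∃ a : Kˣ, I * (Quotient.out (e c : Q))⁻¹ = toPrincipalIdeal (𝓞 K) K a) ↔
      e c = (QuotientGroup.mk I : Q) := by
    intro c
    have h2 : (QuotientGroup.mk (Quotient.out (e c : Q)) : Q) = e c := QuotientGroup.out_eq' _
    have h3 : e c = (QuotientGroup.mk I : Q) ↔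
        (QuotientGroup.mk (Quotient.out (e c : Q)) : Q) = (QuotientGroup.mk I : Q) := by rw [h2]
    rw [h3, QuotientGroup.eq]
    constructor
    · rintro ⟨a, ha⟩
      exact ⟨a, by rw [← ha, mul_comm]⟩
    · rintro ⟨a, ha⟩
      exact ⟨a, by rw [ha, mul_comm]⟩
  simp only [key]
  refine ⟨e.symm (QuotientGroup.mk I), by simp, fun c hc => ?_⟩
  rw [← hc]; simp

lemma lint_sub (J : ι → (FractionalIdeal (𝓞 K)⁰ K)ˣ) (u : ℝ) :
    ∫⁻ x in Set.Ioi (0:ℝ), ENNReal.ofReal (x ^ (u - 1) * FF J x) =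
      ∫⁻ τ : ℝ, ENNReal.ofReal (Real.exp (u * τ)) * ∑ c, FJ' (J c) τ := by
  have himg : Real.exp '' Set.univ = Set.Ioi 0 := by simp [Set.image_univ, Real.range_exp]
  have hd : ∀ x ∈ (Set.univ : Set ℝ), HasDerivWithinAt Real.exp (Real.exp x) Set.univ x :=
    fun x _ => (Real.hasDerivAt_exp x).hasDerivWithinAt
  rw [← himg, lintegral_image_eq_lintegral_abs_deriv_mul MeasurableSet.univ hd
    (Real.exp_injective.injOn), Measure.restrict_univ]
  refine lintegral_congr fun τ => ?_
  rw [FF, Real.log_exp, abs_of_pos (Real.exp_pos _), ENNReal.ofReal_mul (by positivity),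
    ENNReal.ofReal_toReal (FFsum_ne_top J _), ← mul_assoc, ← ENNReal.ofReal_mul (by positivity),
    ← Real.exp_mul, ← Real.exp_add]
  congr 3
  ring

lemma mellin_val {J : ι → (FractionalIdeal (𝓞 K)⁰ K)ˣ} (hJ : IsRep J) (P : WeakFEPair ℂ)
    (hk : P.k = nn K / 2) (hf : ∀ x, P.f x - P.f₀ = (FF J x : ℂ)) {κ : ℝ} (hκ : 0 < κ)
    (hκ2 : ∀ σ, 0 < σ →
    (wK K : ℝ≥0∞) * ∫⁻ l : logSpace K, Gu (nn K * σ / 2) l = ENNReal.ofReal (κ * gamK K σ))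
    {σ : ℝ} (hσ : 1 < σ) :
    Summable (fun I : NZI K => (Ideal.absNorm I.1 : ℝ) ^ (-σ)) ∧
    P.Λ ((nn K * σ / 2 : ℝ) : ℂ) = ((del K ^ (-(σ / 2)) * (κ * gamK K σ) *
      ∑' I : NZI K, (Ideal.absNorm I.1 : ℝ) ^ (-σ) : ℝ) : ℂ) := by
  have hn := nn_pos (K := K)
  have hM := P.hasMellin (s := ((nn K * σ / 2 : ℝ) : ℂ)) (by
    rw [hk, Complex.ofReal_re]; nlinarith)
  set u := nn K * σ / 2 with hu
  have hg : 0 < gamK K σ := by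
    unfold gamK
    refine Finset.prod_pos fun w _ => ?_
    have := mult_pos' w
    have hpi := Real.pi_pos
    exact mul_pos (by positivity) (Real.Gamma_pos_of_pos (by positivity))
  have hdel := del_pos (K := K)
  simp only [hf] at hM
  have heq : ∀ x ∈ Set.Ioi (0:ℝ), (x : ℂ) ^ ((u : ℂ) - 1) • (FF J x : ℂ) = ((x ^ (u - 1) * FF J x : ℝ) : ℂ) := by
    intro x hx
    rw [smul_eq_mul, Complex.ofReal_mul, Complex.ofReal_cpow (le_of_lt hx)]
    push_cast
    rfl
  have hI : IntegrableOn (fun x : ℝ => x ^ (u - 1) * FF J x) (Set.Ioi 0) := by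
    have h1 : IntegrableOn (fun x : ℝ => (x : ℂ) ^ ((u : ℂ) - 1) • (FF J x : ℂ)) (Set.Ioi 0) := hM.1
    have h2 := (h1.congr_fun heq measurableSet_Ioi).re
    simp at h2
    exact h2
  have hnn : 0 ≤ᵐ[volume.restrict (Set.Ioi 0)] (fun x : ℝ => x ^ (u - 1) * FF J x) := by
    refine (ae_restrict_iff' measurableSet_Ioi).2 (Filter.Eventually.of_forall fun x hx => ?_)
    have : (0:ℝ) < x := hx
    exact mul_nonneg (by positivity) (FF_nonneg J x)
  have hintg : ∫ x in Set.Ioi (0:ℝ), x ^ (u - 1) * FF J x =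
      (∫⁻ x in Set.Ioi (0:ℝ), ENNReal.ofReal (x ^ (u - 1) * FF J x)).toReal :=
    integral_eq_lintegral_of_nonneg_ae hnn hI.1
  have hfin : ∫⁻ x in Set.Ioi (0:ℝ), ENNReal.ofReal (x ^ (u - 1) * FF J x) ≠ ⊤ := by
    rw [← ofReal_integral_eq_lintegral_ofReal hI hnn]
    exact ENNReal.ofReal_ne_top
  rw [lint_sub, hu, unfold_main hJ, hκ2 σ (by linarith)] at hintg hfin
  have hS : ∑' I : NZI K, ENNReal.ofReal ((Ideal.absNorm I.1 : ℝ) ^ (-σ)) ≠ ⊤ := by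
    intro h
    rw [h, ENNReal.mul_top] at hfin
    · exact hfin rfl
    · rw [← ENNReal.ofReal_mul (by positivity)]
      exact (ENNReal.ofReal_pos.2 (by positivity)).ne'
  have hsum : Summable (fun I : NZI K => (Ideal.absNorm I.1 : ℝ) ^ (-σ)) := by
    have := ENNReal.summable_toReal hS
    refine this.congr fun I => ENNReal.toReal_ofReal (by positivity)
  refine ⟨hsum, ?_⟩
  rw [← ENNReal.ofReal_tsum_of_nonneg (fun I => by positivity) hsum, ENNReal.toReal_mul, ENNReal.toReal_mul,
    ENNReal.toReal_ofReal (by positivity), ENNReal.toReal_ofReal (by positivity),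
    ENNReal.toReal_ofReal (tsum_nonneg fun I => by positivity), ← hu] at hintg
  rw [← hM.2, ← hintg, mellin, setIntegral_congr_fun measurableSet_Ioi heq]
  exact integral_ofReal

lemma gamK_eq : ∃ B : ℝ, 0 < B ∧ ∀ σ : ℝ, 0 < σ → gamK K σ = B ^ σ *
    (Real.Gamma (σ / 2) ^ nrRealPlaces K * Real.Gamma σ ^ nrComplexPlaces K) := by
  have hpi := Real.pi_pos
  refine ⟨∏ w : InfinitePlace K, (1 / (Real.pi * mult w)) ^ ((mult w : ℝ) / 2), ?_, ?_⟩
  · refine Finset.prod_pos fun w _ => ?_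
    have := mult_pos' w
    positivity
  · intro σ hσ
    unfold gamK
    rw [Finset.prod_mul_distrib, ← Real.finsetProd_rpow]
    · congr 1
      · refine Finset.prod_congr rfl fun w _ => ?_
        have := mult_pos' w
        rw [← Real.rpow_mul (by positivity)]
        congr 1; ring
      · have : ∀ w : InfinitePlace K, Real.Gamma (mult w * σ / 2) =
          if IsReal w then Real.Gamma (σ / 2) else Real.Gamma σ := by
          intro w
          unfold mult
          split_ifs <;> simp
        simp only [this]
        rw [Finset.prod_ite, Finset.prod_const, Finset.prod_const, nrRealPlaces, nrComplexPlaces,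
          Fintype.card_subtype, Fintype.card_subtype]
        simp only [not_isReal_iff_isComplex]
    · intro w _
      positivity

end

end

section
open MeasureTheory Complex

section

lemma fact_bound (c : ℝ) (hc : 0 < c) : ∃ M : ℝ, 0 ≤ M ∧ ∀ N : ℕ, 1 ≤ N →
    (1 / c) ^ (N : ℝ) * Real.Gamma N ≤ Real.exp (M * (N : ℝ) ^ (3/2 : ℝ)) := by
  refine ⟨|Real.log c| + 2, by positivity, fun N hN => ?_⟩
  have hN1 : (1:ℝ) ≤ N := by exact_mod_cast hN
  have hN0 : (0:ℝ) < N := by linarith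
  have e32 : (N:ℝ) ^ (3/2:ℝ) = N * (N:ℝ) ^ (1/2:ℝ) := by
    rw [show (3/2:ℝ) = 1 + 1/2 by norm_num, Real.rpow_add hN0, Real.rpow_one]
  have hr : 1 ≤ (N:ℝ) ^ (1/2:ℝ) := Real.one_le_rpow hN1 (by norm_num)
  have h1 : (1 / c) ^ (N : ℝ) ≤ Real.exp (|Real.log c| * N ^ (3/2:ℝ)) := by
    rw [Real.rpow_def_of_pos (by positivity)]
    refine Real.exp_le_exp.2 ?_
    rw [one_div, Real.log_inv]
    have : -Real.log c ≤ |Real.log c| := neg_le_abs _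
    calc -Real.log c * N ≤ |Real.log c| * N := by gcongr
      _ ≤ _ := by rw [e32]; gcongr; exact le_mul_of_one_le_right hN0.le hr
  have h2 : Real.Gamma N ≤ Real.exp (2 * N ^ (3/2:ℝ)) := by
    obtain ⟨k, rfl⟩ : ∃ k, N = k + 1 := ⟨N - 1, by omega⟩
    push_cast at *
    rw [Real.Gamma_nat_eq_factorial]
    have h3 : ((k.factorial : ℕ) : ℝ) ≤ ((k:ℝ) + 1) ^ (k + 1) := by
      have := Nat.factorial_le_pow k
      calc ((k.factorial : ℕ) : ℝ) ≤ (k:ℝ) ^ k := by exact_mod_cast this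
        _ ≤ ((k:ℝ)+1) ^ k := by gcongr; linarith
        _ ≤ _ := pow_le_pow_right₀ hN1 (by omega)
    refine h3.trans ?_
    rw [← Real.rpow_natCast, Real.rpow_def_of_pos hN0]
    refine Real.exp_le_exp.2 ?_
    have := Real.log_le_rpow_div hN0.le (show (0:ℝ) < 1/2 by norm_num)
    rw [e32]
    push_cast
    nlinarith
  calc _ ≤ Real.exp (|Real.log c| * N ^ (3/2:ℝ)) * Real.exp (2 * N ^ (3/2:ℝ)) := by
        gcongr
    _ = _ := by rw [← Real.exp_add]; ring_nf

lemma Lam0_half (P : WeakFEPair ℂ) {C c : ℝ} (hC : 0 ≤ C) (hc : 0 < c)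
    (h : ∀ x, 1 ≤ x → ‖P.f x - P.f₀‖ ≤ C * Real.exp (-(c * x))) :
    ∃ M : ℝ, 0 ≤ M ∧ ∀ (N : ℕ) (w : ℂ), 1 ≤ N → P.k / 2 ≤ w.re → w.re ≤ N →
      ‖P.Λ₀ w‖ ≤ M * Real.exp (M * (N : ℝ) ^ (3/2 : ℝ)) := by
  obtain ⟨M, hM, hMb⟩ := fact_bound c hc
  set a : ℝ := P.k / 2
  have hconv : ∀ w : ℂ, IntegrableOn (fun x : ℝ => ‖(x : ℂ) ^ (w - 1) • P.f_modif x‖) (Set.Ioi 0) :=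
    fun w => Integrable.norm (P.isStrongFEPair_toStrongFEPair.hasMellin w).1
  set A := ∫ x in Set.Ioi (0:ℝ), ‖(x : ℂ) ^ ((a : ℂ) - 1) • P.f_modif x‖ with hA
  have hA0 : 0 ≤ A := integral_nonneg fun x => norm_nonneg _
  refine ⟨A + C + M, by positivity, fun N w hN hw1 hw2 => ?_⟩
  have hN1 : (1:ℝ) ≤ N := by exact_mod_cast hN
  have hN0 : (0:ℝ) < N := by linarith
  have key := Real.integral_rpow_mul_exp_neg_mul_Ioi hN0 hc
  have hintg : IntegrableOn (fun t : ℝ => t ^ ((N:ℝ) - 1) * Real.exp (-(c * t))) (Set.Ioi 0) := by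
    by_contra h
    rw [integral_undef h] at key
    have : 0 < (1 / c) ^ (N:ℝ) * Real.Gamma N :=
      mul_pos (by positivity) (Real.Gamma_pos_of_pos hN0)
    linarith
  have hb : ‖P.Λ₀ w‖ ≤ A + C * ((1 / c) ^ (N:ℝ) * Real.Gamma N) := by
    rw [WeakFEPair.Λ₀, mellin]
    refine (norm_integral_le_integral_norm _).trans ?_
    rw [← key, hA, ← integral_const_mul, ← integral_add (hconv a) (hintg.const_mul C)]
    refine setIntegral_mono_on (hconv w) ((hconv a).add (hintg.const_mul C)) measurableSet_Ioi ?_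
    intro x hx
    have hx : (0:ℝ) < x := hx
    simp only [norm_smul, Complex.norm_cpow_eq_rpow_re_of_pos hx, Complex.sub_re, Complex.one_re,
      Complex.ofReal_re]
    by_cases h1 : x ≤ 1
    · have : x ^ (w.re - 1) ≤ x ^ (a - 1) :=
        Real.rpow_le_rpow_of_exponent_ge hx h1 (by linarith)
      have h3 : 0 ≤ C * (x ^ ((N:ℝ) - 1) * Real.exp (-(c * x))) := by positivity
      have := mul_le_mul_of_nonneg_right this (norm_nonneg (P.f_modif x))
      linarith
    · push Not at h1
      have e : P.f_modif x = P.f x - P.f₀ := by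
        simp [WeakFEPair.f_modif, h1, h1.le, not_lt.2 h1.le]
      have h4 : x ^ (w.re - 1) ≤ x ^ ((N:ℝ) - 1) :=
        Real.rpow_le_rpow_of_exponent_le h1.le (by linarith)
      have h3 : 0 ≤ x ^ (a - 1) * ‖P.f_modif x‖ := by positivity
      have : x ^ (w.re - 1) * ‖P.f_modif x‖ ≤ x ^ ((N:ℝ) - 1) * (C * Real.exp (-(c * x))) := by
        rw [e]
        exact mul_le_mul h4 (h x h1.le) (norm_nonneg _) (by positivity)
      nlinarith
  refine hb.trans ?_
  have h5 := hMb N hN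
  have h6 : 1 ≤ Real.exp ((A + C + M) * (N:ℝ) ^ (3/2:ℝ)) := Real.one_le_exp (by positivity)
  have h7 : Real.exp (M * (N : ℝ) ^ (3/2 : ℝ)) ≤ Real.exp ((A + C + M) * (N:ℝ) ^ (3/2:ℝ)) := by
    gcongr; linarith
  calc _ ≤ A * Real.exp ((A + C + M) * (N:ℝ) ^ (3/2:ℝ)) + C * Real.exp ((A + C + M) * (N:ℝ) ^ (3/2:ℝ))
      + M * Real.exp ((A + C + M) * (N:ℝ) ^ (3/2:ℝ)) := by
        have := mul_le_mul_of_nonneg_left (h5.trans h7) hC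
        have := mul_le_mul_of_nonneg_left h6 hA0
        have : 0 ≤ M * Real.exp ((A + C + M) * (N:ℝ) ^ (3/2:ℝ)) := by positivity
        linarith
    _ = _ := by ring

/-- the completed entire function -/
noncomputable def XP (P : WeakFEPair ℂ) (s : ℂ) : ℂ :=
  s * (s - 1) * P.Λ₀ (P.k * s) - (1 / P.k) * (s - 1) * P.f₀ + (1 / P.k) * s * (P.ε * P.g₀)

lemma XP_diff (P : WeakFEPair ℂ) : Differentiable ℂ (XP P) := by
  have := P.differentiable_Λ₀
  unfold XP
  fun_prop

lemma XP_symm (P : WeakFEPair ℂ) (s : ℂ) : XP P (1 - s) = P.ε * XP P.symm s := by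
  have h := P.functional_equation₀ (P.k * s)
  have e : (P.k : ℂ) - P.k * s = P.k * (1 - s) := by ring
  rw [e, smul_eq_mul] at h
  have hε := P.hε
  simp only [XP, h, show P.symm.k = P.k from rfl, show P.symm.f₀ = P.g₀ from rfl,
    show P.symm.g₀ = P.f₀ from rfl, show P.symm.ε = P.ε⁻¹ from rfl]
  field_simp
  ring

lemma XP_Lam (P : WeakFEPair ℂ) {s : ℂ} (h0 : s ≠ 0) (h1 : s ≠ 1) :
    XP P s = s * (s - 1) * P.Λ (P.k * s) := by
  have hk : (P.k : ℂ) ≠ 0 := by exact_mod_cast P.hk.ne'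
  have h1' : 1 - s ≠ 0 := sub_ne_zero.2 h1.symm
  have e : (P.k : ℂ) - P.k * s = P.k * (1 - s) := by ring
  rw [XP, P.Λ₀_eq, e, smul_eq_mul, smul_eq_mul]
  field_simp
  ring

lemma XP_half (P : WeakFEPair ℂ) {C c : ℝ} (hC : 0 ≤ C) (hc : 0 < c)
    (h : ∀ x, 1 ≤ x → ‖P.f x - P.f₀‖ ≤ C * Real.exp (-(c * x))) :
    ∃ M : ℝ, 0 ≤ M ∧ ∀ (R : ℝ) (s : ℂ), 1 ≤ R → ‖s‖ ≤ R → 1 / 2 ≤ s.re →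
      ‖XP P s‖ ≤ Real.exp (M * R ^ (3/2 : ℝ)) := by
  obtain ⟨M, hM, hb⟩ := Lam0_half P hC hc h
  have hk := P.hk
  set k := P.k
  set D := 2 + M + ‖(1 / k : ℂ)‖ * (2 * ‖P.f₀‖ + ‖P.ε * P.g₀‖) with hD
  have hD0 : 0 ≤ D := by positivity
  refine ⟨D + 2 + M * (k + 2) ^ (3/2 : ℝ), by positivity, fun R s hR hs hre => ?_⟩
  have hR0 : 0 < R := by linarith
  set N : ℕ := ⌈k * R⌉₊ + 1 with hN
  have hNle : (N : ℝ) ≤ (k + 2) * R := by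
    rw [hN]; push_cast
    have := Nat.ceil_lt_add_one (a := k * R) (by positivity)
    nlinarith
  have hkR : k * R ≤ N := by
    rw [hN]; push_cast
    have := Nat.le_ceil (k * R)
    linarith
  have hre2 : ((k : ℂ) * s).re = k * s.re := by simp
  have hL := hb N (k * s) (by omega) (by rw [hre2]; nlinarith) (by
    rw [hre2]
    have := (Complex.re_le_norm s).trans hs
    nlinarith)
  have hE : Real.exp (M * (N:ℝ) ^ (3/2:ℝ)) ≤ Real.exp (M * (k + 2) ^ (3/2 : ℝ) * R ^ (3/2:ℝ)) := by
    rw [mul_assoc, ← Real.mul_rpow (by positivity) hR0.le]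
    gcongr
  set E := Real.exp (M * (k + 2) ^ (3/2 : ℝ) * R ^ (3/2:ℝ))
  have hE1 : 1 ≤ E := Real.one_le_exp (by positivity)
  have hs1 : ‖s - 1‖ ≤ 2 * R := (norm_sub_le _ _).trans (by simp; linarith)
  have hL' : ‖P.Λ₀ (k * s)‖ ≤ M * E := hL.trans (by gcongr)
  have hRR : R ≤ R ^ 2 := by nlinarith
  have hb1 : ‖s * (s - 1) * P.Λ₀ (k * s)‖ ≤ 2 * M * R ^ 2 * E := by
    rw [norm_mul, norm_mul]
    calc _ ≤ R * (2 * R) * (M * E) := by gcongr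
      _ = _ := by ring
  have hb2 : ‖(1 / k : ℂ) * (s - 1) * P.f₀‖ ≤ ‖(1 / k : ℂ)‖ * (2 * ‖P.f₀‖) * R ^ 2 * E := by
    rw [norm_mul, norm_mul]
    calc _ ≤ ‖(1 / k : ℂ)‖ * (2 * R) * ‖P.f₀‖ := by gcongr
      _ ≤ ‖(1 / k : ℂ)‖ * (2 * R ^ 2) * ‖P.f₀‖ := by gcongr
      _ = ‖(1 / k : ℂ)‖ * (2 * ‖P.f₀‖) * R ^ 2 * 1 := by ring
      _ ≤ _ := by gcongr
  have hb3 : ‖(1 / k : ℂ) * s * (P.ε * P.g₀)‖ ≤ ‖(1 / k : ℂ)‖ * ‖P.ε * P.g₀‖ * R ^ 2 * E := by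
    rw [norm_mul, norm_mul]
    calc _ ≤ ‖(1 / k : ℂ)‖ * R * ‖P.ε * P.g₀‖ := by gcongr
      _ ≤ ‖(1 / k : ℂ)‖ * R ^ 2 * ‖P.ε * P.g₀‖ := by gcongr
      _ = ‖(1 / k : ℂ)‖ * ‖P.ε * P.g₀‖ * R ^ 2 * 1 := by ring
      _ ≤ _ := by gcongr
  have hT : ‖XP P s‖ ≤ 2 * D * R ^ 2 * E := by
    refine (norm_add_le _ _).trans ((add_le_add_left (norm_sub_le _ _) _).trans ?_)
    refine (add_le_add (add_le_add hb1 hb2) hb3).trans ?_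
    have : 0 ≤ R ^ 2 * E := by positivity
    rw [hD]
    have h8 : 0 ≤ ‖(1 / k : ℂ)‖ * (2 * ‖P.f₀‖ + ‖P.ε * P.g₀‖) * (R ^ 2 * E) := by positivity
    nlinarith
  have hR32 : R ≤ R ^ (3/2:ℝ) := by
    calc R = R ^ (1:ℝ) := (Real.rpow_one R).symm
      _ ≤ _ := Real.rpow_le_rpow_of_exponent_le hR (by norm_num)
  have hD2 : 2 * D ≤ Real.exp (2 * D) := by linarith [Real.add_one_le_exp (2 * D)]
  have hD2 : 2 * D ≤ Real.exp (D * R ^ (3/2:ℝ)) * 2 := by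
    have h9 := Real.add_one_le_exp D
    have : Real.exp D ≤ Real.exp (D * R ^ (3/2:ℝ)) := by
      gcongr; nlinarith
    linarith
  have hRe : 2 * R ^ 2 ≤ Real.exp (2 * R ^ (3/2:ℝ)) := by
    have h10 := Real.quadratic_le_exp_of_nonneg (x := 2 * R) (by positivity)
    have : Real.exp (2 * R) ≤ Real.exp (2 * R ^ (3/2:ℝ)) := by gcongr
    nlinarith
  calc ‖XP P s‖ ≤ 2 * D * R ^ 2 * E := hT
    _ ≤ Real.exp (D * R ^ (3/2:ℝ)) * 2 * R ^ 2 * E := by gcongr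
    _ = Real.exp (D * R ^ (3/2:ℝ)) * (2 * R ^ 2) * E := by ring
    _ ≤ Real.exp (D * R ^ (3/2:ℝ)) * Real.exp (2 * R ^ (3/2:ℝ)) * E := by gcongr
    _ = _ := by rw [← Real.exp_add, ← Real.exp_add]; ring_nf

lemma XP_growth (P : WeakFEPair ℂ) {C c C' c' : ℝ} (hC : 0 ≤ C) (hc : 0 < c)
    (h : ∀ x, 1 ≤ x → ‖P.f x - P.f₀‖ ≤ C * Real.exp (-(c * x))) (hC' : 0 ≤ C') (hc' : 0 < c')
    (h' : ∀ x, 1 ≤ x → ‖P.g x - P.g₀‖ ≤ C' * Real.exp (-(c' * x))) :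
    ∃ M : ℝ, 0 ≤ M ∧ ∀ (R : ℝ) (s : ℂ), 1 ≤ R → ‖s‖ ≤ R →
      ‖XP P s‖ ≤ Real.exp (M * R ^ (3/2 : ℝ)) := by
  obtain ⟨M, hM, hb⟩ := XP_half P hC hc h
  obtain ⟨M', hM', hb'⟩ := XP_half P.symm hC' hc' h'
  refine ⟨M + M' * 2 ^ (3/2:ℝ) + ‖P.ε‖, by positivity, fun R s hR hs => ?_⟩
  have hR0 : 0 < R := by linarith
  have hR32 : 1 ≤ R ^ (3/2:ℝ) := Real.one_le_rpow hR (by norm_num)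
  by_cases hre : 1 / 2 ≤ s.re
  · refine (hb R s hR hs hre).trans ?_
    gcongr
    have : 0 ≤ M' * 2 ^ (3/2:ℝ) + ‖P.ε‖ := by positivity
    linarith
  · have e : XP P s = P.ε * XP P.symm (1 - s) := by
      rw [← XP_symm]; congr 1; ring
    have h1 := hb' (2 * R) (1 - s) (by linarith) ((norm_sub_le _ _).trans (by simp; linarith))
      (by simp; linarith)
    rw [e, norm_mul]
    have h2 : ‖P.ε‖ ≤ Real.exp (‖P.ε‖ * R ^ (3/2:ℝ)) := by
      have := Real.add_one_le_exp (‖P.ε‖ * R ^ (3/2:ℝ))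
      have : ‖P.ε‖ ≤ ‖P.ε‖ * R ^ (3/2:ℝ) := le_mul_of_one_le_right (norm_nonneg _) hR32
      linarith
    calc _ ≤ Real.exp (‖P.ε‖ * R ^ (3/2:ℝ)) * Real.exp (M' * (2 * R) ^ (3/2:ℝ)) := by gcongr
      _ ≤ _ := by
        rw [← Real.exp_add, Real.mul_rpow (by norm_num) hR0.le]
        gcongr
        have : 0 ≤ M * R ^ (3/2:ℝ) := by positivity
        nlinarith

end

end

section
open MeasureTheory Complex NumberField Module NumberField.Units NumberField.Units.dirichletUnitTheorem
open NumberField.InfinitePlace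
open scoped nonZeroDivisors ENNReal

section
open scoped Classical

lemma real_ident {f g : ℂ → ℂ} {U : Set ℂ} (hf : AnalyticOnNhd ℂ f U) (hg : AnalyticOnNhd ℂ g U)
    (hU : IsPreconnected U) (h2 : (2 : ℂ) ∈ U)
    (h : ∀ σ : ℝ, 1 < σ → f σ = g σ) : Set.EqOn f g U := by
  refine hf.eqOn_of_preconnected_of_frequently_eq hg hU h2 ?_
  have h1 : Filter.Tendsto (fun x : ℝ => (x : ℂ)) (nhdsWithin 2 {2}ᶜ) (nhdsWithin 2 {2}ᶜ) := by
    refine tendsto_nhdsWithin_iff.2 ⟨?_, ?_⟩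
    · refine Filter.Tendsto.mono_left ?_ nhdsWithin_le_nhds
      exact_mod_cast (Complex.continuous_ofReal.tendsto 2)
    · filter_upwards [self_mem_nhdsWithin] with x hx hx2
      have hx3 : (x : ℂ) = 2 := hx2
      have hx4 : x = 2 := by exact_mod_cast hx3
      exact hx hx4
  refine h1.frequently (Filter.Eventually.frequently ?_)
  have : ∀ᶠ x : ℝ in nhds 2, 1 < x := lt_mem_nhds (by norm_num)
  filter_upwards [nhdsWithin_le_nhds this] with x hx
  exact h x hx

theorem FE_main (K : Type*) [Field K] [NumberField K] :
    ∃ (X : ℂ → ℂ) (κ A M : ℝ) (c : ℂ), Differentiable ℂ X ∧ 0 < κ ∧ 0 < A ∧ 0 ≤ M ∧ c ≠ 0 ∧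
      (∀ σ : ℝ, 1 < σ → Summable (fun I : NZI K => (Ideal.absNorm I.1 : ℝ) ^ (-σ)) ∧
        X σ = ((κ * A ^ σ * (σ * (σ - 1)) * (Real.Gamma (σ / 2) ^ nrRealPlaces K *
          Real.Gamma σ ^ nrComplexPlaces K) * ∑' I : NZI K, (Ideal.absNorm I.1 : ℝ) ^ (-σ) : ℝ) : ℂ)) ∧
      (∀ s, X (1 - s) = c * X s) ∧
      (∀ (R : ℝ) (s : ℂ), 1 ≤ R → ‖s‖ ≤ R → ‖X s‖ ≤ Real.exp (M * R ^ (3/2 : ℝ))) ∧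
      X 0 ≠ 0 ∧ X 1 ≠ 0 := by
  obtain ⟨J, hJ⟩ := exists_rep (K := K)
  obtain ⟨κ, hκ, hκ2⟩ := exists_kap (K := K)
  obtain ⟨B, hB, hBg⟩ := gamK_eq (K := K)
  obtain ⟨C, c, hC, hc, h⟩ := FF_bound J
  obtain ⟨C', c', hC', hc', h'⟩ := FF_bound (fun i => dualU (J i))
  have hn := nn_pos (K := K)
  have hdel := del_pos (K := K)
  set P := pairK J with hP
  have hf : ∀ x, P.f x - P.f₀ = (FF J x : ℂ) := fun x => by
    simp [hP, pairK]
  have hg : ∀ x, P.g x - P.g₀ = (FF (fun i => dualU (J i)) x : ℂ) := fun x => by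
    simp [hP, pairK]
  have hPk : P.k = nn K / 2 := rfl
  obtain ⟨M, hM, hMb⟩ := XP_growth P hC hc (fun x hx => by
    rw [hf, Complex.norm_real, Real.norm_of_nonneg (FF_nonneg _ _)]; exact h x hx) hC' hc' (fun x hx => by
    rw [hg, Complex.norm_real, Real.norm_of_nonneg (FF_nonneg _ _)]; exact h' x hx)
  have hA : 0 < B * del K ^ (-(1/2) : ℝ) := by positivity
  have val : ∀ (Q : WeakFEPair ℂ) (J' : ClassGroup (𝓞 K) → (FractionalIdeal (𝓞 K)⁰ K)ˣ), IsRep J' →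
      Q.k = nn K / 2 → (∀ x, Q.f x - Q.f₀ = (FF J' x : ℂ)) → ∀ σ : ℝ, 1 < σ →
      Summable (fun I : NZI K => (Ideal.absNorm I.1 : ℝ) ^ (-σ)) ∧
        XP Q σ = ((κ * (B * del K ^ (-(1/2) : ℝ)) ^ σ * (σ * (σ - 1)) * (Real.Gamma (σ / 2) ^ nrRealPlaces K *
          Real.Gamma σ ^ nrComplexPlaces K) * ∑' I : NZI K, (Ideal.absNorm I.1 : ℝ) ^ (-σ) : ℝ) : ℂ) := by
    intro Q J' hJ' hQ hQf σ hσ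
    obtain ⟨h1, h2⟩ := mellin_val hJ' Q hQ hQf hκ hκ2 hσ
    refine ⟨h1, ?_⟩
    rw [XP_Lam Q (by exact_mod_cast (by linarith : σ ≠ 0)) (by exact_mod_cast hσ.ne'), hQ,
      show (((nn K / 2 : ℝ) : ℂ) * (σ : ℂ)) = ((nn K * σ / 2 : ℝ) : ℂ) by push_cast; ring, h2,
      hBg σ (by linarith), Real.mul_rpow hB.le (by positivity), ← Real.rpow_mul hdel.le,
      show (-(1/2) : ℝ) * σ = -(σ / 2) by ring]
    push_cast
    ring
  have hsym : XP P.symm = XP P := by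
    have := real_ident (U := Set.univ) ((XP_diff P.symm).differentiableOn.analyticOnNhd isOpen_univ)
      ((XP_diff P).differentiableOn.analyticOnNhd isOpen_univ) isPreconnected_univ (Set.mem_univ _)
      (fun σ hσ => by rw [(val P.symm _ hJ.dual hPk hg σ hσ).2, (val P J hJ hPk hf σ hσ).2])
    exact Set.eqOn_univ _ _ |>.1 this
  have hV : VV K (ClassGroup (𝓞 K)) ≠ 0 := by
    unfold VV
    refine mul_ne_zero (by exact_mod_cast Fintype.card_ne_zero) ?_
    exact ENNReal.toReal_ne_zero.2 ⟨DD_vol_ne, DD_vol_lt.ne⟩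
  have hk : (P.k : ℂ) ≠ 0 := by exact_mod_cast P.hk.ne'
  refine ⟨XP P, κ, B * del K ^ (-(1/2) : ℝ), M, P.ε, XP_diff P, hκ, hA, hM, P.hε, val P J hJ hPk hf,
    fun s => by rw [XP_symm, hsym], hMb, ?_, ?_⟩
  · have : XP P 0 = (1 / P.k) * (VV K (ClassGroup (𝓞 K)) : ℂ) := by
      simp [XP]; left; rfl
    rw [this]
    exact mul_ne_zero (one_div_ne_zero hk) (by exact_mod_cast hV)
  · have : XP P 1 = (1 / P.k) * (P.ε * (VV K (ClassGroup (𝓞 K)) : ℂ)) := by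
      simp [XP]; left; left; rfl
    rw [this]
    exact mul_ne_zero (one_div_ne_zero hk) (mul_ne_zero P.hε (by exact_mod_cast hV))

end

end

section
open Complex

section

lemma entire_order_ne_top {F : ℂ → ℂ} (hF : Differentiable ℂ F) {z0 : ℂ} (h0 : F z0 ≠ 0) (ρ : ℂ) :
    analyticOrderAt F ρ ≠ ⊤ := by
  intro h
  rw [analyticOrderAt_eq_top] at h
  have hA : AnalyticOnNhd ℂ F Set.univ := hF.differentiableOn.analyticOnNhd isOpen_univ
  exact h0 (hA.eqOn_zero_of_preconnected_of_eventuallyEq_zero isPreconnected_univ (Set.mem_univ ρ) h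
    (Set.mem_univ z0))

lemma entire_an {F : ℂ → ℂ} (hF : Differentiable ℂ F) (z : ℂ) : AnalyticAt ℂ F z := hF.analyticAt z

lemma order_zero_iff {F : ℂ → ℂ} (hF : Differentiable ℂ F) {z0 : ℂ} (h0 : F z0 ≠ 0) (ρ : ℂ) :
    analyticOrderNatAt F ρ = 0 ↔ F ρ ≠ 0 := by
  have h := entire_order_ne_top hF h0 ρ
  rw [← (entire_an hF ρ).analyticOrderAt_eq_zero]
  have := Nat.cast_analyticOrderNatAt h
  rw [← this]
  exact_mod_cast Iff.rfl

lemma had_divide {F : ℂ → ℂ} (hF : Differentiable ℂ F) (h0 : F 0 ≠ 0) {ρ : ℂ} (hρ : ρ ≠ 0) :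
    ∃ G : ℂ → ℂ, Differentiable ℂ G ∧ (∀ z, F z = (1 - z / ρ) ^ analyticOrderNatAt F ρ * G z) ∧
      G ρ ≠ 0 := by
  obtain ⟨g, hg, hg0, hgF⟩ := (entire_an hF ρ).analyticOrderAt_ne_top.1 (entire_order_ne_top hF h0 ρ)
  set n := analyticOrderNatAt F ρ
  have hfac : ∀ z, z ≠ ρ → (1 - z / ρ) ≠ 0 := by
    intro z hz h
    apply hz
    field_simp at h
    linear_combination -h
  have hpow : ∀ z : ℂ, (z - ρ) ^ n = (1 - z / ρ) ^ n * (-ρ) ^ n := by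
    intro z
    rw [← mul_pow]
    congr 1
    field_simp
    ring
  let G : ℂ → ℂ := fun z => if z = ρ then (-ρ) ^ n * g ρ else F z / (1 - z / ρ) ^ n
  have hGg : G =ᶠ[nhds ρ] fun z => (-ρ) ^ n * g z := by
    filter_upwards [hgF] with z hz
    by_cases h : z = ρ
    · simp [G, h]
    · simp only [G, h, if_false]
      rw [hz, smul_eq_mul, hpow, div_eq_iff (pow_ne_zero _ (hfac z h))]
      ring
  refine ⟨G, fun z => ?_, fun z => ?_, ?_⟩
  · by_cases h : z = ρ
    · subst h
      refine DifferentiableAt.congr_of_eventuallyEq ?_ hGg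
      exact hg.differentiableAt.const_mul _
    · have : G =ᶠ[nhds z] fun z => F z / (1 - z / ρ) ^ n := by
        filter_upwards [isOpen_ne.mem_nhds h] with y hy
        simp only [G, show y ≠ ρ from hy, if_false]
      refine DifferentiableAt.congr_of_eventuallyEq ?_ this
      exact (hF z).div (by fun_prop) (pow_ne_zero _ (hfac z h))
  · by_cases h : z = ρ
    · have h1 := hgF.self_of_nhds
      subst h
      beta_reduce at h1
      simp only [G, if_true]
      rw [h1, smul_eq_mul, hpow]
      ring
    · simp only [G, h, if_false]
      rw [mul_div_cancel₀ _ (pow_ne_zero _ (hfac z h))]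
  · simp only [G, if_true]
    exact mul_ne_zero (pow_ne_zero _ (neg_ne_zero.2 hρ)) hg0

lemma had_factor {f : ℂ → ℂ} (hf : Differentiable ℂ f) (h0 : f 0 = 1) (S : Finset ℂ) (hS : (0:ℂ) ∉ S) :
    ∃ G : ℂ → ℂ, Differentiable ℂ G ∧
      (∀ z, f z = (∏ ρ ∈ S, (1 - z / ρ) ^ analyticOrderNatAt f ρ) * G z) ∧
      ∀ ρ ∈ S, G ρ ≠ 0 := by
  classical
  induction S using Finset.induction_on with
  | empty => exact ⟨f, hf, by simp, by simp⟩
  | insert a S ha ih =>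
    simp only [Finset.mem_insert, not_or] at hS
    obtain ⟨G, hG, hfG, hGS⟩ := ih hS.2
    have ha0 : a ≠ 0 := fun h => hS.1 h.symm
    have hG0 : G 0 ≠ 0 := by
      have := hfG 0
      rw [h0] at this
      intro h
      rw [h] at this
      simp at this
    set Q : ℂ → ℂ := fun z => ∏ ρ ∈ S, (1 - z / ρ) ^ analyticOrderNatAt f ρ with hQ
    have hQd : Differentiable ℂ Q := by
      rw [hQ]; fun_prop
    have hQa : Q a ≠ 0 := by
      refine Finset.prod_ne_zero_iff.2 fun ρ hρ => pow_ne_zero _ ?_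
      intro h
      have hρ0 : ρ ≠ 0 := fun h => hS.2 (h ▸ hρ)
      field_simp at h
      exact ha ((show a = ρ by linear_combination -h) ▸ hρ)
    have hfe : f = Q * G := funext hfG
    have hord : analyticOrderNatAt f a = analyticOrderNatAt G a := by
      have h1 := analyticOrderAt_mul (entire_an hQd a) (entire_an hG a)
      rw [(entire_an hQd a).analyticOrderAt_eq_zero.2 hQa, zero_add, ← hfe] at h1
      unfold analyticOrderNatAt
      rw [h1]
    obtain ⟨G', hG', hGG', hG'a⟩ := had_divide hG hG0 ha0
    refine ⟨G', hG', fun z => ?_, ?_⟩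
    · rw [Finset.prod_insert ha, hfG, hGG', hord]
      ring
    · intro ρ hρ
      rcases Finset.mem_insert.1 hρ with rfl | hρ
      · exact hG'a
      · intro h
        have := hGS ρ hρ
        rw [hGG', h, mul_zero] at this
        exact this rfl

lemma zeros_fin {f : ℂ → ℂ} (hf : Differentiable ℂ f) (h0 : f 0 = 1) (R : ℝ) :
    {z : ℂ | f z = 0 ∧ ‖z‖ ≤ R}.Finite := by
  by_contra h
  obtain ⟨x, _, hx⟩ := Set.Infinite.exists_accPt_of_subset_isCompact h
    (isCompact_closedBall (0:ℂ) R) (fun z hz => by simpa using hz.2)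
  have hA : AnalyticOnNhd ℂ f Set.univ := hf.differentiableOn.analyticOnNhd isOpen_univ
  have := hA.eqOn_zero_of_preconnected_of_frequently_eq_zero isPreconnected_univ (Set.mem_univ x) (by
    rw [accPt_iff_frequently_nhdsNE] at hx
    exact hx.mono fun z hz => hz.1) (Set.mem_univ 0)
  rw [h0] at this
  exact one_ne_zero this

/-- zero-free function with bounded modulus: control of log derivative -/
lemma had_zero_free {G : ℂ → ℂ} (hG : Differentiable ℂ G) (h0 : G 0 = 1) {R B : ℝ} (hR : 0 < R)
    (hB : 0 < B) (hnz : ∀ z, ‖z‖ ≤ R → G z ≠ 0) (hb : ∀ z, ‖z‖ ≤ R → ‖G z‖ ≤ Real.exp B) :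
    ∀ z, ‖z‖ ≤ R / 4 → ‖deriv (logDeriv G) z‖ ≤ 2 * (2 * B) / (R / 4) ^ 2 := by
  have hLd : DifferentiableOn ℂ (logDeriv G) (Metric.ball 0 R) := by
    intro z hz
    have hz' : ‖z‖ ≤ R := by simpa using (Metric.mem_ball.1 hz).le
    have h1 : DifferentiableAt ℂ (deriv G) z := (entire_an hG z).deriv.differentiableAt
    exact (h1.div (hG z) (hnz z hz')).differentiableWithinAt
  obtain ⟨g, hg0, hg⟩ := hLd.isExactOn_ball.with_val_at 0 0
  have hgd : DifferentiableOn ℂ g (Metric.ball 0 R) := fun z hz =>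
    (hg z hz).differentiableAt.differentiableWithinAt
  have hexp : ∀ z ∈ Metric.ball (0:ℂ) R, G z = Complex.exp (g z) := by
    have hc : ∀ z ∈ Metric.ball (0:ℂ) R, HasDerivAt (fun z => G z * Complex.exp (-g z)) 0 z := by
      intro z hz
      have hz' : ‖z‖ ≤ R := by simpa using (Metric.mem_ball.1 hz).le
      have := (hG z).hasDerivAt.mul ((hg z hz).neg.cexp)
      refine HasDerivAt.congr_deriv this ?_
      rw [logDeriv_apply, Pi.neg_apply]
      have := hnz z hz'
      field_simp
      ring
    intro z hz
    have h1 := (convex_ball (0:ℂ) R).is_const_of_fderivWithin_eq_zero (𝕜 := ℂ)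
      (f := fun z => G z * Complex.exp (-g z))
      (fun z hz => (hc z hz).differentiableAt.differentiableWithinAt)
      (fun z hz => by
        rw [fderivWithin_of_isOpen Metric.isOpen_ball hz]
        have := (hc z hz).hasFDerivAt.fderiv
        rw [this]; ext; simp) hz (Metric.mem_ball_self hR)
    simp only [h0, hg0, neg_zero, Complex.exp_zero, mul_one] at h1
    rw [Complex.exp_neg] at h1
    field_simp at h1
    exact h1
  have hre : Set.MapsTo g (Metric.ball 0 R) {z | z.re ≤ B} := by
    intro z hz
    have hz' : ‖z‖ ≤ R := by simpa using (Metric.mem_ball.1 hz).le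
    have := hb z hz'
    rw [hexp z hz, Complex.norm_exp] at this
    exact Real.exp_le_exp.1 this
  have hbc : ∀ z, ‖z‖ ≤ R / 2 → ‖g z‖ ≤ 2 * B := by
    intro z hz
    have hzb : z ∈ Metric.ball (0:ℂ) R := by rw [mem_ball_zero_iff]; linarith
    refine (borelCaratheodory_zero hB hgd hre hR hzb hg0).trans ?_
    rw [div_le_iff₀ (by linarith)]
    nlinarith
  intro z hz
  have hderiv : deriv (logDeriv G) z = iteratedDeriv 2 g z := by
    rw [iteratedDeriv_succ, iteratedDeriv_one]
    refine Filter.EventuallyEq.deriv_eq ?_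
    have : Metric.ball (0:ℂ) R ∈ nhds z := Metric.isOpen_ball.mem_nhds (by rw [mem_ball_zero_iff]; linarith)
    filter_upwards [this] with y hy
    exact (hg y hy).deriv.symm
  rw [hderiv]
  have := norm_iteratedDeriv_le_of_forall_mem_sphere_norm_le (c := z) (f := g) (C := 2 * B) 2
    (show (0:ℝ) < R / 4 by linarith) ?_ ?_
  · simpa using this
  · refine DifferentiableOn.diffContOnCl (hgd.mono ?_)
    rw [closure_ball _ (by linarith)]
    intro y hy
    rw [mem_ball_zero_iff]
    have h1 : ‖y - z‖ ≤ R / 4 := by simpa [dist_eq_norm] using hy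
    have := norm_add_le (y - z) z
    rw [sub_add_cancel] at this
    linarith
  · intro y hy
    apply hbc
    have h1 : ‖y - z‖ = R / 4 := by simpa [dist_eq_norm] using hy
    have := norm_add_le (y - z) z
    rw [sub_add_cancel] at this
    linarith

end

end

section
open Complex

section

lemma had_step {f : ℂ → ℂ} (hf : Differentiable ℂ f) (h0 : f 0 = 1) {R B : ℝ} (hR : 0 < R)
    (hB : 0 < B) (hb : ∀ z, ‖z‖ ≤ 3 * R → ‖f z‖ ≤ Real.exp B) :
    ∃ S : Finset ℂ, (∀ ρ, ρ ∈ S ↔ f ρ = 0 ∧ ‖ρ‖ ≤ R) ∧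
      (∑ ρ ∈ S, (analyticOrderNatAt f ρ : ℝ)) * Real.log 2 ≤ B ∧
      ∀ z, ‖z‖ ≤ R / 4 → f z ≠ 0 →
        ‖logDeriv f z - logDeriv f 0 - z * deriv (logDeriv f) 0 -
          z ^ 2 * ∑ ρ ∈ S, (analyticOrderNatAt f ρ : ℂ) / (ρ ^ 2 * (z - ρ))‖ ≤
        2 * ‖z‖ * (2 * (2 * B) / (R / 4) ^ 2) := by
  set S := (zeros_fin hf h0 R).toFinset with hSdef
  have hS : ∀ ρ, ρ ∈ S ↔ f ρ = 0 ∧ ‖ρ‖ ≤ R := fun ρ => by simp [hSdef]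
  have hS0 : (0:ℂ) ∉ S := by rw [hS, h0]; simp
  have hρ0 : ∀ ρ ∈ S, ρ ≠ 0 := fun ρ hρ h => hS0 (h ▸ hρ)
  obtain ⟨G, hG, hfG, hGS⟩ := had_factor hf h0 S hS0
  set m := analyticOrderNatAt f
  have hG0 : G 0 = 1 := by
    have := hfG 0
    simp [h0] at this
    exact this.symm
  have hGn : ∀ z, f z ≠ 0 → G z ≠ 0 := by
    intro z hz h
    apply hz
    rw [hfG, h, mul_zero]
  have hGnz : ∀ z, ‖z‖ ≤ R → G z ≠ 0 := by
    intro z hz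
    by_cases h : f z = 0
    · exact hGS z ((hS z).2 ⟨h, hz⟩)
    · exact hGn z h
  -- bound on the big circle
  have hbig : ∀ z : ℂ, ‖z‖ = 3 * R → ‖G z‖ * 2 ^ (∑ ρ ∈ S, m ρ) ≤ Real.exp B := by
    intro z hz
    have h1 := hb z hz.le
    rw [hfG, norm_mul, norm_prod, mul_comm] at h1
    refine le_trans ?_ h1
    refine mul_le_mul_of_nonneg_left ?_ (norm_nonneg _)
    rw [← Finset.prod_pow_eq_pow_sum]
    refine Finset.prod_le_prod (fun ρ _ => by positivity) fun ρ hρ => ?_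
    rw [norm_pow]
    refine pow_le_pow_left₀ (by norm_num) ?_ _
    have h2 : ‖z / ρ‖ - ‖(1:ℂ)‖ ≤ ‖z / ρ - 1‖ := norm_sub_norm_le _ _
    rw [norm_sub_rev, norm_div, hz, norm_one] at h2
    have h3 : 0 < ‖ρ‖ := norm_pos_iff.2 (hρ0 ρ hρ)
    have h4 : 3 ≤ 3 * R / ‖ρ‖ := by
      rw [le_div_iff₀ h3]
      have := ((hS ρ).1 hρ).2
      linarith
    linarith
  have h2n : (0:ℝ) < 2 ^ (∑ ρ ∈ S, m ρ) := by positivity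
  have hmax : ∀ z : ℂ, ‖z‖ ≤ 3 * R → ‖G z‖ ≤ Real.exp B / 2 ^ (∑ ρ ∈ S, m ρ) := by
    intro z hz
    refine norm_le_of_forall_mem_frontier_norm_le (U := Metric.ball (0:ℂ) (3 * R)) Metric.isBounded_ball
      hG.diffContOnCl (fun y hy => ?_) ?_
    · rw [frontier_ball _ (by linarith)] at hy
      rw [le_div_iff₀ h2n]
      exact hbig y (by simpa using hy)
    · rw [closure_ball _ (by linarith)]
      simpa using hz
  have hcount : (∑ ρ ∈ S, (m ρ : ℝ)) * Real.log 2 ≤ B := by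
    have := hmax 0 (by simp; linarith)
    rw [hG0, norm_one, le_div_iff₀ h2n, one_mul] at this
    have h3 := Real.log_le_log h2n this
    rw [Real.log_exp, Real.log_pow] at h3
    exact_mod_cast h3
  refine ⟨S, hS, hcount, ?_⟩
  have hGb : ∀ z, ‖z‖ ≤ R → ‖G z‖ ≤ Real.exp B := fun z hz =>
    (hmax z (by linarith)).trans (div_le_self (Real.exp_pos _).le (one_le_pow₀ (by norm_num)))
  have hfree := had_zero_free hG hG0 hR hB hGnz hGb
  have hne : ∀ y, f y ≠ 0 → ∀ ρ ∈ S, y - ρ ≠ 0 := by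
    intro y hy ρ hρ h
    apply hy
    rw [sub_eq_zero.1 h]
    exact ((hS ρ).1 hρ).1
  have hlog : ∀ y, f y ≠ 0 → logDeriv f y = ∑ ρ ∈ S, (m ρ : ℂ) * (y - ρ)⁻¹ + logDeriv G y := by
    intro y hy
    have h1 : ∀ ρ ∈ S, (1 - y / ρ) ≠ 0 := by
      intro ρ hρ h
      have := hρ0 ρ hρ
      apply hne y hy ρ hρ
      field_simp at h
      linear_combination -h
    have h2 : f = fun y => (∏ ρ ∈ S, (1 - y / ρ) ^ m ρ) * G y := funext hfG
    rw [h2, logDeriv_mul (f := fun y => ∏ ρ ∈ S, (1 - y / ρ) ^ m ρ) (g := G) y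
      (Finset.prod_ne_zero_iff.2 fun ρ hρ => pow_ne_zero _ (h1 ρ hρ)) (hGn y hy) (by fun_prop) (hG y)]
    rw [logDeriv_prod (f := fun ρ y => (1 - y / ρ) ^ m ρ) (fun ρ hρ => pow_ne_zero _ (h1 ρ hρ))
      (fun ρ hρ => by fun_prop)]
    congr 1
    refine Finset.sum_congr rfl fun ρ hρ => ?_
    rw [logDeriv_fun_pow (f := fun y => 1 - y / ρ) (by fun_prop)]
    congr 1
    have hd : HasDerivAt (fun y => 1 - y / ρ) (-(1 / ρ)) y := by
      simpa using ((hasDerivAt_id y).div_const ρ).const_sub 1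
    rw [logDeriv_apply, hd.deriv]
    have := hρ0 ρ hρ
    have h3 := h1 ρ hρ
    have h4 := hne y hy ρ hρ
    rw [div_eq_iff h3, inv_mul_eq_div, eq_div_iff h4]
    field_simp
    ring
  have hGdiff : ∀ y, ‖y‖ ≤ R → DifferentiableAt ℂ (logDeriv G) y := fun y hy =>
    ((entire_an hG y).deriv.differentiableAt).div (hG y) (hGnz y hy)
  have hder : deriv (logDeriv f) 0 = -∑ ρ ∈ S, (m ρ : ℂ) / ρ ^ 2 + deriv (logDeriv G) 0 := by
    have hev : ∀ᶠ y in nhds (0:ℂ), f y ≠ 0 :=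
      hf.continuous.continuousAt.eventually_ne (by rw [h0]; exact one_ne_zero)
    have he : logDeriv f =ᶠ[nhds 0] fun y => ∑ ρ ∈ S, (m ρ : ℂ) * (y - ρ)⁻¹ + logDeriv G y := by
      filter_upwards [hev] with y hy using hlog y hy
    rw [he.deriv_eq]
    have h1 : HasDerivAt (fun y => ∑ ρ ∈ S, (m ρ : ℂ) * (y - ρ)⁻¹)
        (∑ ρ ∈ S, (m ρ : ℂ) * (-1 / (0 - ρ) ^ 2)) 0 := by
      refine HasDerivAt.fun_sum fun ρ hρ => ?_
      refine HasDerivAt.const_mul _ ?_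
      have : HasDerivAt (fun y => y - ρ) 1 0 := (hasDerivAt_id (0:ℂ)).sub_const ρ
      exact this.inv (by simpa using hρ0 ρ hρ)
    have h2 := (hGdiff 0 (by simpa using hR.le)).hasDerivAt
    rw [(h1.fun_add h2).deriv, ← Finset.sum_neg_distrib]
    congr 1
    refine Finset.sum_congr rfl fun ρ hρ => ?_
    rw [zero_sub, neg_sq]
    ring
  intro z hz hfz
  have e : logDeriv f z - logDeriv f 0 - z * deriv (logDeriv f) 0 -
          z ^ 2 * ∑ ρ ∈ S, (m ρ : ℂ) / (ρ ^ 2 * (z - ρ)) =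
      (logDeriv G z - logDeriv G 0) - z * deriv (logDeriv G) 0 := by
    rw [hlog z hfz, hlog 0 (by rw [h0]; exact one_ne_zero), hder]
    have : ∑ ρ ∈ S, (m ρ : ℂ) * (z - ρ)⁻¹ - ∑ ρ ∈ S, (m ρ : ℂ) * (0 - ρ)⁻¹ +
        z * ∑ ρ ∈ S, (m ρ : ℂ) / ρ ^ 2 - z ^ 2 * ∑ ρ ∈ S, (m ρ : ℂ) / (ρ ^ 2 * (z - ρ)) = 0 := by
      rw [Finset.mul_sum, Finset.mul_sum, ← Finset.sum_sub_distrib, ← Finset.sum_add_distrib,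
        ← Finset.sum_sub_distrib]
      refine Finset.sum_eq_zero fun ρ hρ => ?_
      have h1 := hρ0 ρ hρ
      have h2 := hne z hfz ρ hρ
      rw [zero_sub]
      field_simp
      ring
    linear_combination this
  rw [e]
  set D := 2 * (2 * B) / (R / 4) ^ 2
  have h1 : ‖logDeriv G z - logDeriv G 0‖ ≤ D * ‖z - 0‖ := by
    refine Convex.norm_image_sub_le_of_norm_deriv_le (s := Metric.closedBall (0:ℂ) (R / 4)) ?_ ?_
      (convex_closedBall _ _) (by simp; linarith) (by simpa using hz)
    · intro y hy
      exact hGdiff y (by have : ‖y‖ ≤ R / 4 := by simpa using hy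
                         linarith)
    · intro y hy
      exact hfree y (by simpa using hy)
  have h2 : ‖z * deriv (logDeriv G) 0‖ ≤ ‖z‖ * D := by
    rw [norm_mul]
    exact mul_le_mul_of_nonneg_left (hfree 0 (by simp; linarith)) (norm_nonneg _)
  rw [sub_zero] at h1
  refine (norm_sub_le _ _).trans ?_
  linarith

lemma had_sum {f : ℂ → ℂ} (hf : Differentiable ℂ f) (h0 : f 0 = 1) {M : ℝ} (hM : 0 < M)
    (hb : ∀ (R : ℝ) (z : ℂ), 1 ≤ R → ‖z‖ ≤ R → ‖f z‖ ≤ Real.exp (M * R ^ (3/2 : ℝ))) :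
    Summable (fun ρ : ℂ => (analyticOrderNatAt f ρ : ℝ) / ‖ρ‖ ^ 2) := by
  classical
  set m := analyticOrderNatAt f with hm
  have hmz : ∀ ρ, m ρ ≠ 0 → f ρ = 0 := by
    intro ρ h
    by_contra h2
    exact h ((order_zero_iff hf (z0 := 0) (by rw [h0]; exact one_ne_zero) ρ).2 h2)
  -- zeros stay away from 0
  obtain ⟨δ, hδ, hδ1, hδz⟩ : ∃ δ : ℝ, 0 < δ ∧ δ ≤ 1 ∧ ∀ ρ, m ρ ≠ 0 → δ ≤ ‖ρ‖ := by
    have hev : ∀ᶠ y in nhds (0:ℂ), f y ≠ 0 :=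
      hf.continuous.continuousAt.eventually_ne (by rw [h0]; exact one_ne_zero)
    obtain ⟨δ, hδ, h⟩ := Metric.eventually_nhds_iff.1 hev
    refine ⟨min δ 1, by positivity, min_le_right _ _, fun ρ hρ => ?_⟩
    by_contra hlt
    push Not at hlt
    exact h (by simpa using lt_of_lt_of_le hlt (min_le_left _ _)) (hmz ρ hρ)
  set C : ℝ := M * 3 ^ (3/2:ℝ) / Real.log 2 with hC
  have hl2 : 0 < Real.log 2 := Real.log_pos (by norm_num)
  have hcount : ∀ (j : ℕ) (T : Finset ℂ), ∑ ρ ∈ T, (if ‖ρ‖ ≤ 2 ^ j then (m ρ : ℝ) else 0) ≤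
      C * ((2:ℝ) ^ j) ^ (3/2:ℝ) := by
    intro j T
    have h2j : (1:ℝ) ≤ 2 ^ j := one_le_pow₀ (by norm_num)
    obtain ⟨S, hS, hS2, -⟩ := had_step hf h0 (R := 2 ^ j) (B := M * (3 * 2 ^ j) ^ (3/2:ℝ)) (by positivity)
      (by positivity) (fun z hz => hb _ z (by linarith) hz)
    have h1 : ∑ ρ ∈ T, (if ‖ρ‖ ≤ 2 ^ j then (m ρ : ℝ) else 0) ≤ ∑ ρ ∈ S, (m ρ : ℝ) := by
      rw [← Finset.sum_filter]
      rw [← Finset.sum_filter_ne_zero]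
      refine Finset.sum_le_sum_of_subset_of_nonneg (fun ρ hρ => ?_) (fun _ _ _ => by positivity)
      obtain ⟨hρ1, hne⟩ := Finset.mem_filter.1 hρ
      rw [hS]
      exact ⟨hmz ρ (by exact_mod_cast hne), (Finset.mem_filter.1 hρ1).2⟩
    refine h1.trans ?_
    rw [← le_div_iff₀ hl2] at hS2
    refine hS2.trans (le_of_eq ?_)
    rw [Real.mul_rpow (by norm_num) (by positivity), hC]
    ring
  set a : ℕ → ℝ := fun j => (1/4:ℝ) ^ j with ha
  have hsq : Summable (fun j : ℕ => C * (((2:ℝ) ^ j) ^ (3/2:ℝ) * (1/4:ℝ) ^ j)) := by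
    refine Summable.mul_left _ ?_
    have : ∀ j : ℕ, ((2:ℝ) ^ j) ^ (3/2:ℝ) * (1/4:ℝ) ^ j = ((2:ℝ) ^ (-(1/2):ℝ)) ^ j := by
      intro j
      rw [← Real.rpow_natCast, ← Real.rpow_natCast, ← Real.rpow_natCast, ← Real.rpow_mul (by norm_num),
        ← Real.rpow_mul (by norm_num), show (1/4:ℝ) = 2 ^ (-2:ℝ) by
          rw [Real.rpow_neg (by norm_num)]; norm_num, ← Real.rpow_mul (by norm_num),
        ← Real.rpow_add (by norm_num)]
      congr 1; ring
    simp only [this]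
    exact summable_geometric_of_lt_one (by positivity)
      (Real.rpow_lt_one_of_one_lt_of_neg (by norm_num) (by norm_num))
  have hgeo : Summable a := summable_geometric_of_lt_one (by norm_num) (by norm_num)
  set Kc : ℝ := 4 / δ ^ 2 with hKc
  have hpt : ∀ ρ, (m ρ : ℝ) / ‖ρ‖ ^ 2 ≤ Kc * ∑' j : ℕ, (if ‖ρ‖ ≤ 2 ^ j then (m ρ : ℝ) else 0) * a j := by
    intro ρ
    by_cases hρ : m ρ = 0
    · simp [hρ]
    have hρδ := hδz ρ hρ
    have hρ0 : 0 < ‖ρ‖ := by linarith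
    have hsm : Summable (fun j : ℕ => (if ‖ρ‖ ≤ 2 ^ j then (m ρ : ℝ) else 0) * a j) := by
      refine Summable.of_nonneg_of_le (fun j => ?_) (fun j => ?_) (hgeo.mul_left (m ρ : ℝ))
      · split_ifs <;> positivity
      · refine mul_le_mul_of_nonneg_right ?_ (by positivity)
        split_ifs
        · exact le_rfl
        · positivity
    obtain ⟨j, hj1, hj2⟩ : ∃ j : ℕ, ‖ρ‖ ≤ 2 ^ j ∧ (2:ℝ) ^ j * δ ≤ 2 * ‖ρ‖ := by
      have hex : ∃ j : ℕ, ‖ρ‖ ≤ 2 ^ j := (pow_unbounded_of_one_lt ‖ρ‖ (by norm_num : (1:ℝ) < 2)).imp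
        fun _ h => h.le
      refine ⟨Nat.find hex, Nat.find_spec hex, ?_⟩
      rcases Nat.eq_zero_or_pos (Nat.find hex) with h | h
      · rw [h]; simp; linarith
      · obtain ⟨i, hi⟩ : ∃ i, Nat.find hex = i + 1 := ⟨Nat.find hex - 1, by omega⟩
        have := Nat.find_min hex (m := i) (by omega)
        rw [hi, pow_succ]
        push Not at this
        nlinarith [pow_pos (show (0:ℝ) < 2 by norm_num) i]
    have h1 : (m ρ : ℝ) * a j ≤ ∑' j : ℕ, (if ‖ρ‖ ≤ 2 ^ j then (m ρ : ℝ) else 0) * a j := by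
      have := hsm.le_tsum j (fun i _ => by split_ifs <;> positivity)
      simpa [hj1] using this
    refine le_trans ?_ (mul_le_mul_of_nonneg_left h1 (by positivity))
    have h4 : a j * (2 ^ j) ^ 2 = 1 := by
      rw [ha]; simp only
      rw [← pow_mul, mul_comm j 2, pow_mul, ← mul_pow]; norm_num
    have h5 : ((2:ℝ) ^ j * δ) ^ 2 ≤ (2 * ‖ρ‖) ^ 2 := pow_le_pow_left₀ (by positivity) hj2 2
    have ha0 : 0 < a j := by positivity
    rw [hKc, div_le_iff₀ (by positivity), div_mul_eq_mul_div, div_mul_eq_mul_div, le_div_iff₀ (by positivity)]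
    have : δ ^ 2 ≤ 4 * a j * ‖ρ‖ ^ 2 := by
      have := mul_le_mul_of_nonneg_left h5 ha0.le
      calc δ ^ 2 = a j * (2 ^ j) ^ 2 * δ ^ 2 := by rw [h4, one_mul]
        _ = a j * ((2:ℝ) ^ j * δ) ^ 2 := by ring
        _ ≤ _ := this
        _ = _ := by ring
    have hmp : (0:ℝ) ≤ m ρ := by positivity
    nlinarith
  refine summable_of_sum_le (c := Kc * ∑' j : ℕ, C * (((2:ℝ) ^ j) ^ (3/2:ℝ) * (1/4:ℝ) ^ j))
    (fun ρ => by positivity) fun T => ?_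
  calc ∑ ρ ∈ T, (m ρ : ℝ) / ‖ρ‖ ^ 2
      ≤ ∑ ρ ∈ T, Kc * ∑' j : ℕ, (if ‖ρ‖ ≤ 2 ^ j then (m ρ : ℝ) else 0) * a j :=
        Finset.sum_le_sum fun ρ _ => hpt ρ
    _ = Kc * ∑' j : ℕ, ∑ ρ ∈ T, (if ‖ρ‖ ≤ 2 ^ j then (m ρ : ℝ) else 0) * a j := by
        rw [← Finset.mul_sum, Summable.tsum_finsetSum]
        intro ρ _
        refine Summable.of_nonneg_of_le (fun j => ?_) (fun j => ?_) (hgeo.mul_left (m ρ : ℝ))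
        · split_ifs <;> positivity
        · refine mul_le_mul_of_nonneg_right ?_ (by positivity)
          split_ifs
          · exact le_rfl
          · positivity
    _ ≤ _ := by
        refine mul_le_mul_of_nonneg_left ?_ (by positivity)
        have hle : ∀ j : ℕ, ∑ ρ ∈ T, (if ‖ρ‖ ≤ 2 ^ j then (m ρ : ℝ) else 0) * a j ≤
            C * (((2:ℝ) ^ j) ^ (3/2:ℝ) * (1/4:ℝ) ^ j) := by
          intro j
          rw [← Finset.sum_mul, ← mul_assoc]
          exact mul_le_mul_of_nonneg_right (hcount j T) (by positivity)
        refine Summable.tsum_le_tsum hle (Summable.of_nonneg_of_le (fun j => ?_) hle hsq) hsq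
        refine Finset.sum_nonneg fun ρ _ => ?_
        split_ifs <;> positivity

theorem had_main {f : ℂ → ℂ} (hf : Differentiable ℂ f) (h0 : f 0 = 1) {M : ℝ} (hM : 0 < M)
    (hb : ∀ (R : ℝ) (z : ℂ), 1 ≤ R → ‖z‖ ≤ R → ‖f z‖ ≤ Real.exp (M * R ^ (3/2 : ℝ)))
    (z : ℂ) (hz : f z ≠ 0) :
    logDeriv f z = logDeriv f 0 + z * deriv (logDeriv f) 0 +
      z ^ 2 * ∑' ρ : ℂ, (analyticOrderNatAt f ρ : ℂ) / (ρ ^ 2 * (z - ρ)) := by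
  classical
  have hsum := had_sum hf h0 hM hb
  set m := analyticOrderNatAt f with hm
  have hmz : ∀ ρ, m ρ ≠ 0 → f ρ = 0 := by
    intro ρ h
    by_contra h2
    exact h ((order_zero_iff hf (z0 := 0) (by rw [h0]; exact one_ne_zero) ρ).2 h2)
  obtain ⟨δ, hδ, hδz⟩ : ∃ δ : ℝ, 0 < δ ∧ ∀ ρ, m ρ ≠ 0 → δ ≤ ‖z - ρ‖ := by
    have hev : ∀ᶠ y in nhds z, f y ≠ 0 := hf.continuous.continuousAt.eventually_ne hz
    obtain ⟨δ, hδ, h⟩ := Metric.eventually_nhds_iff.1 hev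
    refine ⟨δ, hδ, fun ρ hρ => ?_⟩
    by_contra hlt
    push Not at hlt
    exact h (by rwa [dist_comm, dist_eq_norm]) (hmz ρ hρ)
  set T : ℂ → ℂ := fun ρ => (m ρ : ℂ) / (ρ ^ 2 * (z - ρ)) with hT
  have hTb : ∀ ρ, ‖T ρ‖ ≤ (m ρ : ℝ) / ‖ρ‖ ^ 2 * δ⁻¹ := by
    intro ρ
    by_cases hρ : m ρ = 0
    · simp [hT, hρ]
    · rw [hT]
      simp only [norm_div, norm_mul, norm_pow, Complex.norm_natCast]
      rw [← div_div, div_eq_mul_inv (_ / _)]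
      gcongr
      exact hδz ρ hρ
  choose S hS _ hS3 using fun n : ℕ => had_step hf h0 (R := n + 1) (B := M * (3 * (n + 1)) ^ (3/2:ℝ))
    (by positivity) (by positivity) (fun z hz => hb _ z (by linarith) hz)
  have hlim1 : Filter.Tendsto (fun n : ℕ => ∑ ρ ∈ S n, T ρ) Filter.atTop (nhds (∑' ρ, T ρ)) := by
    have e : ∀ n, ∑ ρ ∈ S n, T ρ = ∑' ρ, if ρ ∈ S n then T ρ else 0 := by
      intro n
      rw [tsum_eq_sum (s := S n)]
      · exact Finset.sum_congr rfl fun ρ hρ => by simp [hρ]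
      · intro ρ hρ; simp [hρ]
    simp only [e]
    refine tendsto_tsum_of_dominated_convergence (hsum.mul_right δ⁻¹) ?_ ?_
    · intro ρ
      by_cases hρ : m ρ = 0
      · simp [hT, hρ]
      · refine tendsto_const_nhds.congr' ?_
        filter_upwards [Filter.eventually_ge_atTop ⌈‖ρ‖⌉₊] with n hn
        have : ρ ∈ S n := by
          rw [hS]
          refine ⟨hmz ρ hρ, ?_⟩
          have := Nat.ceil_le.1 hn
          linarith
        simp [this]
    · refine Filter.Eventually.of_forall fun n ρ => ?_
      split_ifs
      · exact hTb ρ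
      · simp; positivity
  have hlim2 : Filter.Tendsto (fun n : ℕ => 2 * ‖z‖ * (2 * (2 * (M * (3 * ((n:ℝ) + 1)) ^ (3/2:ℝ))) /
      (((n:ℝ) + 1) / 4) ^ 2)) Filter.atTop (nhds 0) := by
    have h1 : Filter.Tendsto (fun n : ℕ => ((n:ℝ) + 1) ^ (-(1/2):ℝ)) Filter.atTop (nhds 0) :=
      (tendsto_rpow_neg_atTop (by norm_num)).comp
        (Filter.tendsto_atTop_add_const_right _ _ tendsto_natCast_atTop_atTop)
    have h2 := h1.const_mul (2 * ‖z‖ * (2 * (2 * (M * 3 ^ (3/2:ℝ))) * 16))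
    rw [mul_zero] at h2
    refine h2.congr fun n => ?_
    have hn : (0:ℝ) < (n:ℝ) + 1 := by positivity
    rw [Real.mul_rpow (by norm_num) hn.le, show (-(1/2):ℝ) = 3/2 - (2:ℕ) by norm_num,
      Real.rpow_sub hn, Real.rpow_natCast]
    field_simp
    norm_num
  have hlim3 : Filter.Tendsto (fun n : ℕ => logDeriv f z - logDeriv f 0 - z * deriv (logDeriv f) 0 -
      z ^ 2 * ∑ ρ ∈ S n, T ρ) Filter.atTop (nhds 0) := by
    refine squeeze_zero_norm' ?_ hlim2
    filter_upwards [Filter.eventually_ge_atTop ⌈4 * ‖z‖⌉₊] with n hn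
    have := Nat.ceil_le.1 hn
    exact hS3 n z (by linarith) hz
  have hlim4 := (tendsto_const_nhds (x := logDeriv f z - logDeriv f 0 - z * deriv (logDeriv f) 0)).sub
    (hlim1.const_mul (z ^ 2))
  have := tendsto_nhds_unique hlim3 hlim4
  linear_combination -this

end

end

section
open NumberField IsDedekindDomain ArithmeticFunction
section
variable {K : Type*} [Field K] [NumberField K]
open scoped Classical

/-- index set of prime powers -/
abbrev PK (K : Type*) [Field K] [NumberField K] := HeightOneSpectrum (𝓞 K) × ℕ

/-- norm of the prime power -/
noncomputable def pn (q : PK K) : ℕ := Ideal.absNorm (q.1.asIdeal ^ (q.2 + 1))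

/-- log norm of the prime -/
noncomputable def pl (q : PK K) : ℝ := Real.log (Ideal.absNorm q.1.asIdeal)

lemma prime_norm (P : HeightOneSpectrum (𝓞 K)) : ∃ p f : ℕ, p.Prime ∧ f ≠ 0 ∧
    Ideal.absNorm P.asIdeal = p ^ f ∧ (p : 𝓞 K) ∈ P.asIdeal := by
  haveI := P.isPrime
  haveI : NeZero P.asIdeal := ⟨P.ne_bot⟩
  have hp := Nat.absNorm_under_prime P.asIdeal
  set p := Ideal.absNorm (Ideal.under ℤ P.asIdeal) with hpdef
  have hspan : Ideal.span {(p:ℤ)} = Ideal.under ℤ P.asIdeal := Int.ideal_span_absNorm_eq_self _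
  haveI : P.asIdeal.LiesOver (Ideal.span {(p:ℤ)}) := ⟨hspan⟩
  have hN := Ideal.absNorm_eq_pow_inertiaDeg' P.asIdeal hp
  refine ⟨p, _, hp, ?_, hN, ?_⟩
  · intro h0
    rw [h0, pow_zero, Ideal.absNorm_eq_one_iff] at hN
    exact P.isPrime.ne_top hN
  · have : (p:ℤ) ∈ Ideal.under ℤ P.asIdeal := by
      rw [← hspan]; exact Ideal.mem_span_singleton_self _
    simpa using this

lemma norm_ge_two (P : HeightOneSpectrum (𝓞 K)) : 2 ≤ Ideal.absNorm P.asIdeal := by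
  obtain ⟨p, f, hp, hf, hN, -⟩ := prime_norm P
  rw [hN]
  exact hp.two_le.trans (Nat.le_self_pow hf p)

lemma pn_eq (q : PK K) : pn q = Ideal.absNorm q.1.asIdeal ^ (q.2 + 1) := by
  rw [pn, map_pow]

lemma pn_ge_two (q : PK K) : 2 ≤ pn q := by
  rw [pn_eq]
  exact (norm_ge_two q.1).trans (Nat.le_self_pow (by omega) _)

lemma pl_pos (q : PK K) : 0 < pl q :=
  Real.log_pos (by exact_mod_cast (norm_ge_two q.1))

lemma pl_le (n : ℕ) (T : Finset (PK K)) (hT : ∀ q ∈ T, pn q = n) :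
    ∑ q ∈ T, pl q ≤ Module.finrank ℚ K * vonMangoldt n := by
  rcases T.eq_empty_or_nonempty with rfl | ⟨q0, hq0⟩
  · simp only [Finset.sum_empty]
    exact mul_nonneg (Nat.cast_nonneg _) vonMangoldt_nonneg
  obtain ⟨p, f, hp, hf, hN, hmem⟩ := prime_norm q0.1
  have hn : n = p ^ (f * (q0.2 + 1)) := by
    rw [← hT q0 hq0, pn_eq, hN, pow_mul]
  have hΛ : vonMangoldt n = Real.log p := by
    rw [hn, vonMangoldt_apply_pow (by positivity), vonMangoldt_apply_prime hp]
  have hall : ∀ q ∈ T, (p : 𝓞 K) ∈ q.1.asIdeal := by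
    intro q hq
    obtain ⟨p', f', hp', hf', hN', hmem'⟩ := prime_norm q.1
    have h1 : p' ∣ p ^ (f * (q0.2 + 1)) := by
      rw [← hn, ← hT q hq, pn_eq, hN']
      exact (dvd_pow_self p' hf').trans (dvd_pow_self _ (by omega))
    have h2 := (Nat.prime_dvd_prime_iff_eq hp' hp).1 (hp'.dvd_of_dvd_pow h1)
    rwa [← h2]
  have hinj : Set.InjOn (fun q : PK K => q.1.asIdeal) T := by
    intro a ha b hb hab
    have h1 : a.1 = b.1 := HeightOneSpectrum.ext hab
    have h2 : pn a = pn b := (hT a ha).trans (hT b hb).symm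
    rw [pn_eq, pn_eq, h1] at h2
    have h3 := Nat.pow_right_injective (norm_ge_two b.1) h2
    exact Prod.ext h1 (by simpa using h3)
  have hdvd : ∏ I ∈ T.image (fun q : PK K => q.1.asIdeal), I ∣ Ideal.span {(p : 𝓞 K)} := by
    refine Finset.prod_primes_dvd _ (fun I hI => ?_) (fun I hI => ?_)
    · obtain ⟨q, hq, rfl⟩ := Finset.mem_image.1 hI
      exact q.1.prime
    · obtain ⟨q, hq, rfl⟩ := Finset.mem_image.1 hI
      rw [Ideal.dvd_span_singleton]
      exact hall q hq
  rw [Finset.prod_image hinj] at hdvd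
  have h4 := map_dvd (Ideal.absNorm (S := 𝓞 K)) hdvd
  rw [map_prod, Ideal.absNorm_span_natCast, RingOfIntegers.rank] at h4
  have h5 := Nat.le_of_dvd (pow_pos hp.pos _) h4
  have h6 : (∏ q ∈ T, (Ideal.absNorm q.1.asIdeal : ℝ)) ≤ (p:ℝ) ^ Module.finrank ℚ K := by exact_mod_cast h5
  have hpos : ∀ q ∈ T, (Ideal.absNorm q.1.asIdeal : ℝ) ≠ 0 := fun q _ => by
    have := norm_ge_two q.1
    positivity
  have h7 := Real.log_le_log (Finset.prod_pos fun q hq => lt_of_le_of_ne (by positivity) (hpos q hq).symm) h6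
  rw [Real.log_prod hpos, Real.log_pow] at h7
  rw [hΛ]
  exact h7

lemma pl_finset_le (g : ℕ → ℝ) (hg : ∀ n, 0 ≤ g n) (hs : Summable fun n => vonMangoldt n * g n)
    (T : Finset (PK K)) : ∑ q ∈ T, pl q * g (pn q) ≤ Module.finrank ℚ K * ∑' n, vonMangoldt n * g n := by
  rw [← Finset.sum_fiberwise_of_maps_to (t := T.image pn) (g := pn)
    (fun q hq => Finset.mem_image_of_mem _ hq)]
  calc _ ≤ ∑ n ∈ T.image pn, Module.finrank ℚ K * (vonMangoldt n * g n) := by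
        refine Finset.sum_le_sum fun n hn => ?_
        rw [← mul_assoc]
        calc _ = ∑ q ∈ T with pn q = n, pl q * g n :=
              Finset.sum_congr rfl fun q hq => by rw [(Finset.mem_filter.1 hq).2]
          _ = (∑ q ∈ T with pn q = n, pl q) * g n := by rw [Finset.sum_mul]
          _ ≤ _ := mul_le_mul_of_nonneg_right
              (pl_le n _ fun q hq => (Finset.mem_filter.1 hq).2) (hg n)
    _ = Module.finrank ℚ K * ∑ n ∈ T.image pn, (vonMangoldt n * g n) := by rw [Finset.mul_sum]
    _ ≤ _ := by
        refine mul_le_mul_of_nonneg_left (hs.sum_le_tsum _ fun n _ => ?_) (by positivity)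
        exact mul_nonneg vonMangoldt_nonneg (hg n)

lemma pl_summable (g : ℕ → ℝ) (hg : ∀ n, 0 ≤ g n) (hs : Summable fun n => vonMangoldt n * g n) :
    Summable (fun q : PK K => pl q * g (pn q)) :=
  summable_of_sum_le (fun q => mul_nonneg (pl_pos q).le (hg _)) (pl_finset_le g hg hs)

lemma pl_tsum_le (g : ℕ → ℝ) (hg : ∀ n, 0 ≤ g n) (hs : Summable fun n => vonMangoldt n * g n) :
    ∑' q : PK K, pl q * g (pn q) ≤ Module.finrank ℚ K * ∑' n, vonMangoldt n * g n :=
  (pl_summable g hg hs).tsum_le_of_sum_le (pl_finset_le g hg hs)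

lemma vm_summable {σ : ℝ} (hσ : 1 < σ) : Summable fun n : ℕ => vonMangoldt n * (n:ℝ) ^ (-σ) := by
  have := (LSeriesSummable_vonMangoldt (s := (σ:ℂ)) (by simpa using hσ)).norm
  refine this.congr fun n => ?_
  rcases eq_or_ne n 0 with rfl | hn
  · simp
  rw [LSeries.term_of_ne_zero hn, norm_div, Complex.norm_natCast_cpow_of_pos (by omega)]
  rw [Complex.norm_real, Real.norm_of_nonneg vonMangoldt_nonneg, Real.rpow_neg (by positivity)]
  simp [div_eq_mul_inv]

lemma pk_summable {σ : ℝ} (hσ : 1 < σ) : Summable fun q : PK K => pl q * (pn q : ℝ) ^ (-σ) :=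
  pl_summable (fun n => (n:ℝ) ^ (-σ)) (fun n => by positivity) (vm_summable hσ)

lemma log_sum (I : Ideal (𝓞 K)) (hI : I ≠ ⊥) :
    HasSum (fun q : PK K => if q.1.asIdeal ^ (q.2 + 1) ∣ I then pl q else 0)
      (Real.log (Ideal.absNorm I)) := by
  have hI0 : I ≠ 0 := hI
  set c : HeightOneSpectrum (𝓞 K) → ℕ := fun P =>
    (Associates.mk P.asIdeal).count (Associates.mk I).factors with hc
  have hdv : ∀ q : PK K, q.1.asIdeal ^ (q.2 + 1) ∣ I ↔ q.2 + 1 ≤ c q.1 := by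
    intro q
    rw [← Associates.prime_pow_dvd_iff_le (Associates.mk_ne_zero.2 hI0) q.1.associates_irreducible,
      ← Associates.mk_pow, Associates.mk_le_mk_iff_dvd]
  have hfin := Ideal.hasFiniteMulSupport hI0
  have hprod := Ideal.finprod_heightOneSpectrum_factorization hI0
  have hfin' : (Function.mulSupport fun v : HeightOneSpectrum (𝓞 K) => v.maxPowDividing I).Finite := hfin
  set S := hfin'.toFinset with hS
  have hmemS : ∀ P, P ∉ S → c P = 0 := by
    intro P hP
    rw [hS, Set.Finite.mem_toFinset, Function.mem_mulSupport, not_not] at hP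
    by_contra h0
    have h1 : P.asIdeal ∣ P.asIdeal ^ c P := dvd_pow_self _ h0
    have h2 : P.asIdeal ^ c P = 1 := hP
    rw [h2] at h1
    exact P.prime.not_unit (isUnit_of_dvd_one h1)
  rw [finprod_eq_prod_of_mulSupport_subset (s := S) _ (by rw [hS]; simp)] at hprod
  have hlog : Real.log (Ideal.absNorm I) = ∑ P ∈ S, c P * Real.log (Ideal.absNorm P.asIdeal) := by
    conv_lhs => rw [← hprod]
    rw [map_prod, Nat.cast_prod, Real.log_prod]
    · refine Finset.sum_congr rfl fun P hP => ?_
      rw [← Real.log_pow]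
      congr 1
      have : P.maxPowDividing I = P.asIdeal ^ c P := rfl
      rw [this, map_pow, Nat.cast_pow]
    · intro P hP
      have : P.maxPowDividing I = P.asIdeal ^ c P := rfl
      rw [this, map_pow, Nat.cast_pow]
      have := norm_ge_two P
      positivity
  have hT : ∀ q ∉ S ×ˢ Finset.range (S.sup c),
      (if q.1.asIdeal ^ (q.2 + 1) ∣ I then pl q else 0) = 0 := by
    intro q hq
    refine if_neg fun h => hq ?_
    rw [hdv] at h
    have h1 : q.1 ∈ S := by
      by_contra h2
      rw [hmemS _ h2] at h
      omega
    refine Finset.mem_product.2 ⟨h1, Finset.mem_range.2 ?_⟩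
    exact lt_of_lt_of_le h (Finset.le_sup h1)
  have h8 := hasSum_sum_of_ne_finset_zero (L := SummationFilter.unconditional _) hT
  convert h8 using 1
  rw [hlog, Finset.sum_product]
  refine Finset.sum_congr rfl fun P hP => ?_
  simp only [pl]
  rw [← Finset.sum_filter, Finset.sum_const, nsmul_eq_mul]
  congr 2
  have : (Finset.range (S.sup c)).filter (fun k => P.asIdeal ^ (k + 1) ∣ I) = Finset.range (c P) := by
    ext k
    have : c P ≤ S.sup c := Finset.le_sup hP
    have h9 := hdv (P, k)
    simp only [Finset.mem_filter, Finset.mem_range]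
    simp only at h9
    rw [h9]
    omega
  rw [this, Finset.card_range]

end

end

section
open NumberField IsDedekindDomain ArithmeticFunction
section
variable {K : Type*} [Field K] [NumberField K]
open scoped Classical

lemma dz_conv {s : ℂ}
    (hq : Summable fun q : PK K => ‖(pl q : ℂ) * (pn q : ℂ) ^ (-s)‖)
    (hI : Summable fun I : {I : Ideal (𝓞 K) // I ≠ ⊥} => ‖(Ideal.absNorm I.1 : ℂ) ^ (-s)‖) :
    HasSum (fun I : {I : Ideal (𝓞 K) // I ≠ ⊥} =>
      (Real.log (Ideal.absNorm I.1) : ℂ) * (Ideal.absNorm I.1 : ℂ) ^ (-s))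
      ((∑' q : PK K, (pl q : ℂ) * (pn q : ℂ) ^ (-s)) *
      (∑' I : {I : Ideal (𝓞 K) // I ≠ ⊥}, (Ideal.absNorm I.1 : ℂ) ^ (-s))) := by
  have hprod := (summable_mul_of_summable_norm hq hI).hasSum
  rw [← tsum_mul_tsum_of_summable_norm hq hI] at hprod
  have hne : ∀ z : PK K × {I : Ideal (𝓞 K) // I ≠ ⊥}, z.1.1.asIdeal ^ (z.1.2 + 1) * z.2.1 ≠ ⊥ := fun z =>
    mul_ne_zero (pow_ne_zero _ z.1.1.ne_bot) z.2.2
  set φ : PK K × {I : Ideal (𝓞 K) // I ≠ ⊥} → {I : Ideal (𝓞 K) // I ≠ ⊥} := fun z =>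
    ⟨z.1.1.asIdeal ^ (z.1.2 + 1) * z.2.1, hne z⟩ with hφ
  have h1 := hprod.tsum_fiberwise φ
  refine (congrArg (fun g => HasSum g _) (funext fun I => ?_)).mpr h1
  have hval : ∀ b : φ ⁻¹' {I}, (pl b.1.1 : ℂ) * (pn b.1.1 : ℂ) ^ (-s) * (Ideal.absNorm b.1.2.1 : ℂ) ^ (-s) =
      (pl b.1.1 : ℂ) * (Ideal.absNorm I.1 : ℂ) ^ (-s) := by
    intro b
    have hb : b.1.1.1.asIdeal ^ (b.1.1.2 + 1) * b.1.2.1 = I.1 := congrArg Subtype.val (b.2 : φ b.1 = I)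
    rw [mul_assoc, ← Complex.natCast_mul_natCast_cpow, pn, ← Nat.cast_mul, ← map_mul, hb]
  rw [tsum_congr hval, tsum_mul_right]
  congr 1
  have h2 := (log_sum I.1 I.2)
  have h2' : HasSum (fun q : PK K => if q.1.asIdeal ^ (q.2 + 1) ∣ I.1 then (pl q : ℂ) else 0)
      (Real.log (Ideal.absNorm I.1)) := by
    have := Complex.hasSum_ofReal.2 h2
    convert this using 2 with q
    split_ifs <;> simp
  let e : φ ⁻¹' {I} ≃ {q : PK K | q.1.asIdeal ^ (q.2 + 1) ∣ I.1} :=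
    Equiv.ofBijective (fun b => ⟨b.1.1, by
      have hb : b.1.1.1.asIdeal ^ (b.1.1.2 + 1) * b.1.2.1 = I.1 := congrArg Subtype.val (b.2 : φ b.1 = I)
      exact ⟨_, hb.symm⟩⟩) (by
      constructor
      · intro a b hab
        have h3 : a.1.1 = b.1.1 := congrArg Subtype.val hab
        have h4 : φ a.1 = φ b.1 := (a.2 : φ a.1 = I).trans (b.2 : φ b.1 = I).symm
        have h5 := congrArg Subtype.val h4
        simp only [hφ, h3] at h5
        have h6 := mul_left_cancel₀ (pow_ne_zero _ b.1.1.1.ne_bot) h5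
        exact Subtype.ext (Prod.ext h3 (Subtype.ext h6))
      · rintro ⟨q, J, hJ⟩
        have hJ0 : J ≠ ⊥ := by
          rintro rfl
          exact I.2 (by rw [hJ]; exact mul_zero _)
        exact ⟨⟨(q, ⟨J, hJ0⟩), Subtype.ext hJ.symm⟩, rfl⟩)
  have h3 : ∑' b : φ ⁻¹' {I}, (pl b.1.1 : ℂ) = ∑' q : {q : PK K | q.1.asIdeal ^ (q.2 + 1) ∣ I.1}, (pl q.1 : ℂ) :=
    e.tsum_eq (fun q : {q : PK K | q.1.asIdeal ^ (q.2 + 1) ∣ I.1} => (pl q.1 : ℂ))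
  rw [h3, tsum_subtype {q : PK K | q.1.asIdeal ^ (q.2 + 1) ∣ I.1} (fun q => (pl q : ℂ)), ← h2'.tsum_eq]
  rfl

end

end

section
open NumberField IsDedekindDomain ArithmeticFunction
section

lemma dir_norm {n : ℕ} (hn : 1 ≤ n) (c : ℝ) (hc : 0 ≤ c) (s : ℂ) :
    ‖(c : ℂ) * (n : ℂ) ^ (-s)‖ = c * (n:ℝ) ^ (-s.re) := by
  rw [norm_mul, Complex.norm_real, Real.norm_of_nonneg hc, Complex.norm_natCast_cpow_of_pos (by omega)]
  simp

lemma dir_summable {ι : Type*} (c : ι → ℝ) (hc : ∀ i, 0 ≤ c i) (n : ι → ℕ) (hn : ∀ i, 1 ≤ n i)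
    (hs : ∀ σ : ℝ, 1 < σ → Summable fun i => c i * (n i : ℝ) ^ (-σ)) {s : ℂ} (h : 1 < s.re) :
    Summable fun i => ‖(c i : ℂ) * (n i : ℂ) ^ (-s)‖ := by
  simpa only [dir_norm (hn _) _ (hc _)] using hs _ h

lemma dir_deriv {ι : Type*} (c : ι → ℝ) (hc : ∀ i, 0 ≤ c i) (n : ι → ℕ) (hn : ∀ i, 1 ≤ n i)
    (hs : ∀ σ : ℝ, 1 < σ → Summable fun i => c i * (n i : ℝ) ^ (-σ)) {s : ℂ} (h : 1 < s.re) :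
    HasDerivAt (fun s : ℂ => ∑' i, (c i : ℂ) * (n i : ℂ) ^ (-s))
      (-∑' i, ((c i * Real.log (n i) : ℝ) : ℂ) * (n i : ℂ) ^ (-s)) s := by
  obtain ⟨σ, hσ1, hσ2⟩ := exists_between h
  have hopen : IsOpen {z : ℂ | σ < z.re} := isOpen_lt continuous_const Complex.continuous_re
  have hd : ∀ i (z : ℂ), HasDerivAt (fun s : ℂ => (c i : ℂ) * (n i : ℂ) ^ (-s))
      (-(((c i * Real.log (n i) : ℝ) : ℂ) * (n i : ℂ) ^ (-z))) z := by
    intro i z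
    have hn0 : (n i : ℂ) ≠ 0 := by
      have := hn i
      exact_mod_cast (by omega : n i ≠ 0)
    refine (((hasDerivAt_neg z).const_cpow (Or.inl hn0)).const_mul (c i : ℂ)).congr_deriv ?_
    rw [Complex.ofReal_mul, Complex.natCast_log]
    ring
  have hbd : ∀ i, ∀ z ∈ {z : ℂ | σ < z.re}, ‖(c i : ℂ) * (n i : ℂ) ^ (-z)‖ ≤ c i * (n i : ℝ) ^ (-σ) := by
    intro i z hz
    rw [dir_norm (hn i) _ (hc i)]
    refine mul_le_mul_of_nonneg_left (Real.rpow_le_rpow_of_exponent_le (by exact_mod_cast hn i) ?_) (hc i)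
    have : σ < z.re := hz
    linarith
  have h1 := Complex.hasSum_deriv_of_summable_norm (hs σ hσ1)
    (fun i z hz => (hd i z).differentiableAt.differentiableWithinAt) hopen hbd hσ2
  have h2 := (Complex.differentiableOn_tsum_of_summable_norm (hs σ hσ1)
    (fun i z hz => (hd i z).differentiableAt.differentiableWithinAt) hopen hbd).differentiableAt
    (hopen.mem_nhds hσ2)
  refine h2.hasDerivAt.congr_deriv ?_
  rw [← h1.tsum_eq, ← tsum_neg]
  exact tsum_congr fun i => (hd i s).deriv

variable (K : Type*) [Field K] [NumberField K]

/-- Dirichlet series -/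
noncomputable def Zs (s : ℂ) : ℂ := ∑' I : {I : Ideal (𝓞 K) // I ≠ ⊥}, (Ideal.absNorm I.1 : ℂ) ^ (-s)
/-- minus its log derivative -/
noncomputable def Ds (s : ℂ) : ℂ := ∑' q : PK K, (pl q : ℂ) * (pn q : ℂ) ^ (-s)

variable {K}

lemma nI_ge (I : {I : Ideal (𝓞 K) // I ≠ ⊥}) : 1 ≤ Ideal.absNorm I.1 :=
  Nat.one_le_iff_ne_zero.2 (Ideal.absNorm_eq_zero_iff.not.2 I.2)

lemma Zs_deriv (hs : ∀ σ : ℝ, 1 < σ → Summable fun I : {I : Ideal (𝓞 K) // I ≠ ⊥} => (Ideal.absNorm I.1 : ℝ) ^ (-σ))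
    {s : ℂ} (h : 1 < s.re) : HasDerivAt (Zs K) (-(Ds K s * Zs K s)) s := by
  have hs' : ∀ σ : ℝ, 1 < σ → Summable fun I : {I : Ideal (𝓞 K) // I ≠ ⊥} =>
    (1:ℝ) * (Ideal.absNorm I.1 : ℝ) ^ (-σ) := by simpa only [one_mul] using hs
  have h1 := dir_deriv (fun _ : {I : Ideal (𝓞 K) // I ≠ ⊥} => 1) (fun _ => zero_le_one)
    (fun I => Ideal.absNorm I.1) nI_ge hs' h
  have h2 := dir_summable (fun _ : {I : Ideal (𝓞 K) // I ≠ ⊥} => 1) (fun _ => zero_le_one)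
    (fun I => Ideal.absNorm I.1) nI_ge hs' h
  have h3 := dir_summable (fun q : PK K => pl q) (fun q => (pl_pos q).le)
    pn (fun q => by have := pn_ge_two q; omega) (fun σ hσ => pk_summable hσ) h
  simp only [Complex.ofReal_one, one_mul] at h1 h2
  have h4 := (dz_conv h3 h2).tsum_eq
  rw [h4] at h1
  exact h1

lemma Zs_ne (hs : ∀ σ : ℝ, 1 < σ → Summable fun I : {I : Ideal (𝓞 K) // I ≠ ⊥} => (Ideal.absNorm I.1 : ℝ) ^ (-σ))
    {s : ℂ} (h : 1 < s.re) : Zs K s ≠ 0 := by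
  set G : ℂ → ℂ := fun s => ∑' q : PK K, (((1 / (q.2 + 1) : ℝ) : ℝ) : ℂ) * (pn q : ℂ) ^ (-s) with hG
  have hGd : ∀ {s : ℂ}, 1 < s.re → HasDerivAt G (-Ds K s) s := by
    intro s h
    have h1 := dir_deriv (fun q : PK K => (1 / (q.2 + 1) : ℝ)) (fun q => by positivity) pn
      (fun q => by have := pn_ge_two q; omega) (fun σ hσ => by
        have hl : 0 < Real.log 2 := Real.log_pos (by norm_num)
        refine Summable.of_nonneg_of_le (fun q => by positivity) (fun q => ?_)
          ((pk_summable hσ).mul_left (1 / Real.log 2))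
        rw [← mul_assoc]
        refine mul_le_mul_of_nonneg_right ?_ (by positivity)
        have h5 : Real.log 2 ≤ pl q := Real.log_le_log (by norm_num) (by exact_mod_cast norm_ge_two q.1)
        calc (1 / (q.2 + 1) : ℝ) ≤ 1 := by
              rw [div_le_one (by positivity)]
              linarith [(Nat.cast_nonneg q.2 : (0:ℝ) ≤ q.2)]
          _ = 1 / Real.log 2 * Real.log 2 := by field_simp
          _ ≤ _ := by gcongr) h
    refine h1.congr_deriv ?_
    congr 1
    refine tsum_congr fun q => ?_
    congr 2
    rw [pn_eq, Nat.cast_pow, Real.log_pow, pl]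
    push_cast
    have : (q.2 + 1 : ℝ) ≠ 0 := by positivity
    field_simp
  have hc : ∀ z : ℂ, 1 < z.re → HasDerivAt (fun s => Zs K s * Complex.exp (-G s)) 0 z := by
    intro z hz
    refine ((Zs_deriv hs hz).mul (hGd hz).neg.cexp).congr_deriv ?_
    ring
  have hconv : Convex ℝ {z : ℂ | 1 < z.re} := convex_halfSpace_re_gt 1
  have hopen : IsOpen {z : ℂ | 1 < z.re} := isOpen_lt continuous_const Complex.continuous_re
  have hconst : Zs K s * Complex.exp (-G s) = Zs K 2 * Complex.exp (-G 2) := by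
    refine hconv.is_const_of_fderivWithin_eq_zero (𝕜 := ℂ) (f := fun s => Zs K s * Complex.exp (-G s))
      (fun z hz => (hc z hz).differentiableAt.differentiableWithinAt) (fun z hz => ?_) h (by norm_num)
    rw [fderivWithin_of_isOpen hopen hz, (hc z hz).hasFDerivAt.fderiv]
    ext; simp
  have h2 : Zs K 2 ≠ 0 := by
    have e : Zs K 2 = ((∑' I : {I : Ideal (𝓞 K) // I ≠ ⊥}, (Ideal.absNorm I.1 : ℝ) ^ (-2:ℝ) : ℝ) : ℂ) := by
      rw [Zs, Complex.ofReal_tsum]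
      refine tsum_congr fun I => ?_
      rw [Complex.ofReal_cpow (by positivity)]
      norm_num
    rw [e]
    have h3 : 0 < ∑' I : {I : Ideal (𝓞 K) // I ≠ ⊥}, (Ideal.absNorm I.1 : ℝ) ^ (-2:ℝ) := by
      refine (hs 2 (by norm_num)).tsum_pos (fun I => by positivity) ⟨⊤, top_ne_bot⟩ ?_
      simp
    exact_mod_cast h3.ne'
  intro h0
  rw [h0, zero_mul] at hconst
  exact mul_ne_zero h2 (Complex.exp_ne_zero _) hconst.symm

/-- the 3-4-1 inequality -/
lemma Ds_341 {σ : ℝ} (hσ : 1 < σ) (y : ℝ) :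
    0 ≤ 3 * (Ds K σ).re + 4 * (Ds K (σ + y * Complex.I)).re + (Ds K (σ + 2 * y * Complex.I)).re := by
  have key : ∀ v : ℝ, HasSum (fun q : PK K => pl q * (pn q : ℝ) ^ (-σ) * Real.cos (v * Real.log (pn q)))
      (Ds K (σ + v * Complex.I)).re := by
    intro v
    have h3 := dir_summable (fun q : PK K => pl q) (fun q => (pl_pos q).le)
      pn (fun q => by have := pn_ge_two q; omega) (fun σ hσ => pk_summable hσ)
      (s := σ + v * Complex.I) (by simpa using hσ)
    have h4 := Complex.hasSum_re h3.of_norm.hasSum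
    refine (congrArg (fun g => HasSum g _) (funext fun q => ?_)).mpr h4
    have hn0 : (0:ℝ) < pn q := by have := pn_ge_two q; positivity
    rw [Complex.re_ofReal_mul, mul_assoc]
    congr 1
    rw [Complex.cpow_def_of_ne_zero (by exact_mod_cast hn0.ne'), Complex.exp_re, ← Complex.natCast_log,
      Real.rpow_def_of_pos hn0]
    simp [Complex.log_re, Complex.log_im, Complex.natCast_arg, Real.cos_neg, mul_comm]
  have h0 := key 0
  have h1 := key y
  have h2 := key (2 * y)
  simp only [zero_mul, Complex.ofReal_zero, add_zero, Real.cos_zero, mul_one] at h0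
  push_cast at h2
  have h5 := ((h0.mul_left 3).add (h1.mul_left 4)).add h2
  refine h5.nonneg fun q => ?_
  have hp : 0 ≤ pl q * (pn q : ℝ) ^ (-σ) := mul_nonneg (pl_pos q).le (by positivity)
  have hcos : Real.cos (2 * y * Real.log (pn q)) = 2 * Real.cos (y * Real.log (pn q)) ^ 2 - 1 := by
    rw [mul_assoc, Real.cos_two_mul]
  have : 3 * (pl q * (pn q : ℝ) ^ (-σ)) + 4 * (pl q * (pn q : ℝ) ^ (-σ) * Real.cos (y * Real.log (pn q))) +
      pl q * (pn q : ℝ) ^ (-σ) * Real.cos (2 * y * Real.log (pn q)) =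
      pl q * (pn q : ℝ) ^ (-σ) * (2 * (1 + Real.cos (y * Real.log (pn q))) ^ 2) := by
    rw [hcos]; ring
  rw [this]
  positivity

end

end

section
open NumberField IsDedekindDomain ArithmeticFunction Filter Topology
section

lemma log_res {F : ℂ → ℂ} (hF : Differentiable ℂ F) {z0 : ℂ} (h0 : F z0 ≠ 0) (ρ : ℂ) :
    Tendsto (fun z => (z - ρ) * logDeriv F z) (𝓝[≠] ρ) (𝓝 (analyticOrderNatAt F ρ : ℂ)) := by
  have hA := entire_an hF ρ
  obtain ⟨g, hg, hgρ, hev⟩ := hA.analyticOrderAt_ne_top.1 (entire_order_ne_top hF h0 ρ)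
  set m := analyticOrderNatAt F ρ
  have hev2 : ∀ᶠ z in 𝓝[≠] ρ, (z - ρ) * logDeriv F z = m + (z - ρ) * logDeriv g z := by
    have h1 : ∀ᶠ z in 𝓝[≠] ρ, ∀ᶠ w in 𝓝 z, F w = (w - ρ) ^ m • g w :=
      hev.eventually_nhds.filter_mono nhdsWithin_le_nhds
    have h2 : ∀ᶠ z in 𝓝[≠] ρ, g z ≠ 0 := (hg.continuousAt.eventually_ne hgρ).filter_mono nhdsWithin_le_nhds
    have h3 : ∀ᶠ z in 𝓝[≠] ρ, AnalyticAt ℂ g z := hg.eventually_analyticAt.filter_mono nhdsWithin_le_nhds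
    filter_upwards [h1, h2, h3, self_mem_nhdsWithin] with z h1 h2 h3 h4
    have h5 : z - ρ ≠ 0 := sub_ne_zero.2 h4
    have h6 : logDeriv F z = logDeriv (fun w => (w - ρ) ^ m * g w) z := by
      have h1' : F =ᶠ[𝓝 z] fun w => (w - ρ) ^ m * g w := h1
      rw [logDeriv_apply, logDeriv_apply, h1'.deriv_eq, h1'.self_of_nhds]
    rw [h6, logDeriv_mul (f := fun w => (w - ρ) ^ m) z (pow_ne_zero _ h5) h2 (by fun_prop) h3.differentiableAt,
      logDeriv_fun_pow (f := fun w => w - ρ) (by fun_prop)]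
    have h7 : logDeriv (fun w => w - ρ) z = (z - ρ)⁻¹ := by
      have : HasDerivAt (fun w => w - ρ) 1 z := (hasDerivAt_id z).sub_const ρ
      rw [logDeriv_apply, this.deriv, one_div]
    rw [h7]
    field_simp
  refine Tendsto.congr' (EventuallyEq.symm hev2) ?_
  have hc : ContinuousAt (fun z => (m:ℂ) + (z - ρ) * logDeriv g z) ρ := by
    have h1 : ContinuousAt (logDeriv g) ρ := hg.deriv.continuousAt.div hg.continuousAt hgρ
    fun_prop
  have := hc.tendsto.mono_left (nhdsWithin_le_nhds (s := {ρ}ᶜ))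
  simpa using this

lemma log_res_real {F : ℂ → ℂ} (hF : Differentiable ℂ F) {z0 : ℂ} (h0 : F z0 ≠ 0) (y : ℝ) :
    Tendsto (fun σ : ℝ => (σ - 1) * (logDeriv F (σ + y * Complex.I)).re) (𝓝[>] 1)
      (𝓝 (analyticOrderNatAt F (1 + y * Complex.I) : ℝ)) := by
  have h1 := log_res hF h0 (1 + y * Complex.I)
  have h2 : Tendsto (fun σ : ℝ => (σ + y * Complex.I : ℂ)) (𝓝[>] 1) (𝓝[≠] (1 + y * Complex.I)) := by
    refine tendsto_nhdsWithin_iff.2 ⟨?_, ?_⟩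
    · have : ContinuousAt (fun σ : ℝ => (σ + y * Complex.I : ℂ)) 1 := by fun_prop
      have := this.tendsto.mono_left (nhdsWithin_le_nhds (s := Set.Ioi 1))
      simpa using this
    · filter_upwards [self_mem_nhdsWithin] with σ hσ
      have : (1:ℝ) < σ := hσ
      simp only [Set.mem_compl_iff, Set.mem_singleton_iff]
      intro h
      have := congrArg Complex.re h
      simp at this
      linarith
  have h3 := (Complex.continuous_re.tendsto _).comp (h1.comp h2)
  simp only [Complex.natCast_re] at h3
  refine h3.congr fun σ => ?_
  simp only [Function.comp]
  have : (σ + y * Complex.I : ℂ) - (1 + y * Complex.I) = ((σ - 1 : ℝ) : ℂ) := by push_cast; ring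
  rw [this, Complex.re_ofReal_mul]

variable {K : Type*} [Field K] [NumberField K]

lemma H_logDeriv (hs : ∀ σ : ℝ, 1 < σ → Summable fun I : {I : Ideal (𝓞 K) // I ≠ ⊥} => (Ideal.absNorm I.1 : ℝ) ^ (-σ))
    {H : ℂ → ℂ} (hH : ∀ s : ℂ, 1 < s.re → H s = Zs K s * (s - 1)) {s : ℂ} (h : 1 < s.re) :
    logDeriv H s = -Ds K s + 1 / (s - 1) := by
  have hopen : IsOpen {z : ℂ | 1 < z.re} := isOpen_lt continuous_const Complex.continuous_re
  have hev : H =ᶠ[𝓝 s] fun s => Zs K s * (s - 1) := by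
    filter_upwards [hopen.mem_nhds h] with z hz using hH z hz
  have h1 := (Zs_deriv hs h).mul ((hasDerivAt_id s).sub_const 1)
  have h2 : s - 1 ≠ 0 := by
    intro h0
    have := congrArg Complex.re h0
    simp at this
    linarith
  have h3 := Zs_ne hs h
  rw [logDeriv_apply, hev.deriv_eq, hH s h]
  have h4 : deriv (fun s => Zs K s * (s - 1)) s = _ := h1.deriv
  rw [h4]
  simp only [id]
  field_simp

lemma H_ne (hs : ∀ σ : ℝ, 1 < σ → Summable fun I : {I : Ideal (𝓞 K) // I ≠ ⊥} => (Ideal.absNorm I.1 : ℝ) ^ (-σ))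
    {H : ℂ → ℂ} (hd : Differentiable ℂ H) (hH : ∀ s : ℂ, 1 < s.re → H s = Zs K s * (s - 1)) (h1 : H 1 ≠ 0)
    {s : ℂ} (h : 1 ≤ s.re) : H s ≠ 0 := by
  have hs1 : ∀ z : ℂ, 1 < z.re → z - 1 ≠ 0 := by
    intro z hz h0
    have := congrArg Complex.re h0
    simp at this
    linarith
  rcases h.lt_or_eq with h | h
  · rw [hH s h]
    exact mul_ne_zero (Zs_ne hs h) (hs1 s h)
  set y := s.im with hy
  have hse : s = 1 + y * Complex.I := by
    apply Complex.ext <;> simp [← h, hy]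
  by_cases hy0 : y = 0
  · rw [hse, hy0]; simpa using h1
  have lim : ∀ v : ℝ, v ≠ 0 → Tendsto (fun σ : ℝ => (σ - 1) * (Ds K (σ + v * Complex.I)).re) (𝓝[>] 1)
      (𝓝 (-(analyticOrderNatAt H (1 + v * Complex.I) : ℝ))) := by
    intro v hv
    have h2 := (log_res_real hd h1 v).neg
    have h3 : Tendsto (fun σ : ℝ => (σ - 1) * (1 / (σ + v * Complex.I - 1)).re) (𝓝[>] 1) (𝓝 0) := by
      have : ContinuousAt (fun σ : ℝ => (σ - 1) * (1 / (σ + v * Complex.I - 1) : ℂ).re) 1 := by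
        refine ContinuousAt.mul (by fun_prop) ?_
        refine Complex.continuous_re.continuousAt.comp ?_
        refine ContinuousAt.div (by fun_prop) (by fun_prop) ?_
        simpa using hv
      have := this.tendsto.mono_left (nhdsWithin_le_nhds (s := Set.Ioi 1))
      simpa using this
    have h4 := h2.add h3
    rw [add_zero] at h4
    refine h4.congr' ?_
    filter_upwards [self_mem_nhdsWithin] with σ hσ
    have hσ' : (1:ℝ) < σ := hσ
    rw [H_logDeriv hs hH (s := σ + v * Complex.I) (by simpa using hσ')]
    simp only [Complex.add_re, Complex.neg_re]
    ring
  have lim0 : Tendsto (fun σ : ℝ => (σ - 1) * (Ds K σ).re) (𝓝[>] 1) (𝓝 1) := by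
    have h2 := (log_res_real hd h1 0).neg
    have h3 : analyticOrderNatAt H (1 + (0:ℝ) * Complex.I) = 0 := by
      rw [order_zero_iff hd h1]
      simpa using h1
    rw [h3] at h2
    have h4 := h2.add (tendsto_const_nhds (x := (1:ℝ)))
    simp only [Nat.cast_zero, neg_zero, zero_add] at h4
    refine h4.congr' ?_
    filter_upwards [self_mem_nhdsWithin] with σ hσ
    have hσ' : (1:ℝ) < σ := hσ
    have h5 : ((σ:ℂ) + (0:ℝ) * Complex.I) = σ := by simp
    rw [h5, H_logDeriv hs hH (s := σ) (by simpa using hσ')]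
    have h6 : (1 / ((σ:ℂ) - 1)) = ((1 / (σ - 1) : ℝ) : ℂ) := by push_cast; rfl
    rw [h6, Complex.add_re, Complex.ofReal_re, Complex.neg_re]
    have : σ - 1 ≠ 0 := by linarith
    field_simp
    ring
  have hl := ((lim0.const_mul 3).add ((lim y hy0).const_mul 4)).add (lim (2 * y) (by simpa using hy0))
  have hge := ge_of_tendsto hl (b := 0) (by
    filter_upwards [self_mem_nhdsWithin] with σ hσ
    have hσ' : (1:ℝ) < σ := hσ
    have := Ds_341 (K := K) hσ' y
    push_cast
    nlinarith)
  intro hz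
  have hm : analyticOrderNatAt H (1 + y * Complex.I) ≠ 0 := by
    intro h0
    rw [order_zero_iff hd h1] at h0
    rw [hse] at hz
    exact h0 hz
  have hm1 : (1:ℝ) ≤ analyticOrderNatAt H (1 + y * Complex.I) := by
    exact_mod_cast Nat.one_le_iff_ne_zero.2 hm
  have hm2 : (0:ℝ) ≤ analyticOrderNatAt H (1 + (2 * y : ℝ) * Complex.I) := Nat.cast_nonneg _
  linarith
end

end

section
open Filter Topology
section

/-- real digamma -/
noncomputable def psr (x : ℝ) : ℝ := deriv Real.Gamma x / Real.Gamma x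

lemma pos_ne_neg {x : ℝ} (hx : 0 < x) (m : ℕ) : x ≠ -(m:ℝ) := by
  have : (0:ℝ) ≤ m := Nat.cast_nonneg m
  intro h; linarith

lemma re_pos_ne_neg {s : ℂ} (hx : 0 < s.re) (m : ℕ) : s ≠ -(m:ℂ) := by
  have : (0:ℝ) ≤ m := Nat.cast_nonneg m
  intro h
  have := congrArg Complex.re h
  simp at this
  linarith

lemma digamma_ofReal {x : ℝ} (hx : 0 < x) : Complex.digamma x = (psr x : ℂ) := by
  have h1 := (Complex.differentiableAt_Gamma (x:ℂ) (re_pos_ne_neg (by simpa using hx))).hasDerivAt.comp_ofReal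
  have h2 := (Real.differentiableAt_Gamma (pos_ne_neg hx)).hasDerivAt.ofReal_comp
  have h3 : (fun y : ℝ => Complex.Gamma y) = fun y : ℝ => (Real.Gamma y : ℂ) :=
    funext fun y => Complex.Gamma_ofReal y
  rw [h3] at h1
  rw [Complex.digamma_def, logDeriv_apply, h1.unique h2, Complex.Gamma_ofReal, psr]
  push_cast; rfl

lemma psr_add_one {x : ℝ} (hx : 0 < x) : psr (x + 1) = psr x + x⁻¹ := by
  have h := Complex.digamma_apply_add_one (x:ℂ) (re_pos_ne_neg (by simpa using hx))
  rw [digamma_ofReal hx, show (x:ℂ) + 1 = ((x + 1 : ℝ) : ℂ) by push_cast; rfl, digamma_ofReal (by linarith)] at h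
  exact_mod_cast h

lemma psr_add_nat {x : ℝ} (hx : 0 < x) (N : ℕ) : psr (x + N) = psr x + ∑ n ∈ Finset.range N, (x + n)⁻¹ := by
  induction N with
  | zero => simp
  | succ N ih =>
    rw [Finset.sum_range_succ, ← add_assoc, ← ih, ← psr_add_one (by positivity)]
    push_cast
    rw [add_assoc]

lemma lg_step {x : ℝ} (hx : 0 < x) : Real.log (Real.Gamma (x + 1)) - Real.log (Real.Gamma x) = Real.log x := by
  rw [Real.Gamma_add_one hx.ne', Real.log_mul hx.ne' (Real.Gamma_pos_of_pos hx).ne']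
  ring

lemma lg_deriv {x : ℝ} (hx : 0 < x) : HasDerivAt (Real.log ∘ Real.Gamma) (psr x) x :=
  (Real.differentiableAt_Gamma (pos_ne_neg hx)).hasDerivAt.log (Real.Gamma_pos_of_pos hx).ne'

lemma psr_le {x : ℝ} (hx : 0 < x) : psr x ≤ Real.log x := by
  have h := Real.convexOn_log_Gamma.le_slope_of_hasDerivAt (Set.mem_Ioi.2 hx)
    (Set.mem_Ioi.2 (by linarith : 0 < x + 1)) (by linarith) (lg_deriv hx)
  rw [slope_def_field] at h
  simpa [lg_step hx] using h

lemma psr_ge {x : ℝ} (hx : 0 < x) : Real.log x ≤ psr (x + 1) := by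
  have h := Real.convexOn_log_Gamma.slope_le_of_hasDerivAt (Set.mem_Ioi.2 hx)
    (Set.mem_Ioi.2 (by linarith : 0 < x + 1)) (by linarith) (lg_deriv (by linarith : 0 < x + 1))
  rw [slope_def_field] at h
  simpa [lg_step hx] using h

lemma psr_lim {t s : ℝ} (ht : 0 < t) (hts : t ≤ s) :
    Tendsto (fun N : ℕ => psr (s + N) - psr (t + N)) atTop (𝓝 0) := by
  have hl : ∀ c d : ℝ, Tendsto (fun N : ℕ => Real.log (c + N) - Real.log (d + N)) atTop (𝓝 0) := by
    intro c d
    have h1 : ∀ c : ℝ, Tendsto (fun N : ℕ => Real.log (c + N) - Real.log N) atTop (𝓝 0) := by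
      intro c
      have := (Real.tendsto_log_comp_add_sub_log c).comp tendsto_natCast_atTop_atTop
      refine this.congr fun N => ?_
      simp [add_comm]
    have := (h1 c).sub (h1 d)
    simp only [sub_zero] at this
    refine this.congr fun N => ?_
    ring
  have hup := hl s (t - 1)
  have hlo := hl (s - 1) t
  refine tendsto_of_tendsto_of_tendsto_of_le_of_le' hlo hup ?_ ?_
  · filter_upwards [eventually_ge_atTop 1] with N hN
    have hN' : (1:ℝ) ≤ N := by exact_mod_cast hN
    have h1 := psr_ge (x := s - 1 + N) (by linarith)
    have h2 := psr_le (x := t + N) (by linarith)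
    rw [show s - 1 + N + 1 = s + N by ring] at h1
    linarith
  · filter_upwards [eventually_ge_atTop 1] with N hN
    have hN' : (1:ℝ) ≤ N := by exact_mod_cast hN
    have h1 := psr_ge (x := t - 1 + N) (by linarith)
    have h2 := psr_le (x := s + N) (by linarith)
    rw [show t - 1 + N + 1 = t + N by ring] at h1
    linarith

lemma psr_sum {t s : ℝ} (ht : 0 < t) (hts : t ≤ s) :
    HasSum (fun n : ℕ => (t + n)⁻¹ - (s + n)⁻¹) (psr s - psr t) := by
  rw [hasSum_iff_tendsto_nat_of_nonneg]
  · have h := (psr_lim ht hts).const_sub (psr s - psr t)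
    rw [sub_zero] at h
    refine h.congr fun N => ?_
    rw [psr_add_nat ht, psr_add_nat (by linarith), Finset.sum_sub_distrib]
    ring
  · intro n
    have : (0:ℝ) ≤ n := Nat.cast_nonneg n
    rw [sub_nonneg]
    exact inv_anti₀ (by linarith) (by linarith)

lemma sq_summable {t : ℝ} (ht : 0 < t) : Summable (fun n : ℕ => 1 / (t + n) ^ 2) := by
  have h1 : Summable (fun n : ℕ => 1 / ((n:ℝ)) ^ 2) := Real.summable_one_div_nat_pow.2 (by norm_num)
  rw [← summable_nat_add_iff 1] at h1 ⊢
  refine Summable.of_nonneg_of_le (fun n => by positivity) (fun n => ?_) h1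
  gcongr
  push_cast
  linarith

lemma digamma_series {t : ℝ} (ht : 0 < t) :
    ∀ w : ℂ, -(t/2) < w.re → Complex.digamma (t + w) = Complex.digamma t + w * deriv Complex.digamma t -
      w ^ 2 * ∑' n : ℕ, 1 / ((t + n : ℂ) ^ 2 * (w + (t + n))) := by
  set U : Set ℂ := {w | -(t/2) < w.re} with hU
  have hopen : IsOpen U := isOpen_lt continuous_const Complex.continuous_re
  have hbound : ∀ (n : ℕ) (w : ℂ), w ∈ U → ‖1 / ((t + n : ℂ) ^ 2 * (w + (t + n)))‖ ≤ 2 / t * (1 / (t + n) ^ 2) := by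
    intro n w hw
    have hw' : -(t/2) < w.re := hw
    have hn : (0:ℝ) ≤ n := Nat.cast_nonneg n
    have h1 : t / 2 ≤ ‖w + (t + n)‖ := by
      refine le_trans ?_ (Complex.re_le_norm _)
      simp; linarith
    have h2 : ‖(t + n : ℂ)‖ = t + n := by
      rw [show (t + n : ℂ) = ((t + n : ℝ) : ℂ) by push_cast; rfl, Complex.norm_real, Real.norm_of_nonneg (by positivity)]
    rw [norm_div, norm_one, norm_mul, norm_pow, h2]
    calc 1 / ((t + n) ^ 2 * ‖w + (t + n)‖) ≤ 1 / ((t + n) ^ 2 * (t / 2)) := by gcongr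
      _ = _ := by field_simp
  have hne : ∀ (n : ℕ) (w : ℂ), w ∈ U → w + (t + n : ℂ) ≠ 0 := by
    intro n w hw h
    have hw' : -(t/2) < w.re := hw
    have hn : (0:ℝ) ≤ n := Nat.cast_nonneg n
    have := congrArg Complex.re h
    simp at this
    linarith
  have hne2 : ∀ (n : ℕ), (t + n : ℂ) ≠ 0 := by
    intro n h
    have hn : (0:ℝ) ≤ n := Nat.cast_nonneg n
    have := congrArg Complex.re h
    simp at this
    linarith
  have hEd : DifferentiableOn ℂ (fun w : ℂ => ∑' n : ℕ, 1 / ((t + n : ℂ) ^ 2 * (w + (t + n)))) U := by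
    refine Complex.differentiableOn_tsum_of_summable_norm ((sq_summable ht).mul_left (2 / t)) (fun n => ?_) hopen hbound
    refine DifferentiableOn.div (by fun_prop) (by fun_prop) fun w hw => ?_
    exact mul_ne_zero (pow_ne_zero _ (hne2 n)) (hne n w hw)
  set E : ℂ → ℂ := fun w => ∑' n : ℕ, 1 / ((t + n : ℂ) ^ 2 * (w + (t + n))) with hE
  set S : ℂ := ∑' n : ℕ, 1 / (t + n : ℂ) ^ 2 with hS
  have hSs : Summable (fun n : ℕ => 1 / (t + n : ℂ) ^ 2) := by
    have := Complex.ofRealCLM.summable (sq_summable ht)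
    refine this.congr fun n => ?_
    simp
  have hdig : DifferentiableOn ℂ (fun w : ℂ => Complex.digamma (t + w)) U := by
    intro w hw
    have hw' : -(t/2) < w.re := hw
    have hr : 0 < (t + w : ℂ).re := by simp; linarith
    have han : AnalyticAt ℂ Complex.Gamma (t + w) := by
      have hop : IsOpen {z : ℂ | 0 < z.re} := isOpen_lt continuous_const Complex.continuous_re
      refine DifferentiableOn.analyticAt (s := {z : ℂ | 0 < z.re}) (fun z hz =>
        (Complex.differentiableAt_Gamma z (re_pos_ne_neg hz)).differentiableWithinAt) (hop.mem_nhds hr)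
    have h1 : DifferentiableAt ℂ Complex.digamma (t + w) :=
      han.deriv.differentiableAt.div han.differentiableAt (Complex.Gamma_ne_zero (re_pos_ne_neg hr))
    have h2 : DifferentiableAt ℂ (fun w : ℂ => (t + w : ℂ)) w := by fun_prop
    exact (DifferentiableAt.comp w h1 h2).differentiableWithinAt
  have hrhs : DifferentiableOn ℂ (fun w : ℂ => Complex.digamma t + w * S - w ^ 2 * E w) U := by
    refine DifferentiableOn.sub (by fun_prop) (DifferentiableOn.mul (by fun_prop) hEd)
  have hident := real_ident (U := U) (hdig.analyticOnNhd hopen) (hrhs.analyticOnNhd hopen)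
    (convex_halfSpace_re_gt _).isPreconnected (by simp [hU]; linarith) (by
      intro σ hσ
      have h1 := psr_sum ht (s := t + σ) (by linarith)
      have h2 : ((t:ℂ) + σ) = ((t + σ : ℝ) : ℂ) := by push_cast; rfl
      rw [h2, digamma_ofReal ht, digamma_ofReal (by linarith)]
      have h3 := (Complex.hasSum_ofReal.2 h1).tsum_eq
      have hmem : (σ:ℂ) ∈ U := by simp [hU]; linarith
      have hEs : Summable (fun n : ℕ => 1 / ((t + n : ℂ) ^ 2 * (σ + (t + n)))) :=
        Summable.of_norm_bounded ((sq_summable ht).mul_left (2 / t)) (fun n => hbound n _ hmem)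
      have h4 : (σ:ℂ) * S - (σ:ℂ) ^ 2 * E σ = ((psr (t + σ) - psr t : ℝ) : ℂ) := by
        rw [← h3, hS, hE]
        simp only
        rw [← tsum_mul_left, ← tsum_mul_left, ← (hSs.mul_left _).tsum_sub (hEs.mul_left _)]
        refine tsum_congr fun n => ?_
        have e1 := hne2 n
        have e2 := hne n _ hmem
        push_cast
        rw [show (t:ℂ) + σ + n = σ + (t + n) by ring]
        field_simp
        ring
      rw [add_sub_assoc, h4]
      push_cast; ring)
  have h0U : (0:ℂ) ∈ U := by simp [hU]; linarith
  have hS' : deriv Complex.digamma t = S := by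
    have h1 : deriv (fun w : ℂ => Complex.digamma (t + w)) 0 = deriv Complex.digamma t := by
      rw [deriv_comp_const_add]; simp
    rw [← h1]
    have h2 := (hident.eventuallyEq_of_mem (hopen.mem_nhds h0U)).deriv_eq
    rw [h2]
    have h3 : HasDerivAt E (deriv E 0) 0 := (hEd.differentiableAt (hopen.mem_nhds h0U)).hasDerivAt
    have h4 : HasDerivAt (fun w : ℂ => Complex.digamma t + w * S - w ^ 2 * E w)
        (1 * S - ((2 : ℕ) * (0:ℂ) ^ (2 - 1) * E 0 + 0 ^ 2 * deriv E 0)) 0 := by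
      refine HasDerivAt.fun_sub ?_ (HasDerivAt.fun_mul (hasDerivAt_pow 2 0) h3)
      exact ((hasDerivAt_id (0:ℂ)).mul_const S).const_add _
    rw [h4.deriv]
    simp
  intro w hw
  rw [hS']
  exact hident hw

end

end

section
open MeasureTheory Filter Topology
section

/-- continuous with exponential bound on the positive half line -/
def ExpB (V : ℝ) (F : ℝ → ℂ) : Prop :=
  ContinuousOn F (Set.Ioi 0) ∧ ∃ C : ℝ, ∀ u : ℝ, 0 < u → ‖F u‖ ≤ C * Real.exp (V * u)

/-- Laplace transform -/
noncomputable def lap (F : ℝ → ℂ) (w : ℂ) : ℂ := ∫ u in Set.Ioi (0:ℝ), Complex.exp (-w * u) * F u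

lemma norm_cexp_mul (w : ℂ) (u : ℝ) : ‖Complex.exp (-w * u)‖ = Real.exp (-w.re * u) := by
  rw [Complex.norm_exp]; simp

lemma ExpB.integrable {V : ℝ} {F : ℝ → ℂ} (hF : ExpB V F) {w : ℂ} (hw : V < w.re) :
    IntegrableOn (fun u : ℝ => Complex.exp (-w * u) * F u) (Set.Ioi 0) := by
  obtain ⟨hc, C, hC⟩ := hF
  have h1 : IntegrableOn (fun u : ℝ => C * Real.exp ((V - w.re) * u)) (Set.Ioi 0) :=
    (integrableOn_exp_mul_Ioi (by linarith) 0).const_mul C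
  refine Integrable.mono' h1 ?_ ?_
  · refine ContinuousOn.aestronglyMeasurable (ContinuousOn.mul (by fun_prop) hc) measurableSet_Ioi
  · refine (ae_restrict_iff' measurableSet_Ioi).2 (ae_of_all _ fun u hu => ?_)
    rw [norm_mul, norm_cexp_mul]
    calc Real.exp (-w.re * u) * ‖F u‖ ≤ Real.exp (-w.re * u) * (C * Real.exp (V * u)) := by
          gcongr; exact hC u hu
      _ = C * (Real.exp (-w.re * u) * Real.exp (V * u)) := by ring
      _ = _ := by rw [← Real.exp_add]; ring_nf

lemma ExpB.mono {V V' : ℝ} {F : ℝ → ℂ} (hF : ExpB V F) (h : V ≤ V') : ExpB V' F := by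
  obtain ⟨hc, C, hC⟩ := hF
  refine ⟨hc, C, fun u hu => (hC u hu).trans ?_⟩
  have hC0 : 0 ≤ C := by
    have := (norm_nonneg _).trans (hC 1 one_pos)
    exact nonneg_of_mul_nonneg_left this (Real.exp_pos _)
  gcongr

lemma ExpB.add {V : ℝ} {F G : ℝ → ℂ} (hF : ExpB V F) (hG : ExpB V G) : ExpB V (fun u => F u + G u) := by
  obtain ⟨hc, C, hC⟩ := hF
  obtain ⟨hc', C', hC'⟩ := hG
  refine ⟨hc.add hc', C + C', fun u hu => (norm_add_le _ _).trans ?_⟩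
  rw [add_mul]
  exact add_le_add (hC u hu) (hC' u hu)

lemma ExpB.const_mul {V : ℝ} {F : ℝ → ℂ} (hF : ExpB V F) (c : ℂ) : ExpB V (fun u => c * F u) := by
  obtain ⟨hc, C, hC⟩ := hF
  refine ⟨continuousOn_const.mul hc, ‖c‖ * C, fun u hu => ?_⟩
  rw [norm_mul, mul_assoc]
  exact mul_le_mul_of_nonneg_left (hC u hu) (norm_nonneg _)

lemma lap_add {V : ℝ} {F G : ℝ → ℂ} (hF : ExpB V F) (hG : ExpB V G) {w : ℂ} (hw : V < w.re) :
    lap (fun u => F u + G u) w = lap F w + lap G w := by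
  simp only [lap, mul_add]
  exact integral_add (hF.integrable hw) (hG.integrable hw)

lemma lap_const_mul {F : ℝ → ℂ} (c : ℂ) (w : ℂ) :
    lap (fun u => c * F u) w = c * lap F w := by
  simp only [lap]
  rw [← integral_const_mul]
  congr 1; funext u; ring

lemma ExpB.tsum {ι : Type*} {V : ℝ} {F : ι → ℝ → ℂ} {B : ι → ℝ}
    (hc : ∀ i, ContinuousOn (F i) (Set.Ioi 0)) (hB : Summable B)
    (hb : ∀ i (u : ℝ), 0 < u → ‖F i u‖ ≤ B i * Real.exp (V * u)) :
    ExpB V (fun u => ∑' i, F i u) := by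
  have hB0 : ∀ i, 0 ≤ B i := fun i =>
    nonneg_of_mul_nonneg_left ((norm_nonneg _).trans (hb i 1 one_pos)) (Real.exp_pos _)
  refine ⟨fun x hx => ContinuousAt.continuousWithinAt ?_, ∑' i, B i, fun u hu => ?_⟩
  · have hx' : 0 < x := hx
    have h1 : ContinuousOn (fun u => ∑' i, F i u) (Set.Ioo 0 (x + 1)) := by
      refine continuousOn_tsum (u := fun i => B i * Real.exp (|V| * (x + 1)))
        (fun i => (hc i).mono Set.Ioo_subset_Ioi_self) (hB.mul_right _) (fun i u hu => (hb i u hu.1).trans ?_)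
      refine mul_le_mul_of_nonneg_left (Real.exp_le_exp.2 ?_) (hB0 i)
      calc V * u ≤ |V| * u := mul_le_mul_of_nonneg_right (le_abs_self V) hu.1.le
        _ ≤ _ := mul_le_mul_of_nonneg_left hu.2.le (abs_nonneg V)
    exact h1.continuousAt (Ioo_mem_nhds hx' (by linarith))
  · rw [← tsum_mul_right]
    have hs : Summable fun i => ‖F i u‖ := Summable.of_nonneg_of_le (fun _ => norm_nonneg _)
      (fun i => hb i u hu) (hB.mul_right _)
    exact (norm_tsum_le_tsum_norm hs).trans (hs.tsum_le_tsum (fun i => hb i u hu) (hB.mul_right _))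

lemma lap_tsum {ι : Type*} {V : ℝ} {F : ι → ℝ → ℂ} {B : ι → ℝ}
    (hc : ∀ i, ContinuousOn (F i) (Set.Ioi 0)) (hB : Summable B)
    (hb : ∀ i (u : ℝ), 0 < u → ‖F i u‖ ≤ B i * Real.exp (V * u)) {w : ℂ} (hw : V < w.re) :
    lap (fun u => ∑' i, F i u) w = ∑' i, lap (F i) w := by
  have hB0 : ∀ i, 0 ≤ B i := fun i =>
    nonneg_of_mul_nonneg_left ((norm_nonneg _).trans (hb i 1 one_pos)) (Real.exp_pos _)
  set S := Function.support B with hS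
  have hcount : S.Countable := hB.countable_support
  haveI : Countable S := hcount.to_subtype
  have hz : ∀ i ∉ S, ∀ u : ℝ, 0 < u → F i u = 0 := by
    intro i hi u hu
    rw [Function.mem_support, not_not] at hi
    have := hb i u hu
    rw [hi, zero_mul] at this
    exact norm_le_zero_iff.1 this
  have hEi : ∀ i, ExpB V (F i) := fun i => ⟨hc i, B i, hb i⟩
  have hintg : ∫ u in Set.Ioi (0:ℝ), Real.exp ((V - w.re) * u) = (w.re - V)⁻¹ := by
    rw [integral_exp_mul_Ioi (by linarith)]
    simp only [mul_zero, Real.exp_zero]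
    rw [← neg_sub, neg_div_neg_eq, one_div]
  have hsum : Summable fun i : S => ∫ u in Set.Ioi (0:ℝ), ‖Complex.exp (-w * u) * F i.1 u‖ := by
    refine Summable.of_nonneg_of_le (fun i => integral_nonneg fun u => norm_nonneg _) (fun i => ?_)
      ((hB.mul_right (w.re - V)⁻¹).comp_injective (Subtype.val_injective (p := (· ∈ S))))
    simp only [Function.comp]
    rw [← hintg, ← integral_const_mul]
    refine setIntegral_mono_on ((hEi i.1).integrable hw).norm
      ((integrableOn_exp_mul_Ioi (by linarith) 0).const_mul _) measurableSet_Ioi fun u hu => ?_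
    rw [norm_mul, norm_cexp_mul]
    calc Real.exp (-w.re * u) * ‖F i.1 u‖ ≤ Real.exp (-w.re * u) * (B i.1 * Real.exp (V * u)) := by
          gcongr; exact hb i.1 u hu
      _ = B i.1 * (Real.exp (-w.re * u) * Real.exp (V * u)) := by ring
      _ = _ := by rw [← Real.exp_add]; ring_nf
  have h1 := hasSum_integral_of_summable_integral_norm (fun i : S => (hEi i.1).integrable hw) hsum
  have h2 : ∑' i, lap (F i) w = ∑' i : S, lap (F i.1) w := by
    refine (tsum_subtype_eq_of_support_subset (f := fun i => lap (F i) w) (s := S) ?_).symm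
    intro i hi
    by_contra hn
    apply hi
    simp only [lap]
    rw [setIntegral_congr_fun (g := fun _ => (0:ℂ)) measurableSet_Ioi]
    · simp
    · intro u hu
      simp only
      rw [hz i hn u hu, mul_zero]
  rw [h2]
  have h3 : ∑' i : S, lap (F i.1) w = _ := h1.tsum_eq
  rw [h3, lap]
  refine setIntegral_congr_fun measurableSet_Ioi fun u hu => ?_
  rw [tsum_mul_left]
  congr 1
  refine (tsum_subtype_eq_of_support_subset (f := fun i => F i u) (s := S) ?_).symm
  intro i hi
  by_contra hn
  exact hi (hz i hn u hu)

lemma lap_exp {a w : ℂ} (h : 0 < (w + a).re) : lap (fun u => Complex.exp (-a * u)) w = 1 / (w + a) := by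
  have h1 := integral_exp_mul_complex_Ioi (a := -(w + a)) (by rw [Complex.neg_re]; linarith) 0
  rw [lap]
  have h2 : ∀ u : ℝ, Complex.exp (-w * u) * Complex.exp (-a * u) = Complex.exp (-(w + a) * u) := by
    intro u; rw [← Complex.exp_add]; ring_nf
  simp only [h2, h1]
  rw [Complex.ofReal_zero, mul_zero, Complex.exp_zero, neg_div_neg_eq]

lemma tendsto_pow_cexp {w : ℂ} (hw : 0 < w.re) (k : ℕ) :
    Tendsto (fun u : ℝ => (u:ℂ) ^ k * Complex.exp (-w * u)) atTop (𝓝 0) := by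
  rw [tendsto_zero_iff_norm_tendsto_zero]
  have := tendsto_rpow_mul_exp_neg_mul_atTop_nhds_zero k w.re hw
  refine this.congr' ?_
  filter_upwards [eventually_gt_atTop 0] with u hu
  rw [norm_mul, norm_cexp_mul, norm_pow, Complex.norm_real, Real.norm_of_nonneg hu.le, Real.rpow_natCast]

lemma exp_hasDeriv (w : ℂ) (u : ℝ) : HasDerivAt (fun u : ℝ => Complex.exp (-w * u)) (-w * Complex.exp (-w * u)) u := by
  have h1 : HasDerivAt (fun u : ℝ => -w * (u:ℂ)) (-w) u := by
    simpa using (Complex.ofRealCLM.hasDerivAt (x := u)).const_mul (-w)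
  exact h1.cexp.congr_deriv (by ring)

lemma expB_pos {c : ℝ} (hc : 0 ≤ c) : ∀ u : ℝ, 0 < u → ‖((max (u - c) 0 : ℝ) : ℂ)‖ ≤ Real.exp (-2 * c) * Real.exp (2 * u) := by
  intro u hu
  rw [← Real.exp_add, Complex.norm_real, Real.norm_of_nonneg (le_max_right _ _)]
  refine max_le ?_ (Real.exp_pos _).le
  rcases le_total (u - c) 0 with h | h
  · exact h.trans (Real.exp_pos _).le
  · have := Real.add_one_le_exp (-2 * c + 2 * u)
    linarith

lemma lap_pos {c : ℝ} (hc : 0 ≤ c) {w : ℂ} (hw : 2 < w.re) :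
    lap (fun u => ((max (u - c) 0 : ℝ) : ℂ)) w = Complex.exp (-w * c) / w ^ 2 := by
  have hE : ExpB 2 (fun u => ((max (u - c) 0 : ℝ) : ℂ)) := ⟨by fun_prop, _, expB_pos hc⟩
  have hI := hE.integrable hw
  have hw0 : w ≠ 0 := by rintro rfl; norm_num at hw
  rw [lap]
  have h1 : ∫ u in Set.Ioi (0:ℝ), Complex.exp (-w * u) * ((max (u - c) 0 : ℝ) : ℂ) =
      ∫ u in Set.Ioi c, Complex.exp (-w * u) * ((max (u - c) 0 : ℝ) : ℂ) := by
    refine (setIntegral_eq_of_subset_of_forall_diff_eq_zero measurableSet_Ioi (Set.Ioi_subset_Ioi hc) ?_)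
    rintro u ⟨hu, hu2⟩
    have : u ≤ c := by simpa using hu2
    rw [max_eq_right (by linarith)]
    simp
  have h2 : ∫ u in Set.Ioi c, Complex.exp (-w * u) * ((max (u - c) 0 : ℝ) : ℂ) =
      ∫ u in Set.Ioi c, Complex.exp (-w * u) * (u - c) := by
    refine setIntegral_congr_fun measurableSet_Ioi fun u hu => ?_
    have : c < u := hu
    rw [max_eq_left (by linarith)]
    push_cast; rfl
  have hI2 : IntegrableOn (fun u : ℝ => Complex.exp (-w * u) * (u - c)) (Set.Ioi c) := by
    refine (hI.mono_set (Set.Ioi_subset_Ioi hc)).congr_fun (fun u hu => ?_) measurableSet_Ioi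
    have : c < u := hu
    simp only
    rw [max_eq_left (by linarith)]
    push_cast; rfl
  have hd : ∀ u : ℝ, HasDerivAt (fun u : ℝ => -(Complex.exp (-w * u) * ((u - c) / w + 1 / w ^ 2)))
      (Complex.exp (-w * u) * (u - c)) u := by
    intro u
    have h3 : HasDerivAt (fun u : ℝ => ((u:ℂ) - c) / w + 1 / w ^ 2) (1 / w) u :=
      (((Complex.ofRealCLM.hasDerivAt (x := u)).sub_const (c:ℂ)).div_const w).add_const _ |>.congr_deriv (by simp)
    refine ((exp_hasDeriv w u).fun_mul h3).neg.congr_deriv ?_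
    field_simp
    ring
  rw [h1, h2, integral_Ioi_of_hasDerivAt_of_tendsto (m := 0) (hd c).continuousAt.continuousWithinAt
    (fun u _ => hd u) hI2 ?_]
  · simp; ring
  · have a0 := (tendsto_pow_cexp (by linarith : 0 < w.re) 0)
    have a1 := (tendsto_pow_cexp (by linarith : 0 < w.re) 1)
    have := (a1.mul_const (-(1 / w))).add (a0.mul_const (c / w - 1 / w ^ 2))
    simp only [zero_mul, add_zero] at this
    refine this.congr fun u => ?_
    ring

lemma lap_sq {w : ℂ} (hw : 2 < w.re) :
    ExpB 2 (fun u : ℝ => (u:ℂ) ^ 2 / 2) ∧ lap (fun u => (u:ℂ) ^ 2 / 2) w = 1 / w ^ 3 := by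
  have hE : ExpB 2 (fun u : ℝ => (u:ℂ) ^ 2 / 2) := by
    refine ⟨by fun_prop, 1, fun u hu => ?_⟩
    rw [norm_div, norm_pow, Complex.norm_real, Real.norm_of_nonneg hu.le]
    have := Real.quadratic_le_exp_of_nonneg (x := 2 * u) (by linarith)
    simp only [Complex.norm_ofNat]
    nlinarith
  refine ⟨hE, ?_⟩
  have hw0 : w ≠ 0 := by rintro rfl; norm_num at hw
  have hd : ∀ u : ℝ, HasDerivAt (fun u : ℝ => -(Complex.exp (-w * u) * ((u:ℂ) ^ 2 / 2 / w + u / w ^ 2 + 1 / w ^ 3)))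
      (Complex.exp (-w * u) * ((u:ℂ) ^ 2 / 2)) u := by
    intro u
    have h0 : HasDerivAt (fun u : ℝ => (u:ℂ)) 1 u := (Complex.ofRealCLM.hasDerivAt (x := u))
    have h3 : HasDerivAt (fun u : ℝ => (u:ℂ) ^ 2 / 2 / w + u / w ^ 2 + 1 / w ^ 3)
        ((2:ℕ) * (u:ℂ) ^ (2 - 1) * 1 / 2 / w + 1 / w ^ 2) u :=
      ((((h0.fun_pow 2).div_const 2).div_const w).fun_add (h0.div_const (w ^ 2))).add_const _
    refine ((exp_hasDeriv w u).fun_mul h3).neg.congr_deriv ?_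
    field_simp
    push_cast
    ring
  rw [lap, integral_Ioi_of_hasDerivAt_of_tendsto (m := 0) (hd 0).continuousAt.continuousWithinAt
    (fun u _ => hd u) (hE.integrable hw) ?_]
  · simp
  · have a0 := (tendsto_pow_cexp (by linarith : 0 < w.re) 0)
    have a1 := (tendsto_pow_cexp (by linarith : 0 < w.re) 1)
    have a2 := (tendsto_pow_cexp (by linarith : 0 < w.re) 2)
    have := ((a2.mul_const (-(1 / 2 / w))).add (a1.mul_const (-(1 / w ^ 2)))).add (a0.mul_const (-(1 / w ^ 3)))
    simp only [zero_mul, add_zero] at this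
    refine this.congr fun u => ?_
    ring

lemma lap_unique {V W : ℝ} (hVW : V < W) {F : ℝ → ℂ} (hF : ExpB V F)
    (h : ∀ w : ℂ, w.re = W → lap F w = 0) {u : ℝ} (hu : 0 < u) : F u = 0 := by
  set G : ℝ → ℂ := (Set.Ioi (0:ℝ)).indicator (fun u => Complex.exp (-(W:ℂ) * u) * F u) with hG
  have hGi : Integrable G := (hF.integrable (w := W) (by simpa using hVW)).integrable_indicator measurableSet_Ioi
  have hFT : FourierTransform.fourier G = 0 := by
    funext y
    rw [Real.fourier_real_eq_integral_exp_smul]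
    have := h (W + 2 * Real.pi * y * Complex.I) (by simp)
    rw [lap, ← integral_indicator measurableSet_Ioi] at this
    rw [Pi.zero_apply, ← this]
    congr 1
    funext v
    simp only [hG, Set.indicator]
    split_ifs
    · rw [smul_eq_mul, ← mul_assoc, ← Complex.exp_add]
      congr 2
      push_cast
      ring
    · simp
  have hcont : ContinuousAt G u := by
    have h1 : ContinuousAt (fun u : ℝ => Complex.exp (-(W:ℂ) * u) * F u) u :=
      ContinuousAt.mul (by fun_prop) (hF.1.continuousAt (Ioi_mem_nhds hu))
    refine h1.congr ?_
    filter_upwards [Ioi_mem_nhds hu] with v hv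
    rw [hG, Set.indicator_of_mem hv]
  have h2 := hGi.fourierInv_fourier_eq (by rw [hFT]; exact integrable_zero _ _ _) hcont
  rw [hFT] at h2
  have h3 : G u = 0 := by
    rw [← h2, Real.fourierInv_eq']
    simp
  rw [hG, Set.indicator_of_mem (Set.mem_Ioi.2 hu)] at h3
  exact (mul_eq_zero.1 h3).resolve_left (Complex.exp_ne_zero _)

end

end

section
open MeasureTheory Filter Topology
section

/-- second order Taylor representation at `t` with Laplace remainder -/
structure LRep (t : ℝ) (L : ℂ → ℂ) (l1 : ℂ) (E : ℝ → ℂ) : Prop where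
  der : HasDerivAt L l1 t
  bd : ExpB 2 E
  eq : ∀ w : ℂ, 2 < w.re → L (t + w) = L t + w * l1 + w ^ 2 * lap E w

lemma LRep.add {t : ℝ} {L L' : ℂ → ℂ} {l l' : ℂ} {E E' : ℝ → ℂ} (h : LRep t L l E) (h' : LRep t L' l' E') :
    LRep t (fun s => L s + L' s) (l + l') (fun u => E u + E' u) := by
  refine ⟨h.der.fun_add h'.der, h.bd.add h'.bd, fun w hw => ?_⟩
  rw [lap_add h.bd h'.bd hw]
  rw [h.eq w hw, h'.eq w hw]
  ring

lemma LRep.const_mul {t : ℝ} {L : ℂ → ℂ} {l : ℂ} {E : ℝ → ℂ} (h : LRep t L l E) (c : ℂ) :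
    LRep t (fun s => c * L s) (c * l) (fun u => c * E u) := by
  refine ⟨h.der.const_mul c, h.bd.const_mul c, fun w hw => ?_⟩
  rw [lap_const_mul]
  rw [h.eq w hw]
  ring

lemma LRep.congr {t : ℝ} {L L' : ℂ → ℂ} {l : ℂ} {E : ℝ → ℂ} (h : LRep t L l E) (h1 : L' =ᶠ[𝓝 (t:ℂ)] L)
    (h2 : ∀ w : ℂ, 2 < w.re → L' (t + w) = L (t + w)) : LRep t L' l E := by
  refine ⟨h.der.congr_of_eventuallyEq h1, h.bd, fun w hw => ?_⟩
  rw [h2 w hw, h1.eq_of_nhds, h.eq w hw]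

lemma rep_const (t : ℝ) (c : ℂ) : LRep t (fun _ => c) 0 (fun _ => 0) := by
  refine ⟨hasDerivAt_const _ _, ⟨by fun_prop, 0, fun u _ => by simp⟩, fun w hw => ?_⟩
  simp [lap]

lemma exp_series {ι : Type*} (c a : ι → ℂ) (hc : Summable fun i => ‖c i‖) (ha : ∀ i, c i ≠ 0 → -2 ≤ (a i).re) :
    ExpB 2 (fun u => ∑' i, c i * Complex.exp (-(a i) * u)) ∧ ∀ w : ℂ, 2 < w.re →
      lap (fun u => ∑' i, c i * Complex.exp (-(a i) * u)) w = ∑' i, c i / (w + a i) := by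
  have hb : ∀ i (u : ℝ), 0 < u → ‖c i * Complex.exp (-(a i) * u)‖ ≤ ‖c i‖ * Real.exp (2 * u) := by
    intro i u hu
    by_cases h : c i = 0
    · simp [h]
    rw [norm_mul, norm_cexp_mul]
    have := ha i h
    gcongr
    linarith
  have hcont : ∀ i, ContinuousOn (fun u : ℝ => c i * Complex.exp (-(a i) * u)) (Set.Ioi 0) :=
    fun i => by fun_prop
  refine ⟨ExpB.tsum hcont hc hb, fun w hw => ?_⟩
  rw [lap_tsum hcont hc hb hw]
  refine tsum_congr fun i => ?_
  rw [lap_const_mul]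
  by_cases h : c i = 0
  · simp [h]
  rw [lap_exp (by have := ha i h; rw [Complex.add_re]; linarith)]
  ring

lemma exp_single (a : ℂ) (ha : -2 ≤ a.re) :
    ExpB 2 (fun u : ℝ => Complex.exp (-a * u)) := by
  refine ⟨by fun_prop, 1, fun u hu => ?_⟩
  rw [norm_cexp_mul, one_mul]
  gcongr
  linarith

lemma rep_inv {t : ℝ} (ht : 0 < t) : LRep t (fun s => 1 / s) (-(1 / (t:ℂ) ^ 2))
    (fun u => 1 / (t:ℂ) ^ 2 * Complex.exp (-(t:ℂ) * u)) := by
  have ht0 : (t:ℂ) ≠ 0 := by exact_mod_cast ht.ne'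
  refine ⟨?_, (exp_single t (by rw [Complex.ofReal_re]; linarith)).const_mul _, fun w hw => ?_⟩
  · have := hasDerivAt_inv ht0
    simp only [one_div]
    exact this
  · rw [lap_const_mul, lap_exp (by rw [Complex.add_re, Complex.ofReal_re]; linarith)]
    have : (t:ℂ) + w ≠ 0 := by
      intro h
      have := congrArg Complex.re h
      simp at this; linarith
    have : w + (t:ℂ) ≠ 0 := by rwa [add_comm]
    field_simp
    ring

lemma digamma_hasDeriv {s : ℂ} (hs : 0 < s.re) : HasDerivAt Complex.digamma (deriv Complex.digamma s) s := by
  have hU : IsOpen {z : ℂ | 0 < z.re} := isOpen_lt continuous_const Complex.continuous_re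
  have h1 : DifferentiableOn ℂ Complex.Gamma {z : ℂ | 0 < z.re} := fun z hz =>
    (Complex.differentiableAt_Gamma z (re_pos_ne_neg hz)).differentiableWithinAt
  have h2 : AnalyticAt ℂ Complex.Gamma s := (h1.analyticOnNhd hU) s hs
  have h3 : DifferentiableAt ℂ Complex.digamma s := by
    have : Complex.digamma = fun z => deriv Complex.Gamma z / Complex.Gamma z := by
      funext z; rfl
    rw [this]
    exact h2.deriv.differentiableAt.div h2.differentiableAt (Complex.Gamma_ne_zero (re_pos_ne_neg hs))
  exact h3.hasDerivAt

lemma rep_psi {t : ℝ} (ht : 0 < t) : LRep t Complex.digamma (deriv Complex.digamma t)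
    (fun u => ∑' n : ℕ, (-(1 / (t + n : ℂ) ^ 2)) * Complex.exp (-(t + n : ℂ) * u)) := by
  have hs := sq_summable ht
  obtain ⟨h1, h2⟩ := exp_series (fun n : ℕ => (-(1 / (t + n : ℂ) ^ 2))) (fun n : ℕ => (t + n : ℂ))
    (hs.congr fun n => by
      rw [norm_neg, norm_div, norm_pow, norm_one]
      rw [show (t + n : ℂ) = ((t + n : ℝ) : ℂ) by push_cast; rfl, Complex.norm_real,
        Real.norm_of_nonneg (by positivity)])
    (fun n _ => by
      have : 0 ≤ t + n := by positivity
      simp; linarith)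
  refine ⟨digamma_hasDeriv (by simpa using ht), h1, fun w hw => ?_⟩
  rw [h2 w hw, digamma_series ht w (by linarith), sub_eq_add_neg, ← mul_neg, ← tsum_neg]
  congr 2
  refine tsum_congr fun n => ?_
  rw [← div_div]; ring

lemma rep_psi_half {t : ℝ} (ht : 0 < t) : LRep t (fun s => Complex.digamma (s / 2)) (deriv Complex.digamma (t / 2) * (1 / 2))
    (fun u => ∑' n : ℕ, (-(2 / (t + 2 * n : ℂ) ^ 2)) * Complex.exp (-(t + 2 * n : ℂ) * u)) := by
  have ht2 : 0 < t / 2 := by linarith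
  have hs := sq_summable ht2
  have hpos : ∀ n : ℕ, (t + 2 * n : ℂ) = ((t + 2 * n : ℝ) : ℂ) := by intro n; push_cast; rfl
  obtain ⟨h1, h2⟩ := exp_series (fun n : ℕ => (-(2 / (t + 2 * n : ℂ) ^ 2))) (fun n : ℕ => (t + 2 * n : ℂ))
    ((hs.mul_left (1/2)).congr fun n => by
      rw [norm_neg, norm_div, norm_pow, hpos, Complex.norm_real,
        Real.norm_of_nonneg (by positivity), Complex.norm_ofNat]
      have : t + 2 * n ≠ 0 := by positivity
      have : t / 2 + n ≠ 0 := by positivity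
      field_simp
      )
    (fun n _ => by rw [hpos, Complex.ofReal_re]; have : 0 ≤ t + 2 * n := by positivity
                   linarith)
  refine ⟨?_, h1, fun w hw => ?_⟩
  · have := (digamma_hasDeriv (s := (t:ℂ) / 2) (by
      rw [show (t:ℂ) / 2 = ((t / 2 : ℝ) : ℂ) by push_cast; rfl, Complex.ofReal_re]; exact ht2))
    exact HasDerivAt.comp (t:ℂ) this ((hasDerivAt_id (t:ℂ)).div_const 2)
  · have h3 := digamma_series ht2 (w / 2) (by
      have : (w / 2).re = w.re / 2 := by simp
      rw [this]; linarith)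
    push_cast at h3
    rw [h2 w hw]
    rw [add_div, h3, sub_eq_add_neg]
    congr 1
    · ring
    · rw [← tsum_mul_left, ← tsum_mul_left, ← tsum_neg]
      refine tsum_congr fun n => ?_
      have a1 : (t + 2 * n : ℂ) ≠ 0 := by rw [hpos]; exact_mod_cast (by positivity : t + 2 * n ≠ 0)
      have a2 : w + (t + 2 * n : ℂ) ≠ 0 := by
        intro h
        have := congrArg Complex.re h
        rw [hpos] at this
        simp only [Complex.add_re, Complex.ofReal_re, Complex.zero_re] at this
        have : 0 ≤ t + 2 * n := by positivity
        linarith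
      have a3 : (t / 2 + n : ℂ) = (t + 2 * n) / 2 := by ring
      have a4 : w / 2 + ((t + 2 * n : ℂ) / 2) = (w + (t + 2 * n)) / 2 := by ring
      rw [a3, a4]
      field_simp

lemma ord_of {F g : ℂ → ℂ} {ρ : ℂ} {n : ℕ} (hF : AnalyticAt ℂ F ρ) (hg : AnalyticAt ℂ g ρ) (h0 : g ρ ≠ 0)
    (h : ∀ᶠ z in 𝓝 ρ, F z = (z - ρ) ^ n * g z) : analyticOrderNatAt F ρ = n := by
  have : analyticOrderAt F ρ = n := hF.analyticOrderAt_eq_natCast.2 ⟨g, hg, h0, by simpa using h⟩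
  rw [analyticOrderNatAt, this, ENat.toNat_coe]

lemma rep_X {X : ℂ → ℂ} (hX : Differentiable ℂ X) {t M : ℝ} (ht : 0 < t) (hM : 0 ≤ M) (hXt : X t ≠ 0)
    (hb : ∀ (R : ℝ) (s : ℂ), 1 ≤ R → ‖s‖ ≤ R → ‖X s‖ ≤ Real.exp (M * R ^ (3/2 : ℝ)))
    (hz : ∀ s : ℂ, 1 ≤ s.re → X s ≠ 0) :
    LRep t (logDeriv X) (deriv (logDeriv X) t)
      (fun u => ∑' z : ℂ, ((analyticOrderNatAt X (t + z) : ℂ) / z ^ 2) * Complex.exp (-(-z) * u)) := by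
  set f : ℂ → ℂ := fun z => X (t + z) / X t with hf
  have hfd : Differentiable ℂ f := by fun_prop
  have hf0 : f 0 = 1 := by simp [hf, hXt]
  have hXa : ∀ s, AnalyticAt ℂ X s := fun s => (hX.analyticAt s)
  have hlog : ∀ z, logDeriv f z = logDeriv X (t + z) := by
    intro z
    have h1 : HasDerivAt f (deriv X (t + z) / X t) z := by
      have := (hX (t + z)).hasDerivAt.comp_const_add (t:ℂ) z
      exact this.div_const _
    rw [logDeriv_apply, logDeriv_apply, h1.deriv, hf]
    field_simp
  have hord : ∀ z, analyticOrderNatAt f z = analyticOrderNatAt X (t + z) := by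
    intro z
    obtain ⟨g, hg, hg0, h⟩ := (hXa (t + z)).analyticOrderAt_ne_top.1 (entire_order_ne_top hX hXt (t + z))
    have hc : Tendsto (fun y : ℂ => (t:ℂ) + y) (𝓝 z) (𝓝 (t + z)) := (continuous_const.add continuous_id).tendsto z
    have hg' : AnalyticAt ℂ (fun y => g (t + y) / X t) z := by
      have h1 : AnalyticAt ℂ (fun y : ℂ => (t:ℂ) + y) z := by fun_prop
      exact (AnalyticAt.comp' hg h1).div analyticAt_const hXt
    refine ord_of (hfd.analyticAt z) hg' (div_ne_zero hg0 hXt) ?_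
    filter_upwards [hc.eventually h] with y hy
    rw [hf]
    simp only [hy, smul_eq_mul]
    rw [add_sub_add_left_eq_sub, mul_div_assoc]
  obtain ⟨M', hM', hb'⟩ : ∃ M' : ℝ, 0 < M' ∧ ∀ (R : ℝ) (z : ℂ), 1 ≤ R → ‖z‖ ≤ R → ‖f z‖ ≤ Real.exp (M' * R ^ (3/2 : ℝ)) := by
    refine ⟨M * (1 + t) ^ (3/2 : ℝ) + |Real.log ‖X t‖| + 1, by positivity, fun R z hR hzR => ?_⟩
    have h1 := hb ((1 + t) * R) (t + z) (by nlinarith) (by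
      refine (norm_add_le _ _).trans ?_
      rw [Complex.norm_real, Real.norm_of_nonneg ht.le]
      nlinarith)
    have h0 : 0 < ‖X t‖ := norm_pos_iff.2 hXt
    rw [hf]
    simp only
    rw [norm_div, div_le_iff₀ h0]
    refine h1.trans ?_
    have h2 : ‖X t‖ = Real.exp (Real.log ‖X t‖) := (Real.exp_log h0).symm
    rw [h2, ← Real.exp_add, Real.log_exp, Real.exp_le_exp, Real.mul_rpow (by linarith) (by linarith)]
    have h3 : 1 ≤ R ^ (3/2 : ℝ) := Real.one_le_rpow hR (by norm_num)
    have h4 := neg_abs_le (Real.log ‖X t‖)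
    have h5 := abs_nonneg (Real.log ‖X t‖)
    nlinarith
  have hm := had_main hfd hf0 hM' hb'
  have hsum := had_sum hfd hf0 hM' hb'
  have hfne : ∀ z, X (t + z) ≠ 0 → f z ≠ 0 := fun z h => div_ne_zero h hXt
  obtain ⟨h1, h2⟩ := exp_series (fun z : ℂ => ((analyticOrderNatAt X (t + z) : ℂ) / z ^ 2)) (fun z => -z)
    (hsum.congr fun z => by rw [hord, norm_div, norm_pow, Complex.norm_natCast])
    (fun z hz0 => by
      have hX0 : X (t + z) = 0 := by
        by_contra h
        apply hz0
        have := (order_zero_iff hX hXt (t + z)).2 h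
        simp [this]
      by_contra hre
      have : 1 ≤ (t + z : ℂ).re := by
        simp at hre ⊢
        linarith
      exact hz _ this hX0)
  have hder : HasDerivAt (logDeriv X) (deriv (logDeriv X) t) t := by
    have : logDeriv X = fun s => deriv X s / X s := by funext s; rfl
    refine DifferentiableAt.hasDerivAt ?_
    rw [this]
    exact (hXa t).deriv.differentiableAt.div (hXa t).differentiableAt hXt
  refine ⟨hder, h1, fun w hw => ?_⟩
  have hw' := hm w (hfne w (hz _ (by simp; linarith)))
  have hd0 : deriv (logDeriv f) 0 = deriv (logDeriv X) t := by
    have : logDeriv f = fun z => logDeriv X (t + z) := funext hlog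
    rw [this, deriv_comp_const_add, add_zero]
  rw [hlog, hlog, add_zero, hd0] at hw'
  rw [hw', h2 w hw]
  congr 2
  refine tsum_congr fun z => ?_
  rw [hord, div_div, sub_eq_add_neg]

lemma b_exists (t : ℝ) (ht : 0 < t) : ∃ b : ℝ → ℂ, ExpB 2 b ∧
    (∀ w : ℂ, 2 < w.re → lap b w = 1 / (w ^ 2 * (t + w - 1))) ∧ ∀ u : ℝ, 0 < u → 0 ≤ (b u).re := by
  by_cases h1 : t = 1
  · refine ⟨fun u => (u:ℂ) ^ 2 / 2, (lap_sq (w := 3) (by norm_num)).1, fun w hw => ?_, fun u hu => ?_⟩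
    · rw [(lap_sq hw).2, h1]
      have : w ≠ 0 := by rintro rfl; norm_num at hw
      congr 1
      push_cast; ring
    · have : (u:ℂ) ^ 2 / 2 = ((u ^ 2 / 2 : ℝ) : ℂ) := by push_cast; rfl
      simp only [this, Complex.ofReal_re]; positivity
  · have ht1 : (t:ℂ) - 1 ≠ 0 := by
      intro h; apply h1; exact_mod_cast sub_eq_zero.1 h
    have hA : ExpB 2 (fun u : ℝ => Complex.exp (-((t:ℂ) - 1) * u)) := exp_single _ (by simp; linarith)
    have hB : ExpB 2 (fun u : ℝ => Complex.exp (-(0:ℂ) * u)) := exp_single _ (by simp)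
    have hC : ExpB 2 (fun u : ℝ => ((max (u - 0) 0 : ℝ) : ℂ)) := ⟨by fun_prop, _, expB_pos le_rfl⟩
    refine ⟨_, ((hA.add (hB.const_mul (-1))).add (hC.const_mul ((t:ℂ) - 1))).const_mul (1 / ((t:ℂ) - 1) ^ 2),
      fun w hw => ?_, fun u hu => ?_⟩
    · have hw1 : 0 < (w + ((t:ℂ) - 1)).re := by simp; linarith
      rw [lap_const_mul, lap_add (hA.add (hB.const_mul (-1))) (hC.const_mul ((t:ℂ) - 1)) hw,
        lap_add hA (hB.const_mul (-1)) hw, lap_const_mul, lap_const_mul, lap_exp hw1, lap_exp (by simp; linarith),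
        lap_pos le_rfl hw]
      have a1 : w ≠ 0 := by rintro rfl; norm_num at hw
      have a2 : w + ((t:ℂ) - 1) ≠ 0 := by intro h; rw [h] at hw1; simp at hw1
      have a3 : (t:ℂ) + w - 1 = w + ((t:ℂ) - 1) := by ring
      rw [a3]
      simp only [Complex.ofReal_zero, mul_zero, Complex.exp_zero, add_zero]
      generalize (t:ℂ) - 1 = v at *
      field_simp
      ring
    · have := Real.add_one_le_exp (-((t - 1) * u))
      have h5 : (1 / ((t:ℂ) - 1) ^ 2 * (Complex.exp (-((t:ℂ) - 1) * u) + -1 * Complex.exp (-(0:ℂ) * u) + ((t:ℂ) - 1) * ((max (u - 0) 0 : ℝ) : ℂ)))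
        = ((1 / (t - 1) ^ 2 * (Real.exp (-((t - 1) * u)) - 1 + (t - 1) * u) : ℝ) : ℂ) := by
        rw [sub_zero, max_eq_left hu.le]
        push_cast
        simp only [neg_zero, zero_mul, Complex.exp_zero]
        ring_nf
      rw [h5, Complex.ofReal_re]
      exact mul_nonneg (by positivity) (by linarith)

end

end

section
open NumberField MeasureTheory Filter Topology ArithmeticFunction
section
variable {K : Type*} [Field K] [NumberField K]

lemma lap_f {t : ℝ} (ht : 0 < t) :
    ExpB 2 (fun u => ∑' q : PK K, ((pl q * (pn q : ℝ) ^ (-t) : ℝ) : ℂ) * ((max (u - Real.log (pn q)) 0 : ℝ) : ℂ)) ∧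
    ∀ w : ℂ, 2 < w.re → lap (fun u => ∑' q : PK K, ((pl q * (pn q : ℝ) ^ (-t) : ℝ) : ℂ) * ((max (u - Real.log (pn q)) 0 : ℝ) : ℂ)) w
      = Ds K (t + w) / w ^ 2 := by
  have hpos : ∀ q : PK K, (0:ℝ) < pn q := fun q => by have := pn_ge_two q; positivity
  have hlog : ∀ q : PK K, 0 ≤ Real.log (pn q) := fun q => Real.log_natCast_nonneg _
  have hc : ∀ q : PK K, ContinuousOn (fun u : ℝ => ((pl q * (pn q : ℝ) ^ (-t) : ℝ) : ℂ) * ((max (u - Real.log (pn q)) 0 : ℝ) : ℂ)) (Set.Ioi 0) :=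
    fun q => by fun_prop
  have hb : ∀ (q : PK K) (u : ℝ), 0 < u → ‖((pl q * (pn q : ℝ) ^ (-t) : ℝ) : ℂ) * ((max (u - Real.log (pn q)) 0 : ℝ) : ℂ)‖
      ≤ pl q * (pn q : ℝ) ^ (-(t + 2)) * Real.exp (2 * u) := by
    intro q u hu
    have h1 := expB_pos (hlog q) u hu
    have h2 : (pn q : ℝ) ^ (-(t + 2)) = (pn q : ℝ) ^ (-t) * Real.exp (-2 * Real.log (pn q)) := by
      rw [neg_add, Real.rpow_add (hpos q), Real.rpow_def_of_pos (hpos q) (-2), mul_comm (-2)]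
    have h3 : 0 ≤ pl q * (pn q : ℝ) ^ (-t) := mul_nonneg (pl_pos q).le (by positivity)
    rw [norm_mul, h2, Complex.norm_real, Real.norm_of_nonneg h3]
    calc _ ≤ pl q * (pn q : ℝ) ^ (-t) * (Real.exp (-2 * Real.log (pn q)) * Real.exp (2 * u)) := by gcongr
      _ = _ := by ring
  have hs : Summable fun q : PK K => pl q * (pn q : ℝ) ^ (-(t + 2)) := pk_summable (by linarith)
  refine ⟨ExpB.tsum hc hs hb, fun w hw => ?_⟩
  rw [lap_tsum hc hs hb hw, Ds, ← tsum_div_const]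
  refine tsum_congr fun q => ?_
  rw [lap_const_mul, lap_pos (hlog q) hw]
  have hn0 : (pn q : ℂ) ≠ 0 := by exact_mod_cast (hpos q).ne'
  have h5 : (pn q : ℂ) ^ (-(t + w)) = (((pn q : ℝ) ^ (-t) : ℝ) : ℂ) * Complex.exp (-w * (Real.log (pn q) : ℝ)) := by
    rw [neg_add, Complex.cpow_add _ _ hn0, Complex.ofReal_cpow (hpos q).le, Complex.cpow_def_of_ne_zero hn0 (-w),
      ← Complex.natCast_log, mul_comm (-w)]
    push_cast
    rfl
  rw [h5]
  push_cast
  ring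

theorem explicit_main (hs : ∀ σ : ℝ, 1 < σ → Summable fun I : {I : Ideal (𝓞 K) // I ≠ ⊥} => (Ideal.absNorm I.1 : ℝ) ^ (-σ))
    {H : ℂ → ℂ} (hH : ∀ s : ℂ, 1 < s.re → H s = Zs K s * (s - 1)) {t : ℝ} (ht : 0 < t) {l1 : ℂ} {E : ℝ → ℂ}
    (hR : LRep t (logDeriv H) l1 E) {u : ℝ} (hu : 0 < u) :
    -(logDeriv H t).re * u ≤ (∑' q : PK K, pl q * ((pn q : ℝ) ^ (-t) * max (u - Real.log (pn q)) 0)) + l1.re + (E u).re := by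
  obtain ⟨hf1, hf2⟩ := lap_f (K := K) ht
  obtain ⟨b, hb1, hb2, hb3⟩ := b_exists t ht
  have hB : ExpB 2 (fun u : ℝ => Complex.exp (-(0:ℂ) * u)) := exp_single _ (by simp)
  have hC : ExpB 2 (fun u : ℝ => ((max (u - 0) 0 : ℝ) : ℂ)) := ⟨by fun_prop, _, expB_pos le_rfl⟩
  have e1 := hf1.add (hb1.const_mul (-1))
  have e2 := e1.add (hC.const_mul (logDeriv H t))
  have e3 := e2.add (hB.const_mul l1)
  have e4 := e3.add hR.bd
  have key := lap_unique (W := 3) (by norm_num) e4 (fun w hw3 => ?_) hu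
  · have h1 := congrArg Complex.re key
    simp only [neg_zero, zero_mul, Complex.exp_zero, sub_zero, mul_one, neg_mul, one_mul, max_eq_left hu.le] at h1
    have h2 : (∑' q : PK K, ((pl q * (pn q : ℝ) ^ (-t) : ℝ) : ℂ) * ((max (u - Real.log (pn q)) 0 : ℝ) : ℂ))
        = ((∑' q : PK K, pl q * ((pn q : ℝ) ^ (-t) * max (u - Real.log (pn q)) 0) : ℝ) : ℂ) := by
      rw [Complex.ofReal_tsum]
      refine tsum_congr fun q => ?_
      rw [← Complex.ofReal_mul, mul_assoc]
    rw [h2] at h1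
    simp only [Complex.add_re, Complex.neg_re, Complex.ofReal_re, Complex.re_mul_ofReal, Complex.zero_re] at h1
    have := hb3 u hu
    linarith
  · have hw : 2 < w.re := by linarith
    rw [lap_add e3 hR.bd hw, lap_add e2 (hB.const_mul l1) hw, lap_add e1 (hC.const_mul (logDeriv H t)) hw,
      lap_add hf1 (hb1.const_mul (-1)) hw, lap_const_mul, lap_const_mul, lap_const_mul, hf2 w hw, hb2 w hw,
      lap_pos le_rfl hw, lap_exp (by simp; linarith)]
    have h3 := hR.eq w hw
    rw [H_logDeriv hs hH (s := t + w) (by simp; linarith)] at h3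
    have a1 : w ≠ 0 := by rintro rfl; norm_num at hw
    have a2 : (t:ℂ) + w - 1 ≠ 0 := by
      intro h
      have := congrArg Complex.re h
      simp at this; linarith
    have h4 : lap E w = (-Ds K (t + w) + 1 / (t + w - 1) - logDeriv H t - w * l1) / w ^ 2 := by
      rw [h3]; field_simp; ring
    rw [h4]
    simp only [Complex.ofReal_zero, mul_zero, Complex.exp_zero, add_zero]
    field_simp
    ring

lemma f_bound {t x : ℝ} (hx : 2 ≤ x) :
    (∑' q : PK K, pl q * ((pn q : ℝ) ^ (-t) * max (Real.log x - Real.log (pn q)) 0)) ≤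
      Module.finrank ℚ K * ∑ n ∈ Finset.Icc 2 ⌊x⌋₊, vonMangoldt n / (n:ℝ) ^ t * Real.log (x / n) := by
  have hfin : ∀ n ∉ Finset.Icc 2 ⌊x⌋₊, vonMangoldt n * ((n : ℝ) ^ (-t) * max (Real.log x - Real.log n) 0) = 0 := by
    intro n hn
    rw [Finset.mem_Icc, not_and_or, not_le, not_le] at hn
    rcases hn with hn | hn
    · interval_cases n
      · simp
      · simp
    · have h1 : x < n := (Nat.floor_lt (by linarith)).1 hn
      have : Real.log x ≤ Real.log n := Real.log_le_log (by linarith) h1.le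
      rw [max_eq_right (by linarith)]; simp
  have := pl_tsum_le (K := K) (fun n => (n : ℝ) ^ (-t) * max (Real.log x - Real.log n) 0)
    (fun n => mul_nonneg (by positivity) (le_max_right _ _))
    (summable_of_ne_finset_zero hfin)
  rw [tsum_eq_sum hfin] at this
  refine this.trans (le_of_eq ?_)
  congr 1
  refine Finset.sum_congr rfl fun n hn => ?_
  rw [Finset.mem_Icc] at hn
  have hn0 : (0:ℝ) < n := by have := hn.1; positivity
  have h1 : (n:ℝ) ≤ x := (Nat.le_floor_iff (by linarith)).1 hn.2
  have : Real.log n ≤ Real.log x := Real.log_le_log hn0 h1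
  rw [max_eq_left (by linarith), Real.log_div (by linarith) hn0.ne', Real.rpow_neg hn0.le]
  ring

end

end

section
open NumberField MeasureTheory Filter Topology
section
variable {K : Type*} [Field K] [NumberField K]

/-- gamma factor -/
noncomputable def Gm (κ A : ℝ) (r1 r2 : ℕ) (s : ℂ) : ℂ :=
  κ * (A:ℂ) ^ s * s * (Complex.Gamma (s / 2) ^ r1 * Complex.Gamma s ^ r2)

lemma half_re (s : ℂ) : (s / 2).re = s.re / 2 := by simp

lemma Gm_ne {κ A : ℝ} (hκ : 0 < κ) (hA : 0 < A) (r1 r2 : ℕ) {s : ℂ} (hs : 0 < s.re) : Gm κ A r1 r2 s ≠ 0 := by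
  have h1 := Complex.Gamma_ne_zero (re_pos_ne_neg hs)
  have h2 := Complex.Gamma_ne_zero (re_pos_ne_neg (s := s / 2) (by rw [half_re]; linarith))
  have h3 : s ≠ 0 := by rintro rfl; simp at hs
  have h4 : (A:ℂ) ^ s ≠ 0 := by
    rw [Ne, Complex.cpow_eq_zero_iff, not_and_or]; left; exact_mod_cast hA.ne'
  have h5 : (κ:ℂ) ≠ 0 := by exact_mod_cast hκ.ne'
  exact mul_ne_zero (mul_ne_zero (mul_ne_zero h5 h4) h3) (mul_ne_zero (pow_ne_zero _ h2) (pow_ne_zero _ h1))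

lemma Gm_diff {κ A : ℝ} (hA : 0 < A) (r1 r2 : ℕ) {s : ℂ} (hs : 0 < s.re) : DifferentiableAt ℂ (Gm κ A r1 r2) s := by
  have h1 := Complex.differentiableAt_Gamma s (re_pos_ne_neg hs)
  have h2 : DifferentiableAt ℂ (fun s : ℂ => Complex.Gamma (s / 2)) s :=
    DifferentiableAt.comp s (Complex.differentiableAt_Gamma (s / 2) (re_pos_ne_neg (by rw [half_re]; linarith))) (by fun_prop)
  have h3 : DifferentiableAt ℂ (fun s : ℂ => (A:ℂ) ^ s) s :=
    differentiableAt_id.const_cpow (Or.inl (by exact_mod_cast hA.ne'))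
  have : Gm κ A r1 r2 = fun s : ℂ => κ * (A:ℂ) ^ s * s * (Complex.Gamma (s / 2) ^ r1 * Complex.Gamma s ^ r2) := rfl
  rw [this]
  fun_prop

lemma Gm_logDeriv {κ A : ℝ} (hκ : 0 < κ) (hA : 0 < A) (r1 r2 : ℕ) {s : ℂ} (hs : 0 < s.re) :
    logDeriv (Gm κ A r1 r2) s = Complex.log A + 1 / s + (r1 / 2 * Complex.digamma (s / 2) + r2 * Complex.digamma s) := by
  have d1 := Complex.differentiableAt_Gamma s (re_pos_ne_neg hs)
  have hs2 : 0 < (s / 2).re := by rw [half_re]; linarith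
  have d2' := Complex.differentiableAt_Gamma (s / 2) (re_pos_ne_neg hs2)
  have d2 : HasDerivAt (fun s : ℂ => Complex.Gamma (s / 2)) (deriv Complex.Gamma (s / 2) * (1 / 2)) s :=
    HasDerivAt.comp s d2'.hasDerivAt ((hasDerivAt_id s).div_const 2)
  have d3 : HasDerivAt (fun s : ℂ => (A:ℂ) ^ s) ((A:ℂ) ^ s * Complex.log A * 1) s :=
    (hasDerivAt_id s).const_cpow (Or.inl (by exact_mod_cast hA.ne'))
  have n1 := Complex.Gamma_ne_zero (re_pos_ne_neg hs)
  have n2 := Complex.Gamma_ne_zero (re_pos_ne_neg hs2)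
  have n3 : s ≠ 0 := by rintro rfl; simp at hs
  have n4 : (A:ℂ) ^ s ≠ 0 := by
    rw [Ne, Complex.cpow_eq_zero_iff, not_and_or]; left; exact_mod_cast hA.ne'
  have n5 : (κ:ℂ) ≠ 0 := by exact_mod_cast hκ.ne'
  have : Gm κ A r1 r2 = fun s : ℂ => (κ * (A:ℂ) ^ s) * s * ((fun s => Complex.Gamma (s / 2)) s ^ r1 * Complex.Gamma s ^ r2) := rfl
  rw [this, logDeriv_mul (f := fun s : ℂ => (κ * (A:ℂ) ^ s) * s)
      (g := fun s : ℂ => (fun s => Complex.Gamma (s / 2)) s ^ r1 * Complex.Gamma s ^ r2) s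
      (mul_ne_zero (mul_ne_zero n5 n4) n3) (mul_ne_zero (pow_ne_zero _ n2) (pow_ne_zero _ n1))
      ((d3.differentiableAt.const_mul _).mul differentiableAt_id)
      ((d2.differentiableAt.pow r1).mul (d1.pow r2)),
    logDeriv_mul (f := fun s : ℂ => (κ * (A:ℂ) ^ s)) (g := fun s : ℂ => s) s (mul_ne_zero n5 n4) n3
      (d3.differentiableAt.const_mul _) differentiableAt_id,
    logDeriv_const_mul s _ n5,
    logDeriv_mul (f := fun s : ℂ => (fun s => Complex.Gamma (s / 2)) s ^ r1) (g := fun s : ℂ => Complex.Gamma s ^ r2) s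
      (pow_ne_zero _ n2) (pow_ne_zero _ n1) (d2.differentiableAt.pow r1) (d1.pow r2),
    logDeriv_fun_pow d2.differentiableAt r1, logDeriv_fun_pow d1 r2]
  have e1 : logDeriv (fun s : ℂ => (A:ℂ) ^ s) s = Complex.log A := by
    rw [logDeriv_apply, d3.deriv]; field_simp
  have e2 : logDeriv (fun s : ℂ => s) s = 1 / s := by
    rw [logDeriv_apply]; simp
  have e3 : logDeriv (fun s : ℂ => Complex.Gamma (s / 2)) s = Complex.digamma (s / 2) / 2 := by
    rw [logDeriv_apply, d2.deriv, Complex.digamma_def, logDeriv_apply]; ring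
  rw [e1, e2, e3, Complex.digamma_def]
  ring

lemma X_eq {X H : ℂ → ℂ} (hX : Differentiable ℂ X) (hH : Differentiable ℂ H) {κ A : ℝ} (hA : 0 < A) (r1 r2 : ℕ)
    (hHZ : ∀ s : ℂ, 1 < s.re → H s = Zs K s * (s - 1))
    (h : ∀ σ : ℝ, 1 < σ → X σ = ((κ * A ^ σ * (σ * (σ - 1)) * (Real.Gamma (σ / 2) ^ r1 * Real.Gamma σ ^ r2) *
       ∑' I : {I : Ideal (𝓞 K) // I ≠ ⊥}, (Ideal.absNorm I.1 : ℝ) ^ (-σ) : ℝ) : ℂ)) {s : ℂ} (hs : 0 < s.re) :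
    X s = Gm κ A r1 r2 s * H s := by
  have hU : IsOpen {z : ℂ | 0 < z.re} := isOpen_lt continuous_const Complex.continuous_re
  have hc : Convex ℝ {z : ℂ | 0 < z.re} := convex_halfSpace_re_gt 0
  have hG : AnalyticOnNhd ℂ (fun s => Gm κ A r1 r2 s * H s) {z : ℂ | 0 < z.re} := by
    refine DifferentiableOn.analyticOnNhd (fun z hz => ?_) hU
    exact ((Gm_diff hA r1 r2 hz).mul (hH z)).differentiableWithinAt
  refine real_ident (f := X) (g := fun s => Gm κ A r1 r2 s * H s) (fun z _ => hX.analyticAt z) hG hc.isPreconnected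
    (by simp) (fun σ hσ => ?_) hs
  rw [h σ hσ, hHZ σ (by simpa using hσ), Zs, Gm]
  have h1 : (∑' I : {I : Ideal (𝓞 K) // I ≠ ⊥}, (Ideal.absNorm I.1 : ℂ) ^ (-(σ:ℂ))) =
      ((∑' I : {I : Ideal (𝓞 K) // I ≠ ⊥}, (Ideal.absNorm I.1 : ℝ) ^ (-σ) : ℝ) : ℂ) := by
    rw [Complex.ofReal_tsum]
    refine tsum_congr fun I => ?_
    rw [Complex.ofReal_cpow (by positivity)]
    push_cast; rfl
  have h2 : (A:ℂ) ^ (σ:ℂ) = ((A ^ σ : ℝ) : ℂ) := (Complex.ofReal_cpow hA.le σ).symm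
  have h3 : Complex.Gamma ((σ:ℂ) / 2) = (Real.Gamma (σ / 2) : ℂ) := by
    rw [← Complex.Gamma_ofReal]; push_cast; rfl
  rw [h1, h2, h3, Complex.Gamma_ofReal]
  push_cast
  ring

end

end

open Complex NumberField

lemma psi_real_part {t u : ℝ} (ht : 0 < t) (hu : 0 < u) (c e k : ℝ) (hc : 0 ≤ c) (he : 0 ≤ e) :
    (∑' n : ℕ, (-((k:ℂ) / (t + (c * n + e) : ℂ) ^ 2)) * Complex.exp (-(t + (c * n + e) : ℂ) * u)) =
      ((-k * ∑' n : ℕ, (Real.exp u) ^ (-(c * n + e) - t) / (c * n + e + t) ^ 2 : ℝ) : ℂ) := by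
  rw [← tsum_mul_left, Complex.ofReal_tsum]
  refine tsum_congr fun n => ?_
  rw [← Real.exp_mul]
  push_cast
  have h1 : (u:ℂ) * (-(c * n + e) - t) = -(t + (c * n + e)) * u := by ring
  rw [h1]
  ring

/-- Let `K` be a number field of degree `d` with `r₁` real embeddings and
`r₂` pairs of complex embeddings, `zK` its Dedekind zeta function, and `H(s) = zK(s)(s-1)`
the associated entire function. Unconditionally, for any real `t > 1/2` with `H(t) ≠ 0` and
any `x ≥ 2`,
`-H'(t)/H(t) ≤ ∑_{2 ≤ n ≤ x} d·Λ(n)/n^t·(log(x/n)/log x) + (1/log x)(H'/H)'(t)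
 + (1/log x)·Re ∑_ρ m_ρ x^{ρ-t}/(ρ-t)² + ((r₁+r₂)/log x)∑_{n≥0} x^{-2n-t}/(2n+t)²
 + (r₂/log x)∑_{n≥0} x^{-2n-1-t}/(2n+1+t)²`,
where `ρ` runs over the zeros of `zK` with `0 < Re ρ < 1`, with multiplicity `m ρ`. -/
theorem dedekind_H_log_deriv_bound (K : Type*) [Field K] [NumberField K]
    (d r₁ r₂ : ℕ) (hd : d = Module.finrank ℚ K)
    (hr₁ : r₁ = NumberField.InfinitePlace.nrRealPlaces K)
    (hr₂ : r₂ = NumberField.InfinitePlace.nrComplexPlaces K)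
    (zK : ℂ → ℂ)
    (hzK_holo : ∀ s : ℂ, s ≠ 1 → DifferentiableAt ℂ zK s)
    (hzK_eq : ∀ s : ℂ, 1 < s.re →
      zK s = ∑' I : {I : Ideal (𝓞 K) // I ≠ ⊥}, (Ideal.absNorm (I : Ideal (𝓞 K)) : ℂ) ^ (-s))
    (H : ℂ → ℂ) (hH : Differentiable ℂ H)
    (hHzK : ∀ s : ℂ, s ≠ 1 → H s = zK s * (s - 1))
    (t : ℝ) (ht : 1 / 2 < t) (hHt : H (t : ℂ) ≠ 0)
    (x : ℝ) (hx : 2 ≤ x)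
    (m : ℂ → ℕ)
    (hm : ∀ ρ : ℂ, zK ρ = 0 → 0 < ρ.re → ρ.re < 1 →
      ∃ g : ℂ → ℂ, AnalyticAt ℂ g ρ ∧ g ρ ≠ 0 ∧
        ∀ᶠ z in nhds ρ, zK z = (z - ρ) ^ m ρ * g z) :
    (-(deriv H (t : ℂ) / H (t : ℂ))).re ≤
      (∑ n ∈ Finset.Icc 2 ⌊x⌋₊,
        (d : ℝ) * ArithmeticFunction.vonMangoldt n / (n : ℝ) ^ t *
          (Real.log (x / n) / Real.log x)) +
      (1 / Real.log x) * (deriv (fun s => deriv H s / H s) (t : ℂ)).re +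
      (1 / Real.log x) *
        (∑' ρ : {ρ : ℂ // zK ρ = 0 ∧ 0 < ρ.re ∧ ρ.re < 1},
          (m ρ : ℂ) * (x : ℂ) ^ ((ρ : ℂ) - (t : ℂ)) / ((ρ : ℂ) - (t : ℂ)) ^ 2).re +
      ((r₁ + r₂ : ℝ) / Real.log x) *
        ∑' n : ℕ, x ^ (-2 * (n : ℝ) - t) / (2 * (n : ℝ) + t) ^ 2 +
      ((r₂ : ℝ) / Real.log x) *
        ∑' n : ℕ, x ^ (-2 * (n : ℝ) - 1 - t) / (2 * (n : ℝ) + 1 + t) ^ 2 := by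
  have ht0 : 0 < t := by linarith
  have hx0 : 0 < x := by linarith
  have hu : 0 < Real.log x := Real.log_pos (by linarith)
  obtain ⟨X, κ, A, M, c, hX, hκ, hA, hM, hc, hXσ, hfe, hXb, hX0, hX1⟩ := FE_main K
  rw [← hr₁, ← hr₂] at hXσ
  have hs : ∀ σ : ℝ, 1 < σ → Summable fun I : {I : Ideal (𝓞 K) // I ≠ ⊥} => (Ideal.absNorm I.1 : ℝ) ^ (-σ) :=
    fun σ hσ => (hXσ σ hσ).1
  have hre1 : ∀ s : ℂ, s.re < 1 → s ≠ 1 := by rintro s h rfl; simp at h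
  have hHZ : ∀ s : ℂ, 1 < s.re → H s = Zs K s * (s - 1) := by
    intro s h
    rw [hHzK s (by rintro rfl; simp at h), hzK_eq s h, Zs]
  have hXH : ∀ {s : ℂ}, 0 < s.re → X s = Gm κ A r₁ r₂ s * H s := fun h =>
    X_eq hX hH hA r₁ r₂ hHZ (fun σ hσ => (hXσ σ hσ).2) h
  have hH1 : H 1 ≠ 0 := by
    intro h
    apply hX1
    rw [hXH (by simp), h, mul_zero]
  have hHne : ∀ {s : ℂ}, 1 ≤ s.re → H s ≠ 0 := fun h => H_ne hs hH hHZ hH1 h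
  have hXne : ∀ s : ℂ, 1 ≤ s.re → X s ≠ 0 := by
    intro s h
    rw [hXH (by linarith)]
    exact mul_ne_zero (Gm_ne hκ hA _ _ (by linarith)) (hHne h)
  have hXne0 : ∀ s : ℂ, s.re ≤ 0 → X s ≠ 0 := by
    intro s h h0
    refine hXne (1 - s) (by simpa using h) ?_
    rw [hfe, h0, mul_zero]
  have hXt : X t ≠ 0 := by
    rw [hXH (by simpa using ht0)]
    exact mul_ne_zero (Gm_ne hκ hA _ _ (by simpa using ht0)) hHt
  have hXz : ∀ s : ℂ, X s = 0 ↔ (zK s = 0 ∧ 0 < s.re ∧ s.re < 1) := by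
    intro s
    constructor
    · intro h
      have h1 : 0 < s.re := by by_contra h1; exact hXne0 s (by linarith) h
      have h2 : s.re < 1 := by by_contra h2; exact hXne s (by linarith) h
      refine ⟨?_, h1, h2⟩
      rw [hXH h1, hHzK s (hre1 s h2)] at h
      rcases mul_eq_zero.1 h with h | h
      · exact absurd h (Gm_ne hκ hA _ _ h1)
      · rcases mul_eq_zero.1 h with h | h
        · exact h
        · exact absurd (sub_eq_zero.1 h) (hre1 s h2)
    · rintro ⟨h, h1, h2⟩
      rw [hXH h1, hHzK s (hre1 s h2), h]; ring
  have hUo : IsOpen {z : ℂ | 0 < z.re} := isOpen_lt continuous_const Complex.continuous_re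
  have hord : ∀ ρ : ℂ, zK ρ = 0 → 0 < ρ.re → ρ.re < 1 → analyticOrderNatAt X ρ = m ρ := by
    intro ρ h0 h1 h2
    obtain ⟨g, hg, hg0, hgz⟩ := hm ρ h0 h1 h2
    have hGa : AnalyticAt ℂ (Gm κ A r₁ r₂) ρ := by
      have : DifferentiableOn ℂ (Gm κ A r₁ r₂) {z : ℂ | 0 < z.re} := fun z hz =>
        (Gm_diff hA r₁ r₂ hz).differentiableWithinAt
      exact this.analyticOnNhd hUo ρ h1
    refine ord_of (g := fun z => Gm κ A r₁ r₂ z * g z * (z - 1)) (hX.analyticAt ρ)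
      ((hGa.mul hg).mul (analyticAt_id.sub analyticAt_const)) ?_ ?_
    · exact mul_ne_zero (mul_ne_zero (Gm_ne hκ hA _ _ h1) hg0) (sub_ne_zero.2 (hre1 ρ h2))
    · have hne : ∀ᶠ z in nhds ρ, z ≠ 1 := isOpen_ne.mem_nhds (hre1 ρ h2)
      filter_upwards [hgz, hne, hUo.mem_nhds h1] with z hz hz1 hzU
      rw [hXH hzU, hHzK z hz1, hz]
      ring
  have hlog : ∀ s : ℂ, 0 < s.re → H s ≠ 0 → logDeriv H s = logDeriv X s + ((-1) * (Complex.log A) +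
      ((-1) * (1 / s) + ((-(r₁ / 2 : ℂ)) * Complex.digamma (s / 2) + (-(r₂ : ℂ)) * Complex.digamma s))) := by
    intro s h1 h2
    have h3 : X =ᶠ[nhds s] fun s => Gm κ A r₁ r₂ s * H s := by
      filter_upwards [hUo.mem_nhds h1] with z hz using hXH hz
    have h4 : logDeriv X s = logDeriv (fun s => Gm κ A r₁ r₂ s * H s) s := by
      rw [logDeriv_apply, logDeriv_apply, h3.deriv_eq, h3.eq_of_nhds]
    rw [h4, logDeriv_mul (f := Gm κ A r₁ r₂) (g := H) s (Gm_ne hκ hA _ _ h1) h2 (Gm_diff hA _ _ h1) (hH s), Gm_logDeriv hκ hA _ _ h1]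
    ring
  have R1 := rep_X hX ht0 hM hXt hXb hXne
  have R2 := (R1.add (((rep_const t (Complex.log A)).const_mul (-1)).add (((rep_inv ht0).const_mul (-1)).add
    (((rep_psi_half ht0).const_mul (-(r₁ / 2 : ℂ))).add ((rep_psi ht0).const_mul (-(r₂:ℂ)))))))
  have R3 := R2.congr (L' := logDeriv H) (by
    have hHe : ∀ᶠ z in nhds (t:ℂ), H z ≠ 0 := (hH t).continuousAt.eventually_ne hHt
    have htU : (t:ℂ) ∈ {z : ℂ | 0 < z.re} := by simpa using ht0
    filter_upwards [hUo.mem_nhds htU, hHe] with z h1 h2 using hlog z h1 h2)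
    (fun w hw => hlog _ (by simp; linarith) (hHne (by simp; linarith)))
  have key := explicit_main hs hHZ ht0 R3 hu
  have hl1 : deriv (fun s => deriv H s / H s) (t:ℂ) = _ := R3.der.deriv
  rw [← hl1] at key
  -- zero sum
  have hzero : (∑' z : ℂ, ((analyticOrderNatAt X (t + z) : ℂ) / z ^ 2) * Complex.exp (-(-z) * (Real.log x : ℝ))) =
      ∑' ρ : {ρ : ℂ // zK ρ = 0 ∧ 0 < ρ.re ∧ ρ.re < 1},
          (m ρ : ℂ) * (x : ℂ) ^ ((ρ : ℂ) - (t : ℂ)) / ((ρ : ℂ) - (t : ℂ)) ^ 2 := by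
    rw [← (Equiv.subRight (t:ℂ)).tsum_eq]
    simp only [Equiv.subRight_apply, add_sub_cancel]
    rw [← tsum_subtype_eq_of_support_subset (s := {ρ : ℂ | zK ρ = 0 ∧ 0 < ρ.re ∧ ρ.re < 1})]
    · refine tsum_congr fun ρ => ?_
      obtain ⟨ρ, h0, h1, h2⟩ := ρ
      simp only
      rw [hord ρ h0 h1 h2, Complex.cpow_def_of_ne_zero (by exact_mod_cast hx0.ne'), Complex.ofReal_log hx0.le, neg_neg,
        mul_comm (ρ - t)]
      ring
    · intro ρ hρ
      rw [Set.mem_setOf_eq, ← hXz]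
      by_contra h
      apply hρ
      simp [(order_zero_iff hX hXt ρ).2 h]
  -- gamma sums
  have hS : ∀ e : ℝ, 0 ≤ e → Summable fun n : ℕ => x ^ (-(2 * (n:ℝ) + e) - t) / (2 * (n:ℝ) + e + t) ^ 2 := by
    intro e he
    refine Summable.of_nonneg_of_le (fun n => by positivity) (fun n => ?_) (sq_summable ht0)
    have h1 : x ^ (-(2 * (n:ℝ) + e) - t) ≤ 1 := Real.rpow_le_one_of_one_le_of_nonpos (by linarith) (by
      have : 0 ≤ 2 * (n:ℝ) + e := by positivity
      linarith)
    have h2 : 0 < t + n := by positivity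
    have : (0:ℝ) ≤ n := by positivity
    refine div_le_div₀ zero_le_one h1 (by positivity) ?_
    exact pow_le_pow_left₀ h2.le (by linarith) 2
  have p1 := psi_real_part ht0 hu 2 0 2 (by norm_num) le_rfl
  have p2 := psi_real_part ht0 hu 1 0 1 (by norm_num) le_rfl
  rw [Real.exp_log hx0] at p1 p2
  have p3 : (∑' n : ℕ, x ^ (-(1 * (n:ℝ) + 0) - t) / (1 * (n:ℝ) + 0 + t) ^ 2) =
      (∑' n : ℕ, x ^ (-2 * (n : ℝ) - t) / (2 * (n : ℝ) + t) ^ 2) +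
        ∑' n : ℕ, x ^ (-2 * (n : ℝ) - 1 - t) / (2 * (n : ℝ) + 1 + t) ^ 2 := by
    rw [← tsum_even_add_odd (f := fun n : ℕ => x ^ (-(1 * (n:ℝ) + 0) - t) / (1 * (n:ℝ) + 0 + t) ^ 2)]
    · congr 1
      · refine tsum_congr fun n => ?_
        push_cast; ring_nf
      · refine tsum_congr fun n => ?_
        push_cast; ring_nf
    · refine (hS 0 le_rfl).congr fun n => ?_
      push_cast; ring_nf
    · refine (hS 1 zero_le_one).congr fun n => ?_
      push_cast; ring_nf
  have p4 : (∑' n : ℕ, x ^ (-(2 * (n:ℝ) + 0) - t) / (2 * (n:ℝ) + 0 + t) ^ 2) =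
      (∑' n : ℕ, x ^ (-2 * (n : ℝ) - t) / (2 * (n : ℝ) + t) ^ 2) := by
    refine tsum_congr fun n => ?_
    ring_nf
  rw [p3] at p2
  rw [p4] at p1
  set S0 := ∑' n : ℕ, x ^ (-2 * (n : ℝ) - t) / (2 * (n : ℝ) + t) ^ 2 with hS0
  set S1 := ∑' n : ℕ, x ^ (-2 * (n : ℝ) - 1 - t) / (2 * (n : ℝ) + 1 + t) ^ 2 with hS1
  have hinv : (1 / (t:ℂ) ^ 2 * Complex.exp (-(t:ℂ) * (Real.log x : ℝ))) =
      ((1 / t ^ 2 * Real.exp (-t * Real.log x) : ℝ) : ℂ) := by push_cast; rfl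
  have hinvpos : 0 ≤ 1 / t ^ 2 * Real.exp (-t * Real.log x) := by positivity
  simp only [Complex.ofReal_zero, add_zero, Complex.ofReal_one, Complex.ofReal_ofNat, one_mul] at p1 p2
  rw [hzero, hinv, p1, p2] at key
  have hr1c : (-((r₁:ℂ) / 2)) = ((-((r₁:ℝ) / 2) : ℝ) : ℂ) := by push_cast; rfl
  have hr2c : (-(r₂:ℂ)) = ((-(r₂:ℝ) : ℝ) : ℂ) := by push_cast; rfl
  rw [hr1c, hr2c] at key
  simp only [mul_zero, zero_add, ← Complex.ofReal_mul, Complex.add_re, Complex.ofReal_re, neg_mul, one_mul, Complex.neg_re] at key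
  have hfb := f_bound (K := K) (t := t) hx
  rw [← hd, Finset.mul_sum] at hfb
  have hsum : (∑ n ∈ Finset.Icc 2 ⌊x⌋₊,
        (d : ℝ) * ArithmeticFunction.vonMangoldt n / (n : ℝ) ^ t *
          (Real.log (x / n) / Real.log x)) = (∑ n ∈ Finset.Icc 2 ⌊x⌋₊,
        (d : ℝ) * (ArithmeticFunction.vonMangoldt n / (n : ℝ) ^ t * Real.log (x / n))) / Real.log x := by
    rw [Finset.sum_div]
    refine Finset.sum_congr rfl fun n _ => ?_
    ring
  rw [hsum, Complex.neg_re]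
  rw [logDeriv_apply] at key
  set Q := ∑ n ∈ Finset.Icc 2 ⌊x⌋₊,
        (d : ℝ) * (ArithmeticFunction.vonMangoldt n / (n : ℝ) ^ t * Real.log (x / n))
  generalize (deriv H (t:ℂ) / H t).re = y at *
  generalize (deriv (fun s => deriv H s / H s) (t:ℂ)).re = y' at *
  have hfin : -y * Real.log x ≤ Q + y' + (∑' ρ : {ρ : ℂ // zK ρ = 0 ∧ 0 < ρ.re ∧ ρ.re < 1},
          (m ρ : ℂ) * (x : ℂ) ^ ((ρ : ℂ) - (t : ℂ)) / ((ρ : ℂ) - (t : ℂ)) ^ 2).re + (r₁ + r₂) * S0 + r₂ * S1 := by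
    rw [neg_mul] at hinvpos
    linarith
  calc -y = -y * Real.log x / Real.log x := by field_simp
    _ ≤ _ := div_le_div_of_nonneg_right hfin hu.le
    _ = _ := by ring
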